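/- Suppose m ≠ n, T is Σ1-sound, and m, n ≥ 1. Then there exists a Σ1 provability predicate PR_T(x) of T such that: (1) for any modal formula A and any arithmetical interpretation f based on PR_T(x), if N⁺A_{m,n} ⊢ A then T ⊢ f(A); and (2) there exists an arithmetical interpretation f based on PR_T(x) such that for every modal formula A, N⁺A_{m,n} ⊢ A if and only if T ⊢ f(A). -/

import Mathlib

namespace PLN

/-! ### Modal formulas and the logics N⁺A_{m,n} -/

/-- Formulas of modal propositional logic. -/
inductive MFml : Type
  | var : ℕ → MFml
  | bot : MFml
  | neg : MFml → MFml
  | and : MFml → MFml → MFml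
  | or : MFml → MFml → MFml
  | imp : MFml → MFml → MFml
  | box : MFml → MFml
  deriving DecidableEq

/-- `boxIter n A` is `□ⁿ A`, where `□⁰ A = A` and `□^(k+1) A = □ (□ᵏ A)`. -/
def boxIter : ℕ → MFml → MFml
  | 0, A => A
  | k + 1, A => .box (boxIter k A)

/-- Evaluation of a modal formula under a valuation of its "propositional atoms"
(propositional variables, and boxed formulas); used to define propositional tautologies
in the modal language. -/
def MFml.evalTC (v : MFml → Prop) : MFml → Prop
  | .bot => False
  | .neg A => ¬ A.evalTC v
  | .and A B => A.evalTC v ∧ B.evalTC v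
  | .or A B => A.evalTC v ∨ B.evalTC v
  | .imp A B => A.evalTC v → B.evalTC v
  | A => v A

/-- Propositional tautologies in the modal language. -/
def MTaut (A : MFml) : Prop := ∀ v, A.evalTC v

/-- Provability in the logic `N⁺A_{m,n}`: the pure logic of necessitation `N`
(propositional tautologies, modus ponens, necessitation) together with the axiom scheme
`□ⁿA → □ᵐA` and the rule `Ros□` (from `¬□A` infer `¬□□A`). -/
inductive NAProves (m n : ℕ) : MFml → Prop
  | taut {A} : MTaut A → NAProves m n A
  | acc (A) : NAProves m n (.imp (boxIter n A) (boxIter m A))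
  | mp {A B} : NAProves m n (.imp A B) → NAProves m n A → NAProves m n B
  | nec {A} : NAProves m n A → NAProves m n (.box A)
  | ros {A} : NAProves m n (.neg (.box A)) → NAProves m n (.neg (.box (.box A)))

/-- `IsSub B A` : `B` is a subformula of `A`. -/
inductive IsSub : MFml → MFml → Prop
  | refl (A) : IsSub A A
  | neg {B A} : IsSub B A → IsSub B (.neg A)
  | andL {B A C} : IsSub B A → IsSub B (.and A C)
  | andR {B A C} : IsSub B C → IsSub B (.and A C)
  | orL {B A C} : IsSub B A → IsSub B (.or A C)
  | orR {B A C} : IsSub B C → IsSub B (.or A C)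
  | impL {B A C} : IsSub B A → IsSub B (.imp A C)
  | impR {B A C} : IsSub B C → IsSub B (.imp A C)
  | box {B A} : IsSub B A → IsSub B (.box A)

/-! ### N-frames and N-models -/

/-- An N-model on a set `W` of worlds: an N-frame (a binary relation `≺_B` on `W`
for each modal formula `B`) together with a valuation of propositional variables. -/
structure NModel (W : Type) where
  rel : MFml → W → W → Prop
  val : W → ℕ → Prop

/-- The forcing relation of an N-model:
`x ⊩ □B` iff every `y` with `x ≺_B y` satisfies `y ⊩ B`. -/
def NModel.Forces {W : Type} (M : NModel W) : W → MFml → Prop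
  | x, .var p => M.val x p
  | _, .bot => False
  | x, .neg A => ¬ NModel.Forces M x A
  | x, .and A B => NModel.Forces M x A ∧ NModel.Forces M x B
  | x, .or A B => NModel.Forces M x A ∨ NModel.Forces M x B
  | x, .imp A B => NModel.Forces M x A → NModel.Forces M x B
  | x, .box A => ∀ y, M.rel A x y → NModel.Forces M y A

/-- The relations `≺_B^k` : `x ≺_B^0 y` iff `x = y`, and
`x ≺_B^(k+1) y` iff `∃ w, x ≺_{□ᵏB} w` and `w ≺_B^k y`. -/
def NModel.relIter {W : Type} (M : NModel W) (B : MFml) : ℕ → W → W → Prop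
  | 0, x, y => x = y
  | k + 1, x, y => ∃ w, M.rel (boxIter k B) x w ∧ NModel.relIter M B k w y

/-- `(m,n)`-accessibility of (the frame of) an N-model. -/
def NModel.Accessible {W : Type} (M : NModel W) (m n : ℕ) : Prop :=
  ∀ (B : MFml) (x y : W), NModel.relIter M B m x y → NModel.relIter M B n x y

/-! ### The language of first-order arithmetic -/

/-- Terms of the language of arithmetic, with de Bruijn variables. -/
inductive ATerm : Type
  | var : ℕ → ATerm
  | zero : ATerm
  | succ : ATerm → ATerm
  | add : ATerm → ATerm → ATerm
  | mul : ATerm → ATerm → ATerm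
  deriving DecidableEq

/-- Formulas of the language of arithmetic (with `≤` primitive), de Bruijn variables. -/
inductive AFml : Type
  | eq : ATerm → ATerm → AFml
  | le : ATerm → ATerm → AFml
  | neg : AFml → AFml
  | and : AFml → AFml → AFml
  | or : AFml → AFml → AFml
  | imp : AFml → AFml → AFml
  | all : AFml → AFml
  | ex : AFml → AFml
  deriving DecidableEq

/-- Lift (shift up by one) the variables `≥ c` of a term. -/
def ATerm.lift (c : ℕ) : ATerm → ATerm
  | .var n => .var (if n < c then n else n + 1)
  | .zero => .zero
  | .succ t => .succ (t.lift c)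
  | .add t s => .add (t.lift c) (s.lift c)
  | .mul t s => .mul (t.lift c) (s.lift c)

/-- Simultaneous substitution in terms. -/
def ATerm.substAll (σ : ℕ → ATerm) : ATerm → ATerm
  | .var n => σ n
  | .zero => .zero
  | .succ t => .succ (t.substAll σ)
  | .add t s => .add (t.substAll σ) (s.substAll σ)
  | .mul t s => .mul (t.substAll σ) (s.substAll σ)

/-- Pushing a substitution under a binder. -/
def liftSub (σ : ℕ → ATerm) : ℕ → ATerm
  | 0 => .var 0
  | n + 1 => (σ n).lift 0

/-- Lift (shift up by one) the free variables `≥ c` of a formula. -/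
def AFml.lift (c : ℕ) : AFml → AFml
  | .eq t s => .eq (t.lift c) (s.lift c)
  | .le t s => .le (t.lift c) (s.lift c)
  | .neg φ => .neg (φ.lift c)
  | .and φ ψ => .and (φ.lift c) (ψ.lift c)
  | .or φ ψ => .or (φ.lift c) (ψ.lift c)
  | .imp φ ψ => .imp (φ.lift c) (ψ.lift c)
  | .all φ => .all (φ.lift (c + 1))
  | .ex φ => .ex (φ.lift (c + 1))

/-- Simultaneous (capture-avoiding) substitution in formulas. -/
def AFml.substAll (σ : ℕ → ATerm) : AFml → AFml
  | .eq t s => .eq (t.substAll σ) (s.substAll σ)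
  | .le t s => .le (t.substAll σ) (s.substAll σ)
  | .neg φ => .neg (φ.substAll σ)
  | .and φ ψ => .and (φ.substAll σ) (ψ.substAll σ)
  | .or φ ψ => .or (φ.substAll σ) (ψ.substAll σ)
  | .imp φ ψ => .imp (φ.substAll σ) (ψ.substAll σ)
  | .all φ => .all (φ.substAll (liftSub σ))
  | .ex φ => .ex (φ.substAll (liftSub σ))

def subst0Env (t : ATerm) : ℕ → ATerm
  | 0 => t
  | n + 1 => .var n

def subst2Env (t s : ATerm) : ℕ → ATerm
  | 0 => t
  | 1 => s
  | n + 2 => .var n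

/-- Substitute the term `t` for the free variable `0` (decrementing other variables). -/
def AFml.subst0 (φ : AFml) (t : ATerm) : AFml := φ.substAll (subst0Env t)

/-- Substitute the terms `t`, `s` for the free variables `0`, `1` simultaneously. -/
def AFml.subst2 (φ : AFml) (t s : ATerm) : AFml := φ.substAll (subst2Env t s)

/-- Substitute `S(var 0)` for `var 0`, leaving all other free variables unchanged. -/
def succSubst (φ : AFml) : AFml :=
  φ.substAll fun n => if n = 0 then .succ (.var 0) else .var n

/-- All variables of a term are `< c`. -/
def ATerm.FreeLt (c : ℕ) : ATerm → Prop
  | .var n => n < c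
  | .zero => True
  | .succ t => t.FreeLt c
  | .add t s => t.FreeLt c ∧ s.FreeLt c
  | .mul t s => t.FreeLt c ∧ s.FreeLt c

/-- All free variables of a formula are `< c`; `FreeLt 0 φ` says that `φ` is a sentence. -/
def AFml.FreeLt (c : ℕ) : AFml → Prop
  | .eq t s => t.FreeLt c ∧ s.FreeLt c
  | .le t s => t.FreeLt c ∧ s.FreeLt c
  | .neg φ => φ.FreeLt c
  | .and φ ψ => φ.FreeLt c ∧ ψ.FreeLt c
  | .or φ ψ => φ.FreeLt c ∧ ψ.FreeLt c
  | .imp φ ψ => φ.FreeLt c ∧ ψ.FreeLt c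
  | .all φ => φ.FreeLt (c + 1)
  | .ex φ => φ.FreeLt (c + 1)

/-- The numeral `n̄`. -/
def numeral : ℕ → ATerm
  | 0 => .zero
  | n + 1 => .succ (numeral n)

/-- A Gödel numbering of terms. -/
def ATerm.code : ATerm → ℕ
  | .var n => Nat.pair 0 n
  | .zero => Nat.pair 1 0
  | .succ t => Nat.pair 2 t.code
  | .add t s => Nat.pair 3 (Nat.pair t.code s.code)
  | .mul t s => Nat.pair 4 (Nat.pair t.code s.code)

/-- A Gödel numbering of formulas. -/
def AFml.code : AFml → ℕ
  | .eq t s => Nat.pair 0 (Nat.pair t.code s.code)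
  | .le t s => Nat.pair 1 (Nat.pair t.code s.code)
  | .neg φ => Nat.pair 2 φ.code
  | .and φ ψ => Nat.pair 3 (Nat.pair φ.code ψ.code)
  | .or φ ψ => Nat.pair 4 (Nat.pair φ.code ψ.code)
  | .imp φ ψ => Nat.pair 5 (Nat.pair φ.code ψ.code)
  | .all φ => Nat.pair 6 φ.code
  | .ex φ => Nat.pair 7 φ.code

/-- `⌜φ⌝`, the numeral of the Gödel number of `φ`. -/
def gnum (φ : AFml) : ATerm := numeral φ.code

/-- For a formula `P(x)` (with free variable `var 0`), `P.appNum φ` is `P(⌜φ⌝)`. -/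
def AFml.appNum (P φ : AFml) : AFml := P.subst0 (gnum φ)

/-- Iterated application of a predicate: `iterPred P k φ = P(⌜P(⌜⋯P(⌜φ⌝)⋯⌝)⌝)` (`k` times). -/
def iterPred (P : AFml) : ℕ → AFml → AFml
  | 0, φ => φ
  | k + 1, φ => P.appNum (iterPred P k φ)

/-! ### Satisfaction in the standard model -/

def ATerm.val (ρ : ℕ → ℕ) : ATerm → ℕ
  | .var n => ρ n
  | .zero => 0
  | .succ t => t.val ρ + 1
  | .add t s => t.val ρ + s.val ρ
  | .mul t s => t.val ρ * s.val ρ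

def consEnv (a : ℕ) (ρ : ℕ → ℕ) : ℕ → ℕ
  | 0 => a
  | n + 1 => ρ n

/-- Satisfaction in the standard model `ℕ` under an environment `ρ`. -/
def AFml.Sat (ρ : ℕ → ℕ) : AFml → Prop
  | .eq t s => t.val ρ = s.val ρ
  | .le t s => t.val ρ ≤ s.val ρ
  | .neg φ => ¬ φ.Sat ρ
  | .and φ ψ => φ.Sat ρ ∧ ψ.Sat ρ
  | .or φ ψ => φ.Sat ρ ∨ ψ.Sat ρ
  | .imp φ ψ => φ.Sat ρ → ψ.Sat ρ
  | .all φ => ∀ a, φ.Sat (consEnv a ρ)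
  | .ex φ => ∃ a, φ.Sat (consEnv a ρ)

/-- `ℕ ⊨ φ`. -/
def TrueN (φ : AFml) : Prop := φ.Sat fun _ => 0

/-! ### The arithmetical hierarchy: Δ₀, Σ₁, Π₁ -/

/-- `Δ₀` formulas: every quantifier is bounded. -/
inductive IsDelta0 : AFml → Prop
  | eq (t s : ATerm) : IsDelta0 (.eq t s)
  | le (t s : ATerm) : IsDelta0 (.le t s)
  | neg {φ} : IsDelta0 φ → IsDelta0 (.neg φ)
  | and {φ ψ} : IsDelta0 φ → IsDelta0 ψ → IsDelta0 (.and φ ψ)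
  | or {φ ψ} : IsDelta0 φ → IsDelta0 ψ → IsDelta0 (.or φ ψ)
  | imp {φ ψ} : IsDelta0 φ → IsDelta0 ψ → IsDelta0 (.imp φ ψ)
  | ball {φ : AFml} (t : ATerm) : IsDelta0 φ → IsDelta0 (.all (.imp (.le (.var 0) (ATerm.lift 0 t)) φ))
  | bex {φ : AFml} (t : ATerm) : IsDelta0 φ → IsDelta0 (.ex (.and (.le (.var 0) (ATerm.lift 0 t)) φ))

mutual
  /-- `Σ₁` formulas. -/
  inductive IsSigma1 : AFml → Prop
    | delta0 {φ} : IsDelta0 φ → IsSigma1 φ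
    | and {φ ψ} : IsSigma1 φ → IsSigma1 ψ → IsSigma1 (.and φ ψ)
    | or {φ ψ} : IsSigma1 φ → IsSigma1 ψ → IsSigma1 (.or φ ψ)
    | ex {φ} : IsSigma1 φ → IsSigma1 (.ex φ)
    | negPi {φ} : IsPi1 φ → IsSigma1 (.neg φ)
    | impPiSigma {φ ψ} : IsPi1 φ → IsSigma1 ψ → IsSigma1 (.imp φ ψ)
  /-- `Π₁` formulas. -/
  inductive IsPi1 : AFml → Prop
    | delta0 {φ} : IsDelta0 φ → IsPi1 φ
    | and {φ ψ} : IsPi1 φ → IsPi1 ψ → IsPi1 (.and φ ψ)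
    | or {φ ψ} : IsPi1 φ → IsPi1 ψ → IsPi1 (.or φ ψ)
    | all {φ} : IsPi1 φ → IsPi1 (.all φ)
    | negSigma {φ} : IsSigma1 φ → IsPi1 (.neg φ)
    | impSigmaPi {φ ψ} : IsSigma1 φ → IsPi1 ψ → IsPi1 (.imp φ ψ)
end

/-! ### A Hilbert-style proof system for first-order arithmetic -/

/-- Evaluation of an arithmetical formula under a valuation of its "propositionally atomic"
subformulas (atomic or quantified formulas); used for propositional tautologies and
tautological consequence. -/
def AFml.evalProp (v : AFml → Prop) : AFml → Prop
  | .neg φ => ¬ φ.evalProp v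
  | .and φ ψ => φ.evalProp v ∧ ψ.evalProp v
  | .or φ ψ => φ.evalProp v ∨ ψ.evalProp v
  | .imp φ ψ => φ.evalProp v → ψ.evalProp v
  | φ => v φ

/-- Propositional tautologies in the language of arithmetic. -/
def ATaut (φ : AFml) : Prop := ∀ v, φ.evalProp v

/-- `φ` is a tautological consequence of the set `X` of formulas. -/
def TC (X : Set AFml) (φ : AFml) : Prop :=
  ∀ v : AFml → Prop, (∀ ψ ∈ X, ψ.evalProp v) → φ.evalProp v

def iffF (φ ψ : AFml) : AFml := .and (.imp φ ψ) (.imp ψ φ)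

/-- Hilbert-style provability from the set of axioms `Γ` in classical first-order
logic with equality. -/
inductive Proves (Γ : Set AFml) : AFml → Prop
  | ax {φ} : φ ∈ Γ → Proves Γ φ
  | taut {φ} : ATaut φ → Proves Γ φ
  | mp {φ ψ} : Proves Γ (.imp φ ψ) → Proves Γ φ → Proves Γ ψ
  | allE (φ : AFml) (t : ATerm) : Proves Γ (.imp (.all φ) (φ.subst0 t))
  | exI (φ : AFml) (t : ATerm) : Proves Γ (.imp (φ.subst0 t) (.ex φ))
  | allImp (φ ψ : AFml) : Proves Γ (.imp (.all (.imp φ ψ)) (.imp (.all φ) (.all ψ)))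
  | vacAll (φ : AFml) : Proves Γ (.imp φ (.all (AFml.lift 0 φ)))
  | exDef (φ : AFml) : Proves Γ (iffF (.ex φ) (.neg (.all (.neg φ))))
  | gen {φ} : Proves Γ φ → Proves Γ (.all φ)
  | eqRefl (t : ATerm) : Proves Γ (.eq t t)
  | eqSubst (φ : AFml) (t s : ATerm) : Proves Γ (.imp (.eq t s) (.imp (φ.subst0 t) (φ.subst0 s)))

/-! ### Peano arithmetic -/

/-- The axioms of Peano arithmetic. -/
inductive PAax : AFml → Prop
  | succNeZero : PAax (.all (.neg (.eq (.succ (.var 0)) .zero)))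
  | succInj :
      PAax (.all (.all (.imp (.eq (.succ (.var 1)) (.succ (.var 0))) (.eq (.var 1) (.var 0)))))
  | addZero : PAax (.all (.eq (.add (.var 0) .zero) (.var 0)))
  | addSucc :
      PAax (.all (.all (.eq (.add (.var 1) (.succ (.var 0))) (.succ (.add (.var 1) (.var 0))))))
  | mulZero : PAax (.all (.eq (.mul (.var 0) .zero) .zero))
  | mulSucc :
      PAax (.all (.all (.eq (.mul (.var 1) (.succ (.var 0)))
        (.add (.mul (.var 1) (.var 0)) (.var 1)))))
  | leDef :
      PAax (.all (.all (iffF (.le (.var 1) (.var 0))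
        (.ex (.eq (.add (.var 0) (.var 2)) (.var 1))))))
  | ind (φ : AFml) :
      PAax (.imp (.and (φ.subst0 .zero) (.all (.imp φ (succSubst φ)))) (.all φ))

/-- Peano arithmetic, as a set of axioms. -/
def PA : Set AFml := {φ | PAax φ}

/-- The sentence `0 = 1`. -/
def botFml : AFml := .eq .zero (.succ .zero)

/-- `t < s`, as the formula `S(t) ≤ s`. -/
def ltF (t s : ATerm) : AFml := .le (.succ t) s

/-- `Δ₁(PA)` formulas: `Σ₁` formulas which are `PA`-provably equivalent to a `Π₁` formula. -/
def IsDelta1PA (φ : AFml) : Prop :=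
  IsSigma1 φ ∧ ∃ ψ, IsPi1 ψ ∧ Proves PA (iffF φ ψ)

/-! ### Theories, provability predicates, arithmetical interpretations -/

/-- `Tax` is primitive recursively axiomatized (via the Gödel numbering). -/
def PrAxiomatized (Tax : Set AFml) : Prop :=
  ∃ p : ℕ → Bool, Primrec p ∧ ∀ φ : AFml, φ ∈ Tax ↔ p φ.code = true

/-- `Σ₁`-soundness: every `T`-provable `Σ₁` sentence is true in `ℕ`. -/
def Sigma1Sound (Tax : Set AFml) : Prop :=
  ∀ φ : AFml, IsSigma1 φ → φ.FreeLt 0 → Proves Tax φ → TrueN φ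

/-- `P` is a provability predicate of `T`: a formula `P(x)` with at most the free
variable `x` such that for every formula `φ`, `T ⊢ φ` iff `PA ⊢ P(⌜φ⌝)`. -/
def IsProvPred (Tax : Set AFml) (P : AFml) : Prop :=
  P.FreeLt 1 ∧ ∀ φ : AFml, Proves Tax φ ↔ Proves PA (P.appNum φ)

/-- `f` is an arithmetical interpretation based on the predicate `P`. -/
def IsInterp (P : AFml) (f : MFml → AFml) : Prop :=
  (∀ i, (f (.var i)).FreeLt 0) ∧
  f .bot = botFml ∧
  (∀ A, f (.neg A) = .neg (f A)) ∧
  (∀ A B, f (.and A B) = .and (f A) (f B)) ∧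
  (∀ A B, f (.or A B) = .or (f A) (f B)) ∧
  (∀ A B, f (.imp A B) = .imp (f A) (f B)) ∧
  (∀ A, f (.box A) = P.appNum (f A))

/-- The provability logic of the predicate `P` (relative to the theory `Tax`). -/
def PL (Tax : Set AFml) (P : AFml) : Set MFml :=
  {A | ∀ f : MFml → AFml, IsInterp P f → Proves Tax (f A)}

/-- The formulas with a `T`-proof of code `≤ s` (relative to a proof enumeration `prf`). -/
def PTset (prf : ℕ → Option AFml) (s : ℕ) : Set AFml :=
  {φ | ∃ y ≤ s, prf y = some φ}

/-! ## Part A1: substitution and models -/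

def scons {α : Type} (a : α) (ρ : ℕ → α) : ℕ → α
  | 0 => a
  | n + 1 => ρ n

def shiftEnv (c : ℕ) : ℕ → ATerm := fun n => .var (if n < c then n else n + 1)

theorem ATerm.lift_eq (c : ℕ) (t : ATerm) : t.lift c = t.substAll (shiftEnv c) := by
  induction t <;> simp_all [ATerm.lift, ATerm.substAll, shiftEnv]

theorem liftSub_shift (c : ℕ) : liftSub (shiftEnv c) = shiftEnv (c + 1) := by
  funext n
  cases n with
  | zero => simp [liftSub, shiftEnv]
  | succ n =>
    simp only [liftSub, shiftEnv, ATerm.lift]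
    congr 1
    split_ifs <;> omega

theorem AFml.lift_eq (φ : AFml) : ∀ c, φ.lift c = φ.substAll (shiftEnv c) := by
  induction φ <;> intro c <;>
    simp_all [AFml.lift, AFml.substAll, ATerm.lift_eq, liftSub_shift]

theorem ATerm.substAll_comp (σ τ : ℕ → ATerm) (t : ATerm) :
    (t.substAll σ).substAll τ = t.substAll (fun n => (σ n).substAll τ) := by
  induction t <;> simp_all [ATerm.substAll]

theorem ATerm.substAll_congr {σ τ : ℕ → ATerm} (c : ℕ) (t : ATerm) (ht : t.FreeLt c)
    (h : ∀ n < c, σ n = τ n) : t.substAll σ = t.substAll τ := by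
  induction t <;> simp_all [ATerm.substAll, ATerm.FreeLt]

theorem AFml.substAll_congr (φ : AFml) : ∀ {σ τ : ℕ → ATerm} (c : ℕ), φ.FreeLt c →
    (∀ n < c, σ n = τ n) → φ.substAll σ = φ.substAll τ := by
  have key : ∀ (σ τ : ℕ → ATerm) (c : ℕ), (∀ n < c, σ n = τ n) →
      ∀ n < c + 1, liftSub σ n = liftSub τ n := by
    intro σ τ c h n hn
    cases n with
    | zero => rfl
    | succ n => simp [liftSub, h n (by omega)]
  induction φ with
  | eq t s | le t s =>
    intro σ τ c hf h
    simp [AFml.substAll, ATerm.substAll_congr c t hf.1 h, ATerm.substAll_congr c s hf.2 h]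
  | neg φ ih => intro σ τ c hf h; simp [AFml.substAll, ih c hf h]
  | and φ ψ ih ih' | or φ ψ ih ih' | imp φ ψ ih ih' =>
    intro σ τ c hf h
    simp [AFml.substAll, ih c hf.1 h, ih' c hf.2 h]
  | all φ ih | ex φ ih =>
    intro σ τ c hf h
    simp [AFml.substAll, ih (c + 1) hf (key _ _ _ h)]

theorem ATerm.lift_liftSub (τ : ℕ → ATerm) (t : ATerm) :
    (t.lift 0).substAll (liftSub τ) = (t.substAll τ).lift 0 := by
  induction t <;> simp_all [ATerm.substAll, ATerm.lift, liftSub]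

theorem liftSub_comp (σ τ : ℕ → ATerm) :
    (fun n => (liftSub σ n).substAll (liftSub τ)) = liftSub (fun n => (σ n).substAll τ) := by
  funext n
  cases n with
  | zero => rfl
  | succ n => simp [liftSub, ATerm.lift_liftSub]

theorem AFml.substAll_comp (φ : AFml) : ∀ (σ τ : ℕ → ATerm),
    (φ.substAll σ).substAll τ = φ.substAll (fun n => (σ n).substAll τ) := by
  induction φ <;> intro σ τ <;>
    simp_all [AFml.substAll, ATerm.substAll_comp, liftSub_comp]

theorem ATerm.substAll_var (t : ATerm) : t.substAll ATerm.var = t := by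
  induction t <;> simp_all [ATerm.substAll]

theorem liftSub_var : liftSub ATerm.var = ATerm.var := by
  funext n
  cases n <;> simp [liftSub, ATerm.lift]

theorem AFml.substAll_var (φ : AFml) : φ.substAll ATerm.var = φ := by
  induction φ <;> simp_all [AFml.substAll, ATerm.substAll_var, liftSub_var]

theorem ATerm.lift_subst0 (t s : ATerm) : (t.lift 0).substAll (subst0Env s) = t := by
  induction t <;> simp_all [ATerm.substAll, ATerm.lift, subst0Env]

theorem subst0_liftSub (φ : AFml) (σ : ℕ → ATerm) (t : ATerm) :
    (φ.substAll (liftSub σ)).subst0 t = φ.substAll (scons t σ) := by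
  rw [AFml.subst0, AFml.substAll_comp]
  congr 1
  funext n
  cases n with
  | zero => rfl
  | succ n => simp [liftSub, ATerm.lift_subst0, scons]

theorem subst0_substAll (φ : AFml) (σ : ℕ → ATerm) (t : ATerm) :
    (φ.subst0 t).substAll σ = φ.substAll (scons (t.substAll σ) σ) := by
  rw [AFml.subst0, AFml.substAll_comp]
  congr 1
  funext n
  cases n with
  | zero => rfl
  | succ n => simp [subst0Env, scons, ATerm.substAll]

theorem ATerm.FreeLt.mono {t : ATerm} {c d : ℕ} (h : t.FreeLt c) (hcd : c ≤ d) : t.FreeLt d := by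
  induction t <;> simp_all [ATerm.FreeLt]
  omega

theorem AFml.FreeLt.mono {φ : AFml} : ∀ {c d : ℕ}, φ.FreeLt c → c ≤ d → φ.FreeLt d := by
  induction φ with
  | eq t s | le t s => intro c d h hcd; exact ⟨h.1.mono hcd, h.2.mono hcd⟩
  | neg φ ih => intro c d h hcd; exact ih (c := c) h hcd
  | and φ ψ ih ih' | or φ ψ ih ih' | imp φ ψ ih ih' =>
    intro c d h hcd; exact ⟨ih h.1 hcd, ih' h.2 hcd⟩
  | all φ ih | ex φ ih => intro c d h hcd; exact ih (c := c + 1) h (by omega)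

theorem ATerm.exists_freeLt (t : ATerm) : ∃ c, t.FreeLt c := by
  induction t with
  | var n => exact ⟨n + 1, Nat.lt_succ_self n⟩
  | zero => exact ⟨0, trivial⟩
  | succ t ih => exact ih
  | add t s ih ih' | mul t s ih ih' =>
    obtain ⟨c, hc⟩ := ih
    obtain ⟨d, hd⟩ := ih'
    exact ⟨max c d, hc.mono (le_max_left _ _), hd.mono (le_max_right _ _)⟩

theorem AFml.exists_freeLt (φ : AFml) : ∃ c, φ.FreeLt c := by
  induction φ with
  | eq t s | le t s =>
    obtain ⟨c, hc⟩ := t.exists_freeLt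
    obtain ⟨d, hd⟩ := s.exists_freeLt
    exact ⟨max c d, hc.mono (le_max_left _ _), hd.mono (le_max_right _ _)⟩
  | neg φ ih => exact ih
  | and φ ψ ih ih' | or φ ψ ih ih' | imp φ ψ ih ih' =>
    obtain ⟨c, hc⟩ := ih
    obtain ⟨d, hd⟩ := ih'
    exact ⟨max c d, hc.mono (le_max_left _ _), hd.mono (le_max_right _ _)⟩
  | all φ ih | ex φ ih =>
    obtain ⟨c, hc⟩ := ih
    exact ⟨c, AFml.FreeLt.mono (φ := φ) hc (by omega)⟩

theorem ATerm.FreeLt.lift0 {t : ATerm} {c : ℕ} (h : t.FreeLt c) : (t.lift 0).FreeLt (c + 1) := by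
  induction t <;> simp_all [ATerm.FreeLt, ATerm.lift]

theorem ATerm.FreeLt.substAll {t : ATerm} {σ : ℕ → ATerm} {c d : ℕ} (h : t.FreeLt c)
    (hσ : ∀ n < c, (σ n).FreeLt d) : (t.substAll σ).FreeLt d := by
  induction t <;> simp_all [ATerm.FreeLt, ATerm.substAll]

theorem AFml.FreeLt.substAll {φ : AFml} : ∀ {σ : ℕ → ATerm} {c d : ℕ}, φ.FreeLt c →
    (∀ n < c, (σ n).FreeLt d) → (φ.substAll σ).FreeLt d := by
  have key : ∀ {σ : ℕ → ATerm} {c d : ℕ}, (∀ n < c, (σ n).FreeLt d) →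
      ∀ n < c + 1, (liftSub σ n).FreeLt (d + 1) := by
    intro σ c d h n hn
    cases n with
    | zero => exact Nat.succ_pos d
    | succ n => exact (h n (by omega)).lift0
  induction φ with
  | eq t s | le t s =>
    intro σ c d hf h
    exact ⟨hf.1.substAll h, hf.2.substAll h⟩
  | neg φ ih => intro σ c d hf h; exact ih (c := c) hf h
  | and φ ψ ih ih' | or φ ψ ih ih' | imp φ ψ ih ih' =>
    intro σ c d hf h
    exact ⟨ih hf.1 h, ih' hf.2 h⟩
  | all φ ih | ex φ ih =>
    intro σ c d hf h
    exact ih (c := c + 1) (d := d + 1) hf (key h)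

/-- Structures for the language of arithmetic. -/
structure Mdl where
  D : Type
  zero : D
  succ : D → D
  add : D → D → D
  mul : D → D → D
  le : D → D → Prop

def Mdl.val (M : Mdl) (ρ : ℕ → M.D) : ATerm → M.D
  | .var n => ρ n
  | .zero => M.zero
  | .succ t => M.succ (M.val ρ t)
  | .add t s => M.add (M.val ρ t) (M.val ρ s)
  | .mul t s => M.mul (M.val ρ t) (M.val ρ s)

def Mdl.Sat (M : Mdl) (ρ : ℕ → M.D) : AFml → Prop
  | .eq t s => M.val ρ t = M.val ρ s
  | .le t s => M.le (M.val ρ t) (M.val ρ s)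
  | .neg φ => ¬ M.Sat ρ φ
  | .and φ ψ => M.Sat ρ φ ∧ M.Sat ρ ψ
  | .or φ ψ => M.Sat ρ φ ∨ M.Sat ρ ψ
  | .imp φ ψ => M.Sat ρ φ → M.Sat ρ ψ
  | .all φ => ∀ a, M.Sat (scons a ρ) φ
  | .ex φ => ∃ a, M.Sat (scons a ρ) φ

theorem Mdl.val_subst (M : Mdl) (ρ : ℕ → M.D) (σ : ℕ → ATerm) (t : ATerm) :
    M.val ρ (t.substAll σ) = M.val (fun n => M.val ρ (σ n)) t := by
  induction t <;> simp_all [ATerm.substAll, Mdl.val]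

theorem Mdl.val_lift (M : Mdl) (ρ : ℕ → M.D) (a : M.D) (t : ATerm) :
    M.val (scons a ρ) (t.lift 0) = M.val ρ t := by
  induction t <;> simp_all [ATerm.lift, Mdl.val, scons]

theorem Mdl.env_liftSub (M : Mdl) (ρ : ℕ → M.D) (σ : ℕ → ATerm) (a : M.D) :
    (fun n => M.val (scons a ρ) (liftSub σ n)) = scons a (fun n => M.val ρ (σ n)) := by
  funext n
  cases n with
  | zero => rfl
  | succ n => simp [liftSub, Mdl.val_lift, scons]

theorem Mdl.sat_subst (M : Mdl) (φ : AFml) : ∀ (ρ : ℕ → M.D) (σ : ℕ → ATerm),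
    M.Sat ρ (φ.substAll σ) ↔ M.Sat (fun n => M.val ρ (σ n)) φ := by
  induction φ <;> intro ρ σ <;>
    simp_all [AFml.substAll, Mdl.Sat, Mdl.val_subst, Mdl.env_liftSub]

theorem Mdl.sat_subst0 (M : Mdl) (φ : AFml) (ρ : ℕ → M.D) (t : ATerm) :
    M.Sat ρ (φ.subst0 t) ↔ M.Sat (scons (M.val ρ t) ρ) φ := by
  rw [AFml.subst0, Mdl.sat_subst]
  have : (fun n => M.val ρ (subst0Env t n)) = scons (M.val ρ t) ρ := by
    funext n
    cases n <;> rfl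
  rw [this]

theorem Mdl.sat_lift0 (M : Mdl) (φ : AFml) (ρ : ℕ → M.D) (a : M.D) :
    M.Sat (scons a ρ) (φ.lift 0) ↔ M.Sat ρ φ := by
  rw [AFml.lift_eq, Mdl.sat_subst]
  rfl

theorem Mdl.val_congr (M : Mdl) {ρ τ : ℕ → M.D} {c : ℕ} {t : ATerm} (ht : t.FreeLt c)
    (h : ∀ n < c, ρ n = τ n) : M.val ρ t = M.val τ t := by
  induction t <;> simp_all [Mdl.val, ATerm.FreeLt]

theorem Mdl.sat_congr (M : Mdl) {φ : AFml} : ∀ {ρ τ : ℕ → M.D} {c : ℕ}, φ.FreeLt c →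
    (∀ n < c, ρ n = τ n) → (M.Sat ρ φ ↔ M.Sat τ φ) := by
  have key : ∀ (a : M.D) {ρ τ : ℕ → M.D} {c : ℕ}, (∀ n < c, ρ n = τ n) →
      ∀ n < c + 1, scons a ρ n = scons a τ n := by
    intro a ρ τ c h n hn
    cases n with
    | zero => rfl
    | succ n => simp [scons, h n (by omega)]
  induction φ with
  | eq t s | le t s =>
    intro ρ τ c hf h
    simp [Mdl.Sat, M.val_congr hf.1 h, M.val_congr hf.2 h]
  | neg φ ih => intro ρ τ c hf h; simp only [Mdl.Sat]; rw [ih (c := c) hf h]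
  | and φ ψ ih ih' | or φ ψ ih ih' | imp φ ψ ih ih' =>
    intro ρ τ c hf h
    simp only [Mdl.Sat]; rw [ih hf.1 h, ih' hf.2 h]
  | all φ ih =>
    intro ρ τ c hf h
    exact forall_congr' fun a => ih (c := c + 1) hf (key a h)
  | ex φ ih =>
    intro ρ τ c hf h
    exact exists_congr fun a => ih (c := c + 1) hf (key a h)

/-- The standard model. -/
def NMdl : Mdl := ⟨ℕ, 0, Nat.succ, (· + ·), (· * ·), (· ≤ ·)⟩

theorem NMdl_val (ρ : ℕ → ℕ) (t : ATerm) : NMdl.val ρ t = t.val ρ := by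
  induction t with
  | var n => rfl
  | zero => rfl
  | succ t ih => show Nat.succ _ = _; rw [ih]; rfl
  | add t s ih ih' => show (_ + _ : ℕ) = _; rw [ih, ih']; rfl
  | mul t s ih ih' => show (_ * _ : ℕ) = _; rw [ih, ih']; rfl

theorem consEnv_eq (a : ℕ) (ρ : ℕ → ℕ) : consEnv a ρ = scons a ρ := by
  funext n
  cases n <;> rfl

theorem NMdl_sat (φ : AFml) : ∀ (ρ : ℕ → ℕ), NMdl.Sat ρ φ ↔ φ.Sat ρ := by
  induction φ with
  | eq t s | le t s =>
    intro ρ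
    simp only [Mdl.Sat, AFml.Sat, NMdl_val]
    rfl
  | neg φ ih => intro ρ; simp only [Mdl.Sat, AFml.Sat, ih]
  | and φ ψ ih ih' | or φ ψ ih ih' | imp φ ψ ih ih' =>
    intro ρ; simp only [Mdl.Sat, AFml.Sat, ih, ih']
  | all φ ih =>
    intro ρ
    simp only [Mdl.Sat, AFml.Sat, consEnv_eq]
    exact forall_congr' fun a => ih _
  | ex φ ih =>
    intro ρ
    simp only [Mdl.Sat, AFml.Sat, consEnv_eq]
    exact exists_congr fun a => ih _

/-- `M` is a model of `Γ` (all axioms hold in all environments). -/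
def Mdl.Models (M : Mdl) (Γ : Set AFml) : Prop := ∀ γ ∈ Γ, ∀ ρ, M.Sat ρ γ

theorem Mdl.sat_evalProp (M : Mdl) (ρ : ℕ → M.D) (φ : AFml) :
    φ.evalProp (fun ψ => M.Sat ρ ψ) ↔ M.Sat ρ φ := by
  induction φ <;> simp_all [AFml.evalProp, Mdl.Sat]

theorem Mdl.sound (M : Mdl) {Γ : Set AFml} (hM : M.Models Γ) {φ : AFml} (h : Proves Γ φ) :
    ∀ ρ, M.Sat ρ φ := by
  induction h with
  | ax h => exact hM _ h
  | taut h => intro ρ; exact (M.sat_evalProp ρ _).1 (h _)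
  | mp _ _ ih ih' => intro ρ; exact ih ρ (ih' ρ)
  | allE φ t => intro ρ h; rw [M.sat_subst0]; exact h _
  | exI φ t => intro ρ h; rw [M.sat_subst0] at h; exact ⟨_, h⟩
  | allImp φ ψ => intro ρ h h' a; exact h a (h' a)
  | vacAll φ => intro ρ h a; rw [M.sat_lift0]; exact h
  | exDef φ =>
    intro ρ
    constructor
    · rintro ⟨a, ha⟩ h
      exact h a ha
    · intro h
      by_contra h'
      exact h fun a ha => h' ⟨a, ha⟩
  | gen _ ih => intro ρ a; exact ih _
  | eqRefl t => intro ρ; rfl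
  | eqSubst φ t s =>
    intro ρ h h'
    rw [M.sat_subst0] at h' ⊢
    have h : M.val ρ t = M.val ρ s := h
    rw [← h]; exact h'

/-! ## Part A2: completeness -/

theorem Proves.tc1 {Γ : Set AFml} {a b : AFml} (h : Proves Γ a)
    (ht : ∀ v, a.evalProp v → b.evalProp v) : Proves Γ b :=
  .mp (.taut (φ := .imp a b) ht) h

theorem Proves.tc2 {Γ : Set AFml} {a b c : AFml} (h : Proves Γ a) (h' : Proves Γ b)
    (ht : ∀ v, a.evalProp v → b.evalProp v → c.evalProp v) : Proves Γ c :=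
  .mp (.mp (.taut (φ := .imp a (.imp b c)) ht) h) h'

theorem Proves.tc3 {Γ : Set AFml} {a b c d : AFml} (h : Proves Γ a) (h' : Proves Γ b)
    (h'' : Proves Γ c)
    (ht : ∀ v, a.evalProp v → b.evalProp v → c.evalProp v → d.evalProp v) : Proves Γ d :=
  .mp (.mp (.mp (.taut (φ := .imp a (.imp b (.imp c d))) ht) h) h') h''

def allN : ℕ → AFml → AFml
  | 0, φ => φ
  | N + 1, φ => .all (allN N φ)

theorem Proves.allN {Γ : Set AFml} {φ : AFml} (h : Proves Γ φ) (N : ℕ) : Proves Γ (allN N φ) := by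
  induction N with
  | zero => exact h
  | succ N ih => exact .gen ih

theorem Proves.inst {Γ : Set AFml} {φ : AFml} (N : ℕ) : ∀ (σ₀ σ : ℕ → ATerm),
    Proves Γ ((PLN.allN N φ).substAll σ₀) → (∀ k, σ (N + k) = σ₀ k) →
    Proves Γ (φ.substAll σ) := by
  induction N with
  | zero =>
    intro σ₀ σ h hσ
    have : σ = σ₀ := by funext k; simpa using hσ k
    rw [this]; exact h
  | succ N ih =>
    intro σ₀ σ h hσ
    apply ih (scons (σ N) σ₀) σ
    · have h2 := Proves.mp (Proves.allE _ (σ N)) h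
      rwa [subst0_liftSub] at h2
    · intro k
      cases k with
      | zero => rfl
      | succ k =>
        have := hσ k
        simp only [scons]
        rw [← this]; congr 1; omega

theorem Proves.subst {Γ : Set AFml} {φ : AFml} (h : Proves Γ φ) (σ : ℕ → ATerm) :
    Proves Γ (φ.substAll σ) := by
  obtain ⟨c, hc⟩ := φ.exists_freeLt
  have h1 := h.allN c
  rw [← (PLN.allN c φ).substAll_var] at h1
  have h2 := Proves.inst (φ := φ) c ATerm.var (fun n => if n < c then σ n else .var (n - c)) h1
    (by intro k; simp)
  rwa [φ.substAll_congr (τ := σ) c hc (by intro n hn; simp [hn])] at h2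

theorem ATerm.code_inj : ∀ {t s : ATerm}, t.code = s.code → t = s := by
  intro t
  induction t with
  | var n => intro s h; cases s <;> simp [ATerm.code, Nat.pair_eq_pair] at h ⊢; exact h
  | zero => intro s h; cases s <;> simp [ATerm.code, Nat.pair_eq_pair] at h ⊢
  | succ t ih =>
    intro s h; cases s <;> simp [ATerm.code, Nat.pair_eq_pair] at h ⊢
    exact ih h
  | add t t' ih ih' | mul t t' ih ih' =>
    intro s h; cases s <;> simp [ATerm.code, Nat.pair_eq_pair] at h ⊢
    exact ⟨ih h.1, ih' h.2⟩

theorem AFml.code_inj : ∀ {φ ψ : AFml}, φ.code = ψ.code → φ = ψ := by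
  intro φ
  induction φ with
  | eq t s | le t s =>
    intro ψ h; cases ψ <;> simp [AFml.code, Nat.pair_eq_pair] at h ⊢
    exact ⟨ATerm.code_inj h.1, ATerm.code_inj h.2⟩
  | neg φ ih | all φ ih | ex φ ih =>
    intro ψ h; cases ψ <;> simp [AFml.code, Nat.pair_eq_pair] at h ⊢
    exact ih h
  | and φ φ' ih ih' | or φ φ' ih ih' | imp φ φ' ih ih' =>
    intro ψ h; cases ψ <;> simp [AFml.code, Nat.pair_eq_pair] at h ⊢
    exact ⟨ih h.1, ih' h.2⟩

instance : Countable AFml := ⟨⟨AFml.code, fun _ _ h => AFml.code_inj h⟩⟩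
instance : Nonempty AFml := ⟨botFml⟩

/-- Consistency of a formula with `Γ`. -/
def Con (Γ : Set AFml) (χ : AFml) : Prop := ¬ Proves Γ (.neg χ)

theorem henkin_fresh {Γ : Set AFml} {A θ : AFml} (hA : Con Γ A)
    (hex : Proves Γ (.imp A (.ex θ))) : ∃ t, Con Γ (.and A (θ.subst0 t)) := by
  obtain ⟨c, hc⟩ := A.exists_freeLt
  obtain ⟨d, hd⟩ := θ.exists_freeLt
  obtain ⟨w, hwc, hwd⟩ : ∃ w, c ≤ w ∧ d ≤ w := ⟨max c d, le_max_left _ _, le_max_right _ _⟩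
  refine ⟨.var w, fun h => hA ?_⟩
  have h1 : Proves Γ (.imp A (.neg (θ.subst0 (.var w)))) :=
    h.tc1 (by intro v; simp only [AFml.evalProp]; tauto)
  have h2 := h1.subst (fun n => if n < w then .var (n + 1) else .var 0)
  simp only [AFml.substAll] at h2
  rw [subst0_substAll] at h2
  rw [A.substAll_congr (τ := shiftEnv 0) w (hc.mono hwc) (by intro n hn; simp [hn, shiftEnv]),
    ← AFml.lift_eq] at h2
  rw [θ.substAll_congr (τ := ATerm.var) w (hd.mono hwd) (by
    intro n hn
    cases n with
    | zero => simp [scons, ATerm.substAll]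
    | succ n => simp [scons, show n < w by omega]), AFml.substAll_var] at h2
  have h3 := Proves.mp (Proves.allImp _ _) h2.gen
  have h4 := Proves.vacAll (Γ := Γ) A
  have h5 : Proves Γ (.imp A (.all (.neg θ))) :=
    h3.tc2 h4 (by intro v; simp only [AFml.evalProp]; tauto)
  exact (Proves.exDef θ).tc3 h5 hex (by
    intro v; simp only [iffF, AFml.evalProp]; tauto)

theorem henkin_step {Γ : Set AFml} (χ : AFml) (hχ : Con Γ χ) (ψ : AFml) :
    ∃ χ', Con Γ χ' ∧ Proves Γ (.imp χ' χ) ∧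
      (Proves Γ (.imp χ' ψ) ∨ Proves Γ (.imp χ' (.neg ψ))) ∧
      (∀ θ, ψ = .ex θ → Proves Γ (.imp χ' ψ) → ∃ t, Proves Γ (.imp χ' (θ.subst0 t))) := by
  have triv : ∀ a b, Proves Γ (.imp (.and a b) a) := fun a b =>
    .taut (by intro v; simp only [AFml.evalProp]; tauto)
  have triv' : ∀ a b, Proves Γ (.imp (.and a b) b) := fun a b =>
    .taut (by intro v; simp only [AFml.evalProp]; tauto)
  by_cases hc : Con Γ (.and χ ψ)
  · by_cases hex : ∃ θ, ψ = .ex θ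
    · obtain ⟨θ, rfl⟩ := hex
      obtain ⟨t, ht⟩ := henkin_fresh hc (triv' _ _)
      refine ⟨_, ht, ?_, Or.inl ?_, ?_⟩
      · exact .taut (by intro v; simp only [AFml.evalProp]; tauto)
      · exact .taut (by intro v; simp only [AFml.evalProp]; tauto)
      · intro θ' h _
        obtain rfl : θ = θ' := by simpa using h
        exact ⟨t, triv' _ _⟩
    · exact ⟨_, hc, triv _ _, Or.inl (triv' _ _), fun θ h => absurd ⟨θ, h⟩ hex⟩
  · have hc : Proves Γ (.neg (.and χ ψ)) := by simpa [Con] using hc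
    have h1 : Proves Γ (.imp χ (.neg ψ)) :=
      hc.tc1 (by intro v; simp only [AFml.evalProp]; tauto)
    refine ⟨χ, hχ, .taut (by intro v; simp only [AFml.evalProp]; tauto), Or.inr h1, ?_⟩
    intro θ _ h
    exact absurd (h.tc2 h1 (by intro v; simp only [AFml.evalProp]; tauto)) hχ

/-- A Henkin-complete set. -/
structure Henkin (Γ : Set AFml) (H : Set AFml) : Prop where
  prov : ∀ ψ, Proves Γ ψ → ψ ∈ H
  mp : ∀ ψ θ, AFml.imp ψ θ ∈ H → ψ ∈ H → θ ∈ H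
  neg : ∀ ψ, AFml.neg ψ ∈ H ↔ ψ ∉ H
  wit : ∀ θ, AFml.ex θ ∈ H → ∃ t, θ.subst0 t ∈ H

theorem exists_henkin {Γ : Set AFml} {φ : AFml} (hφ : ¬ Proves Γ φ) :
    ∃ H, Henkin Γ H ∧ φ ∉ H := by
  classical
  obtain ⟨e, he⟩ := exists_surjective_nat AFml
  choose! nxt hcon hmon hdec hwit using fun χ (h : Con Γ χ) ψ => henkin_step (Γ := Γ) χ h ψ
  let ch : ℕ → AFml := fun n => Nat.rec (.neg φ) (fun n χ => nxt χ (e n)) n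
  have ch0 : ch 0 = .neg φ := rfl
  have chs : ∀ n, ch (n + 1) = nxt (ch n) (e n) := fun n => rfl
  have hC : ∀ n, Con Γ (ch n) := by
    intro n
    induction n with
    | zero =>
      intro h
      exact hφ (h.tc1 (by rw [ch0]; intro v; simp only [AFml.evalProp]; tauto))
    | succ n ih => rw [chs]; exact hcon _ ih _
  have hm : ∀ n k, Proves Γ (.imp (ch (n + k)) (ch n)) := by
    intro n k
    induction k with
    | zero => exact .taut (by intro v; simp only [AFml.evalProp]; tauto)
    | succ k ih =>
      have := hmon (ch (n + k)) (hC _) (e (n + k))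
      rw [← chs] at this
      exact this.tc2 ih (by intro v; simp only [AFml.evalProp]; tauto)
  have hmono : ∀ n n' ψ, n ≤ n' → Proves Γ (.imp (ch n) ψ) → Proves Γ (.imp (ch n') ψ) := by
    intro n n' ψ hn h
    obtain ⟨k, rfl⟩ := Nat.exists_eq_add_of_le hn
    exact (hm n k).tc2 h (by intro v; simp only [AFml.evalProp]; tauto)
  have hnot : ∀ ψ n n', Proves Γ (.imp (ch n) ψ) → Proves Γ (.imp (ch n') (.neg ψ)) → False := by
    intro ψ n n' h h'
    have h1 := hmono n (max n n') _ (le_max_left _ _) h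
    have h2 := hmono n' (max n n') _ (le_max_right _ _) h'
    exact hC _ (h1.tc2 h2 (by intro v; simp only [AFml.evalProp]; tauto))
  refine ⟨{ψ | ∃ n, Proves Γ (.imp (ch n) ψ)}, ⟨?_, ?_, ?_, ?_⟩, ?_⟩
  · intro ψ h
    exact ⟨0, h.tc1 (by intro v; simp only [AFml.evalProp]; tauto)⟩
  · rintro ψ θ ⟨n, h⟩ ⟨n', h'⟩
    have h1 := hmono n (max n n') _ (le_max_left _ _) h
    have h2 := hmono n' (max n n') _ (le_max_right _ _) h'
    exact ⟨_, h1.tc2 h2 (by intro v; simp only [AFml.evalProp]; tauto)⟩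
  · intro ψ
    constructor
    · rintro ⟨n, h⟩ ⟨n', h'⟩
      exact hnot _ _ _ h' h
    · intro h
      obtain ⟨k, rfl⟩ := he ψ
      rcases hdec (ch k) (hC k) (e k) with h1 | h1
      · exact absurd ⟨k + 1, h1⟩ h
      · exact ⟨k + 1, h1⟩
  · rintro θ ⟨n, h⟩
    obtain ⟨k, hk⟩ := he (.ex θ)
    rcases hdec (ch k) (hC k) (e k) with h1 | h1
    · obtain ⟨t, ht⟩ := hwit (ch k) (hC k) (e k) θ hk h1
      exact ⟨t, k + 1, ht⟩
    · rw [hk] at h1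
      exact (hnot _ n (k + 1) h (by rw [chs, hk]; exact h1)).elim
  · rintro ⟨n, h⟩
    exact hnot φ n 0 h (.taut (by rw [ch0]; intro v; simp only [AFml.evalProp]; tauto))

section termModel
variable {Γ H : Set AFml}

theorem Henkin.tc1 (hH : Henkin Γ H) {a b : AFml} (h : Proves Γ (.imp a b)) (ha : a ∈ H) :
    b ∈ H := hH.mp _ _ (hH.prov _ h) ha

theorem Henkin.and (hH : Henkin Γ H) (a b : AFml) : AFml.and a b ∈ H ↔ a ∈ H ∧ b ∈ H := by
  constructor
  · intro h
    exact ⟨hH.tc1 (.taut (by intro v; simp only [AFml.evalProp]; tauto)) h,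
      hH.tc1 (.taut (by intro v; simp only [AFml.evalProp]; tauto)) h⟩
  · rintro ⟨h, h'⟩
    exact hH.mp _ _ (hH.tc1 (a := a) (b := .imp b (.and a b))
      (.taut (by intro v; simp only [AFml.evalProp]; tauto)) h) h'

theorem Henkin.imp (hH : Henkin Γ H) (a b : AFml) : AFml.imp a b ∈ H ↔ (a ∈ H → b ∈ H) := by
  constructor
  · exact hH.mp _ _
  · intro h
    by_cases ha : a ∈ H
    · exact hH.tc1 (.taut (by intro v; simp only [AFml.evalProp]; tauto)) (h ha)
    · exact hH.tc1 (.taut (by intro v; simp only [AFml.evalProp]; tauto)) ((hH.neg a).2 ha)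

theorem Henkin.or (hH : Henkin Γ H) (a b : AFml) : AFml.or a b ∈ H ↔ (a ∈ H ∨ b ∈ H) := by
  constructor
  · intro h
    by_cases ha : a ∈ H
    · exact Or.inl ha
    · right
      refine (hH.imp (.neg a) b).1 (hH.tc1 (.taut ?_) h) ((hH.neg a).2 ha)
      intro v; simp only [AFml.evalProp]; tauto
  · rintro (h | h)
    · exact hH.tc1 (.taut (by intro v; simp only [AFml.evalProp]; tauto)) h
    · exact hH.tc1 (.taut (by intro v; simp only [AFml.evalProp]; tauto)) h

theorem Henkin.ex (hH : Henkin Γ H) (a : AFml) : AFml.ex a ∈ H ↔ ∃ t, a.subst0 t ∈ H :=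
  ⟨hH.wit a, fun ⟨t, ht⟩ => hH.tc1 (.exI a t) ht⟩

theorem Henkin.all (hH : Henkin Γ H) (a : AFml) : AFml.all a ∈ H ↔ ∀ t, a.subst0 t ∈ H := by
  constructor
  · intro h t
    exact hH.tc1 (.allE a t) h
  · intro h
    by_contra hn
    have h1 : Proves Γ (.imp (.all (.neg (.neg a))) (.all a)) :=
      .mp (.allImp _ _) (.gen (.taut (by intro v; simp only [AFml.evalProp]; tauto)))
    have h2 : Proves Γ (.imp (.neg (.all a)) (.ex (.neg a))) :=
      h1.tc2 (.exDef (.neg a)) (by intro v; simp only [iffF, AFml.evalProp]; tauto)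
    obtain ⟨t, ht⟩ := hH.wit _ (hH.tc1 h2 ((hH.neg _).2 hn))
    exact (hH.neg _).1 ht (h t)

theorem Henkin.leib (hH : Henkin Γ H) (φ : AFml) {t s : ATerm} (h : AFml.eq t s ∈ H)
    (h' : φ.subst0 t ∈ H) : φ.subst0 s ∈ H :=
  hH.mp _ _ (hH.mp _ _ (hH.prov _ (.eqSubst φ t s)) h) h'

theorem Henkin.refl (hH : Henkin Γ H) (t : ATerm) : AFml.eq t t ∈ H := hH.prov _ (.eqRefl t)

theorem Henkin.symm (hH : Henkin Γ H) {t s : ATerm} (h : AFml.eq t s ∈ H) : AFml.eq s t ∈ H := by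
  have := hH.leib (.eq (.var 0) (t.lift 0)) h
    (by simpa [AFml.subst0, AFml.substAll, ATerm.substAll, ATerm.lift_subst0] using! hH.refl t)
  simpa [AFml.subst0, AFml.substAll, ATerm.substAll, ATerm.lift_subst0, subst0Env] using this

theorem Henkin.trans (hH : Henkin Γ H) {t s u : ATerm} (h : AFml.eq t s ∈ H)
    (h' : AFml.eq s u ∈ H) : AFml.eq t u ∈ H := by
  have := hH.leib (.eq (.var 0) (u.lift 0)) (hH.symm h)
    (by simpa [AFml.subst0, AFml.substAll, ATerm.substAll, ATerm.lift_subst0] using! h')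
  simpa [AFml.subst0, AFml.substAll, ATerm.substAll, ATerm.lift_subst0, subst0Env] using this

theorem Henkin.ctx (hH : Henkin Γ H) (F : ATerm → ATerm) (F' : ATerm)
    (hF : ∀ t, F'.substAll (subst0Env t) = F t) {t s : ATerm} (h : AFml.eq t s ∈ H) :
    AFml.eq (F t) (F s) ∈ H := by
  have := hH.leib (.eq ((F t).lift 0) F') h
    (by simpa [AFml.subst0, AFml.substAll, ATerm.lift_subst0, hF] using! hH.refl (F t))
  simpa [AFml.subst0, AFml.substAll, ATerm.lift_subst0, hF] using! this

theorem Henkin.leCongr (hH : Henkin Γ H) {t s t' s' : ATerm} (h : AFml.eq t t' ∈ H)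
    (h' : AFml.eq s s' ∈ H) (hl : AFml.le t s ∈ H) : AFml.le t' s' ∈ H := by
  have h1 := hH.leib (.le (.var 0) (s.lift 0)) h
    (by simpa [AFml.subst0, AFml.substAll, ATerm.substAll, ATerm.lift_subst0] using! hl)
  have h1 : AFml.le t' s ∈ H := by
    simpa [AFml.subst0, AFml.substAll, ATerm.substAll, ATerm.lift_subst0, subst0Env] using h1
  have h2 := hH.leib (.le (t'.lift 0) (.var 0)) h'
    (by simpa [AFml.subst0, AFml.substAll, ATerm.substAll, ATerm.lift_subst0] using! h1)
  simpa [AFml.subst0, AFml.substAll, ATerm.substAll, ATerm.lift_subst0, subst0Env] using h2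

def Henkin.setoid (hH : Henkin Γ H) : Setoid ATerm where
  r t s := AFml.eq t s ∈ H
  iseqv := ⟨hH.refl, hH.symm, hH.trans⟩

/-- The term model. -/
def Henkin.mdl (hH : Henkin Γ H) : Mdl where
  D := Quotient hH.setoid
  zero := Quotient.mk hH.setoid .zero
  succ := Quotient.map .succ (fun _ _ h => hH.ctx .succ (.succ (.var 0)) (fun _ => rfl) h)
  add := Quotient.map₂ .add (fun a a' h b b' h' =>
    hH.trans (hH.ctx (fun t => .add t b) (.add (.var 0) (b.lift 0))
      (fun t => by simp [ATerm.substAll, subst0Env, ATerm.lift_subst0]) h)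
      (hH.ctx (fun t => .add a' t) (.add (a'.lift 0) (.var 0))
      (fun t => by simp [ATerm.substAll, subst0Env, ATerm.lift_subst0]) h'))
  mul := Quotient.map₂ .mul (fun a a' h b b' h' =>
    hH.trans (hH.ctx (fun t => .mul t b) (.mul (.var 0) (b.lift 0))
      (fun t => by simp [ATerm.substAll, subst0Env, ATerm.lift_subst0]) h)
      (hH.ctx (fun t => .mul a' t) (.mul (a'.lift 0) (.var 0))
      (fun t => by simp [ATerm.substAll, subst0Env, ATerm.lift_subst0]) h'))
  le := Quotient.lift₂ (fun t s => AFml.le t s ∈ H) (fun _ _ _ _ h h' =>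
    propext ⟨hH.leCongr h h', hH.leCongr (hH.symm h) (hH.symm h')⟩)

def Henkin.cls (hH : Henkin Γ H) (t : ATerm) : hH.mdl.D := Quotient.mk hH.setoid t

theorem Henkin.val_mdl (hH : Henkin Γ H) (σ : ℕ → ATerm) (t : ATerm) :
    hH.mdl.val (fun n => hH.cls (σ n)) t = hH.cls (t.substAll σ) := by
  induction t with
  | var n => rfl
  | zero => rfl
  | succ t ih => simp only [Mdl.val, ih]; rfl
  | add t s ih ih' => simp only [Mdl.val, ih, ih']; rfl
  | mul t s ih ih' => simp only [Mdl.val, ih, ih']; rfl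

theorem Henkin.env_mdl (hH : Henkin Γ H) (σ : ℕ → ATerm) (t : ATerm) :
    scons (hH.cls t) (fun n => hH.cls (σ n)) = fun n => hH.cls (scons t σ n) := by
  funext n
  cases n <;> rfl

theorem Henkin.truth (hH : Henkin Γ H) (φ : AFml) : ∀ σ : ℕ → ATerm,
    hH.mdl.Sat (fun n => hH.cls (σ n)) φ ↔ φ.substAll σ ∈ H := by
  induction φ with
  | eq t s =>
    intro σ
    simp only [Mdl.Sat, Henkin.val_mdl, AFml.substAll]
    exact Quotient.eq (r := hH.setoid)
  | le t s =>
    intro σ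
    simp only [Mdl.Sat, Henkin.val_mdl, AFml.substAll]
    exact Iff.rfl
  | neg φ ih => intro σ; simp only [Mdl.Sat, AFml.substAll, ih, hH.neg]
  | and φ ψ ih ih' => intro σ; simp only [Mdl.Sat, AFml.substAll, ih, ih', hH.and]
  | or φ ψ ih ih' => intro σ; simp only [Mdl.Sat, AFml.substAll, ih, ih', hH.or]
  | imp φ ψ ih ih' => intro σ; simp only [Mdl.Sat, AFml.substAll, ih, ih', hH.imp]
  | all φ ih =>
    intro σ
    simp only [Mdl.Sat, AFml.substAll, hH.all, subst0_liftSub]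
    constructor
    · intro h t
      have := h (hH.cls t)
      rwa [hH.env_mdl, ih] at this
    · intro h a
      induction a using Quotient.inductionOn with
      | h t =>
        have := (ih _).2 (h t)
        rwa [← hH.env_mdl] at this
  | ex φ ih =>
    intro σ
    simp only [Mdl.Sat, AFml.substAll, hH.ex, subst0_liftSub]
    constructor
    · rintro ⟨a, ha⟩
      induction a using Quotient.inductionOn with
      | h t =>
        refine ⟨t, (ih _).1 ?_⟩
        rwa [← hH.env_mdl]
    · rintro ⟨t, ht⟩
      refine ⟨hH.cls t, ?_⟩
      rwa [hH.env_mdl, ih]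

theorem Henkin.models (hH : Henkin Γ H) : hH.mdl.Models Γ := by
  intro γ hγ ρ
  have : ρ = fun n => hH.cls ((ρ n).out) := by
    funext n
    exact (Quotient.out_eq (ρ n)).symm
  rw [this, hH.truth]
  exact hH.prov _ ((Proves.ax hγ).subst _)

end termModel

/-- Completeness theorem. -/
theorem completeness {Γ : Set AFml} {φ : AFml}
    (h : ∀ M : Mdl, M.Models Γ → ∀ ρ, M.Sat ρ φ) : Proves Γ φ := by
  by_contra hn
  obtain ⟨H, hH, hφ⟩ := exists_henkin hn
  apply hφ
  have := (hH.truth φ ATerm.var).1 (h _ hH.models _)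
  rwa [AFml.substAll_var] at this

theorem exists_model {Γ : Set AFml} (h : ¬ Proves Γ botFml) : ∃ M : Mdl, M.Models Γ := by
  by_contra hn
  exact h (completeness fun M hM => absurd ⟨M, hM⟩ hn)

/-! ## Part B: models of PA -/

def Mdl.num (M : Mdl) : ℕ → M.D
  | 0 => M.zero
  | n + 1 => M.succ (M.num n)

theorem val_lift0 (a : ℕ) (ρ : ℕ → ℕ) (t : ATerm) : (t.lift 0).val (scons a ρ) = t.val ρ := by
  rw [← NMdl_val, ← NMdl_val]
  exact NMdl.val_lift ρ a t

section PAmodels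

theorem Mdl.Models.succ_ne {M : Mdl} (hM : M.Models PA) (a : M.D) : M.succ a ≠ M.zero :=
  hM _ PAax.succNeZero (fun _ => M.zero) a

theorem Mdl.Models.succ_inj {M : Mdl} (hM : M.Models PA) {a b : M.D} (h : M.succ a = M.succ b) : a = b :=
  hM _ PAax.succInj (fun _ => M.zero) a b h

theorem Mdl.Models.add_zero {M : Mdl} (hM : M.Models PA) (a : M.D) : M.add a M.zero = a :=
  hM _ PAax.addZero (fun _ => M.zero) a

theorem Mdl.Models.add_succ {M : Mdl} (hM : M.Models PA) (a b : M.D) : M.add a (M.succ b) = M.succ (M.add a b) :=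
  hM _ PAax.addSucc (fun _ => M.zero) a b

theorem Mdl.Models.mul_zero {M : Mdl} (hM : M.Models PA) (a : M.D) : M.mul a M.zero = M.zero :=
  hM _ PAax.mulZero (fun _ => M.zero) a

theorem Mdl.Models.mul_succ {M : Mdl} (hM : M.Models PA) (a b : M.D) : M.mul a (M.succ b) = M.add (M.mul a b) a :=
  hM _ PAax.mulSucc (fun _ => M.zero) a b

theorem Mdl.Models.le_def {M : Mdl} (hM : M.Models PA) (a b : M.D) : M.le a b ↔ ∃ z, M.add z a = b := by
  have h := hM _ PAax.leDef (fun _ => M.zero) a b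
  exact ⟨h.1, h.2⟩

theorem Mdl.Models.cases {M : Mdl} (hM : M.Models PA) (y : M.D) : y = M.zero ∨ ∃ z, y = M.succ z := by
  have h := hM _ (PAax.ind (.or (.eq (.var 0) .zero) (.ex (.eq (.var 1) (.succ (.var 0))))))
    (fun _ => M.zero)
  refine h ⟨Or.inl rfl, fun a _ => ?_⟩ y
  rw [succSubst, M.sat_subst]
  exact Or.inr ⟨a, rfl⟩

theorem Mdl.Models.num_add {M : Mdl} (hM : M.Models PA) (j k : ℕ) : M.num (j + k) = M.add (M.num j) (M.num k) := by
  induction k with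
  | zero => exact (hM.add_zero _).symm
  | succ k ih =>
    show M.succ (M.num (j + k)) = M.add _ (M.succ (M.num k))
    rw [hM.add_succ, ih]

theorem Mdl.Models.num_mul {M : Mdl} (hM : M.Models PA) (j k : ℕ) : M.num (j * k) = M.mul (M.num j) (M.num k) := by
  induction k with
  | zero => exact (hM.mul_zero _).symm
  | succ k ih =>
    show M.num (j * k + j) = M.mul _ (M.succ (M.num k))
    rw [hM.mul_succ, hM.num_add, ih]

theorem Mdl.Models.num_inj {M : Mdl} (hM : M.Models PA) : ∀ {j k : ℕ}, M.num j = M.num k → j = k := by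
  intro j
  induction j with
  | zero =>
    intro k h
    cases k with
    | zero => rfl
    | succ k => exact absurd h.symm (hM.succ_ne _)
  | succ j ih =>
    intro k h
    cases k with
    | zero => exact absurd h (hM.succ_ne _)
    | succ k => rw [ih (hM.succ_inj h)]

theorem Mdl.Models.le_num {M : Mdl} (hM : M.Models PA) {k : ℕ} : ∀ {y : M.D}, M.le y (M.num k) → ∃ j ≤ k, y = M.num j := by
  induction k with
  | zero =>
    intro y h
    obtain ⟨z, hz⟩ := (hM.le_def _ _).1 h
    rcases hM.cases y with rfl | ⟨y', rfl⟩
    · exact ⟨0, le_rfl, rfl⟩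
    · rw [hM.add_succ] at hz
      exact absurd hz (hM.succ_ne _)
  | succ k ih =>
    intro y h
    obtain ⟨z, hz⟩ := (hM.le_def _ _).1 h
    rcases hM.cases y with rfl | ⟨y', rfl⟩
    · exact ⟨0, Nat.zero_le _, rfl⟩
    · rw [hM.add_succ] at hz
      obtain ⟨j, hj, rfl⟩ := ih ((hM.le_def _ _).2 ⟨z, hM.succ_inj hz⟩)
      exact ⟨j + 1, by omega, rfl⟩

theorem Mdl.Models.num_le {M : Mdl} (hM : M.Models PA) {j k : ℕ} : M.le (M.num j) (M.num k) ↔ j ≤ k := by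
  constructor
  · intro h
    obtain ⟨i, hi, h⟩ := hM.le_num h
    rw [hM.num_inj h]; exact hi
  · intro h
    refine (hM.le_def _ _).2 ⟨M.num (k - j), ?_⟩
    rw [← hM.num_add]; congr 1; omega

theorem Mdl.Models.total {M : Mdl} (hM : M.Models PA) (k : ℕ) : ∀ y : M.D, (∃ j ≤ k, y = M.num j) ∨ M.le (M.num (k + 1)) y := by
  have key : ∀ y : M.D, (∃ j ≤ k, y = M.num j) ∨ ∃ z, M.add z (M.num (k + 1)) = y := by
    induction k with
    | zero =>
      intro y
      rcases hM.cases y with rfl | ⟨y', rfl⟩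
      · exact Or.inl ⟨0, le_rfl, rfl⟩
      · refine Or.inr ⟨y', ?_⟩
        show M.add y' (M.succ M.zero) = _
        rw [hM.add_succ, hM.add_zero]
    | succ k ih =>
      intro y
      rcases hM.cases y with rfl | ⟨y', rfl⟩
      · exact Or.inl ⟨0, Nat.zero_le _, rfl⟩
      · rcases ih y' with ⟨j, hj, rfl⟩ | ⟨z, hz⟩
        · exact Or.inl ⟨j + 1, by omega, rfl⟩
        · refine Or.inr ⟨z, ?_⟩
          show M.add z (M.succ (M.num (k + 1))) = _
          rw [hM.add_succ, hz]
  intro y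
  rcases key y with h | h
  · exact Or.inl h
  · exact Or.inr ((hM.le_def _ _).2 h)

theorem Mdl.Models.num_le_of_le {M : Mdl} (hM : M.Models PA) {k k' : ℕ} (hk : k ≤ k') {y : M.D} (h : M.le (M.num k') y) :
    M.le (M.num k) y := by
  cases k with
  | zero => exact (hM.le_def _ _).2 ⟨y, hM.add_zero y⟩
  | succ k =>
    rcases hM.total k y with ⟨j, hj, rfl⟩ | h'
    · have := hM.num_le.1 h
      omega
    · exact h'

theorem Mdl.Models.total' {M : Mdl} (hM : M.Models PA) (k : ℕ) (y : M.D) : (∃ j ≤ k, y = M.num j) ∨ M.le (M.num k) y := by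
  rcases hM.total k y with h | h
  · exact Or.inl h
  · exact Or.inr (hM.num_le_of_le (Nat.le_succ k) h)

theorem Mdl.Models.val_num {M : Mdl} (hM : M.Models PA) (ρ : ℕ → ℕ) (t : ATerm) :
    M.val (fun n => M.num (ρ n)) t = M.num (t.val ρ) := by
  induction t with
  | var n => rfl
  | zero => rfl
  | succ t ih => simp only [Mdl.val, ATerm.val, ih]; rfl
  | add t s ih ih' => simp only [Mdl.val, ATerm.val, ih, ih', hM.num_add]
  | mul t s ih ih' => simp only [Mdl.val, ATerm.val, ih, ih', hM.num_mul]

theorem Mdl.scons_num {M : Mdl} (a : ℕ) (ρ : ℕ → ℕ) :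
    scons (M.num a) (fun n => M.num (ρ n)) = fun n => M.num (scons a ρ n) := by
  funext n
  cases n <;> rfl

theorem Mdl.Models.abs0 {M : Mdl} (hM : M.Models PA) {θ : AFml} (hθ : IsDelta0 θ) : ∀ ρ : ℕ → ℕ,
    M.Sat (fun n => M.num (ρ n)) θ ↔ θ.Sat ρ := by
  induction hθ with
  | eq t s =>
    intro ρ
    simp only [Mdl.Sat, AFml.Sat, hM.val_num]
    exact ⟨hM.num_inj, fun h => by rw [h]⟩
  | le t s => intro ρ; simp only [Mdl.Sat, AFml.Sat, hM.val_num, hM.num_le]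
  | neg _ ih => intro ρ; simp only [Mdl.Sat, AFml.Sat, ih]
  | and _ _ ih ih' => intro ρ; simp only [Mdl.Sat, AFml.Sat, ih, ih']
  | or _ _ ih ih' => intro ρ; simp only [Mdl.Sat, AFml.Sat, ih, ih']
  | imp _ _ ih ih' => intro ρ; simp only [Mdl.Sat, AFml.Sat, ih, ih']
  | ball t _ ih =>
    intro ρ
    simp only [Mdl.Sat, AFml.Sat, Mdl.val, M.val_lift, hM.val_num, consEnv_eq]
    constructor
    · intro h a ha
      have := h (M.num a) (by
        simp only [scons]; rw [hM.num_le]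
        rwa [val_lift0] at ha)
      rwa [M.scons_num, ih] at this
    · intro h a ha
      obtain ⟨j, hj, rfl⟩ := hM.le_num ha
      rw [M.scons_num, ih]
      exact h j (by rw [val_lift0]; exact hj)
  | bex t _ ih =>
    intro ρ
    simp only [Mdl.Sat, AFml.Sat, Mdl.val, M.val_lift, hM.val_num, consEnv_eq]
    constructor
    · rintro ⟨a, ha, h⟩
      obtain ⟨j, hj, rfl⟩ := hM.le_num ha
      rw [M.scons_num, ih] at h
      exact ⟨j, by rw [val_lift0]; exact hj, h⟩
    · rintro ⟨a, ha, h⟩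
      refine ⟨M.num a, ?_, ?_⟩
      · simp only [scons]; rw [hM.num_le]
        rwa [val_lift0] at ha
      · rw [M.scons_num, ih]; exact h

end PAmodels

/-! ## Part C: definability -/

theorem sat_subst (φ : AFml) (ρ : ℕ → ℕ) (σ : ℕ → ATerm) :
    (φ.substAll σ).Sat ρ ↔ φ.Sat (fun n => (σ n).val ρ) := by
  have h := NMdl.sat_subst φ ρ σ
  have h2 : (fun n => NMdl.val ρ (σ n)) = fun n => (σ n).val ρ := by
    funext n
    exact NMdl_val ρ (σ n)
  rw [h2] at h
  exact ((NMdl_sat _ _).symm.trans h).trans (NMdl_sat _ _)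

theorem IsDelta0.substAll {θ : AFml} (h : IsDelta0 θ) : ∀ σ, IsDelta0 (θ.substAll σ) := by
  induction h with
  | eq t s => intro σ; exact .eq _ _
  | le t s => intro σ; exact .le _ _
  | neg _ ih => intro σ; exact .neg (ih σ)
  | and _ _ ih ih' => intro σ; exact .and (ih σ) (ih' σ)
  | or _ _ ih ih' => intro σ; exact .or (ih σ) (ih' σ)
  | imp _ _ ih ih' => intro σ; exact .imp (ih σ) (ih' σ)
  | ball t _ ih =>
    intro σ
    simp only [AFml.substAll, ATerm.lift_liftSub]
    exact .ball _ (ih _)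
  | bex t _ ih =>
    intro σ
    simp only [AFml.substAll, ATerm.lift_liftSub]
    exact .bex _ (ih _)

def exB (t : ATerm) (φ : AFml) : AFml := .ex (.and (.le (.var 0) (t.lift 0)) φ)
def allB (t : ATerm) (φ : AFml) : AFml := .all (.imp (.le (.var 0) (t.lift 0)) φ)

theorem sat_exB (t : ATerm) (φ : AFml) (ρ : ℕ → ℕ) :
    (exB t φ).Sat ρ ↔ ∃ a ≤ t.val ρ, φ.Sat (scons a ρ) := by
  simp only [exB, AFml.Sat, consEnv_eq, val_lift0]
  rfl

theorem sat_allB (t : ATerm) (φ : AFml) (ρ : ℕ → ℕ) :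
    (allB t φ).Sat ρ ↔ ∀ a ≤ t.val ρ, φ.Sat (scons a ρ) := by
  simp only [allB, AFml.Sat, consEnv_eq, val_lift0]
  rfl

theorem Mdl.sat_exB (M : Mdl) (t : ATerm) (φ : AFml) (ρ : ℕ → M.D) :
    M.Sat ρ (exB t φ) ↔ ∃ a, M.le a (M.val ρ t) ∧ M.Sat (scons a ρ) φ := by
  simp only [exB, Mdl.Sat, M.val_lift]
  rfl

theorem Mdl.sat_allB (M : Mdl) (t : ATerm) (φ : AFml) (ρ : ℕ → M.D) :
    M.Sat ρ (allB t φ) ↔ ∀ a, M.le a (M.val ρ t) → M.Sat (scons a ρ) φ := by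
  simp only [allB, Mdl.Sat, M.val_lift]
  rfl

/-- `Σ₁`-definability in the standard model. -/
def DefS (R : (ℕ → ℕ) → Prop) : Prop :=
  ∃ θ, IsDelta0 θ ∧ ∀ ρ, R ρ ↔ ∃ z, θ.Sat (scons z ρ)

/-- Renaming skipping the variable 1. -/
def skip1 : ℕ → ATerm
  | 0 => .var 0
  | n + 1 => .var (n + 2)

def swap01 : ℕ → ATerm
  | 0 => .var 1
  | 1 => .var 0
  | n + 2 => .var (n + 2)

theorem skip1_env (a b : ℕ) (ρ : ℕ → ℕ) :
    (fun n => (skip1 n).val (scons a (scons b ρ))) = scons a ρ := by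
  funext n
  cases n <;> rfl

theorem swap01_env (a b : ℕ) (ρ : ℕ → ℕ) :
    (fun n => (swap01 n).val (scons a (scons b ρ))) = scons b (scons a ρ) := by
  funext n
  match n with
  | 0 => rfl
  | 1 => rfl
  | n + 2 => rfl

theorem DefS.mono {R : (ℕ → ℕ) → Prop} (h : DefS R) :
    ∃ θ, IsDelta0 θ ∧ (∀ ρ z z', z ≤ z' → θ.Sat (scons z ρ) → θ.Sat (scons z' ρ)) ∧
      ∀ ρ, R ρ ↔ ∃ z, θ.Sat (scons z ρ) := by
  obtain ⟨θ, h0, h⟩ := h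
  have key : ∀ z ρ, (exB (.var 0) (θ.substAll skip1)).Sat (scons z ρ) ↔
      ∃ a ≤ z, θ.Sat (scons a ρ) := by
    intro z ρ
    rw [sat_exB]
    simp only [sat_subst, skip1_env]
    rfl
  refine ⟨exB (.var 0) (θ.substAll skip1), .bex _ (h0.substAll _), ?_, ?_⟩
  · intro ρ z z' hz
    rw [key, key]
    rintro ⟨a, ha, h⟩
    exact ⟨a, ha.trans hz, h⟩
  · intro ρ
    rw [h]
    simp only [key]
    constructor
    · rintro ⟨z, hz⟩
      exact ⟨z, z, le_rfl, hz⟩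
    · rintro ⟨z, a, _, hz⟩
      exact ⟨a, hz⟩

theorem DefS.of_iff {R S : (ℕ → ℕ) → Prop} (h : DefS R) (hRS : ∀ ρ, S ρ ↔ R ρ) : DefS S := by
  obtain ⟨θ, h0, h⟩ := h
  exact ⟨θ, h0, fun ρ => (hRS ρ).trans (h ρ)⟩

theorem DefS.delta0 {θ : AFml} (h : IsDelta0 θ) : DefS θ.Sat := by
  refine ⟨θ.substAll (shiftEnv 0), h.substAll _, fun ρ => ?_⟩
  simp only [sat_subst]
  exact ⟨fun h => ⟨0, h⟩, fun ⟨_, h⟩ => h⟩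

theorem DefS.and {R S : (ℕ → ℕ) → Prop} (hR : DefS R) (hS : DefS S) :
    DefS fun ρ => R ρ ∧ S ρ := by
  obtain ⟨θ, h0, hm, h⟩ := hR.mono
  obtain ⟨θ', h0', hm', h'⟩ := hS.mono
  refine ⟨.and θ θ', .and h0 h0', fun ρ => ?_⟩
  show R ρ ∧ S ρ ↔ _
  rw [h, h']
  constructor
  · rintro ⟨⟨z, hz⟩, z', hz'⟩
    exact ⟨max z z', hm _ _ _ (le_max_left _ _) hz, hm' _ _ _ (le_max_right _ _) hz'⟩
  · rintro ⟨z, hz, hz'⟩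
    exact ⟨⟨z, hz⟩, z, hz'⟩

theorem DefS.or {R S : (ℕ → ℕ) → Prop} (hR : DefS R) (hS : DefS S) :
    DefS fun ρ => R ρ ∨ S ρ := by
  obtain ⟨θ, h0, h⟩ := hR
  obtain ⟨θ', h0', h'⟩ := hS
  refine ⟨.or θ θ', .or h0 h0', fun ρ => ?_⟩
  show R ρ ∨ S ρ ↔ _
  rw [h, h', ← exists_or]
  rfl

theorem DefS.subst {R : (ℕ → ℕ) → Prop} (hR : DefS R) (σ : ℕ → ATerm) :
    DefS fun ρ => R fun n => (σ n).val ρ := by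
  obtain ⟨θ, h0, h⟩ := hR
  refine ⟨θ.substAll (liftSub σ), h0.substAll _, fun ρ => ?_⟩
  show (R fun n => (σ n).val ρ) ↔ _
  rw [h]
  simp only [sat_subst]
  have : ∀ z, (fun n => (liftSub σ n).val (scons z ρ)) = scons z fun n => (σ n).val ρ := by
    intro z
    funext n
    cases n with
    | zero => rfl
    | succ n => simp [liftSub, val_lift0, scons]
  simp only [this]

/-- Functions of the environment given by a term. -/
def IsT (f : (ℕ → ℕ) → ℕ) : Prop := ∃ t : ATerm, ∀ ρ, t.val ρ = f ρ

theorem IsT.var (n : ℕ) : IsT fun ρ => ρ n := ⟨.var n, fun _ => rfl⟩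
theorem IsT.add {f g : (ℕ → ℕ) → ℕ} (hf : IsT f) (hg : IsT g) : IsT fun ρ => f ρ + g ρ := by
  obtain ⟨t, ht⟩ := hf
  obtain ⟨s, hs⟩ := hg
  exact ⟨.add t s, fun ρ => by simp [ATerm.val, ht, hs]⟩
theorem IsT.mul {f g : (ℕ → ℕ) → ℕ} (hf : IsT f) (hg : IsT g) : IsT fun ρ => f ρ * g ρ := by
  obtain ⟨t, ht⟩ := hf
  obtain ⟨s, hs⟩ := hg
  exact ⟨.mul t s, fun ρ => by simp [ATerm.val, ht, hs]⟩

theorem numeral_val (k : ℕ) (ρ : ℕ → ℕ) : (numeral k).val ρ = k := by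
  induction k with
  | zero => rfl
  | succ k ih => simp [numeral, ATerm.val, ih]

theorem IsT.const (k : ℕ) : IsT fun _ => k := ⟨numeral k, numeral_val k⟩

theorem DefS.exists {Q : ℕ → (ℕ → ℕ) → Prop} (h : DefS fun ρ => Q (ρ 0) (fun n => ρ (n + 1))) :
    DefS fun ρ => ∃ a, Q a ρ := by
  obtain ⟨θ, h0, hm, h⟩ := h.mono
  refine ⟨exB (.var 0) (θ.substAll swap01), .bex _ (h0.substAll _), fun ρ => ?_⟩
  simp only [sat_exB, sat_subst, swap01_env]
  have h' : ∀ a, Q a ρ ↔ ∃ z, θ.Sat (scons z (scons a ρ)) := fun a => h (scons a ρ)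
  simp only [h']
  constructor
  · rintro ⟨a, z, hz⟩
    exact ⟨max a z, a, le_max_left _ _, hm _ _ _ (le_max_right _ _) hz⟩
  · rintro ⟨z, a, _, hz⟩
    exact ⟨a, z, hz⟩

theorem DefS.ball {Q : ℕ → (ℕ → ℕ) → Prop} {f : (ℕ → ℕ) → ℕ} (hf : IsT f)
    (h : DefS fun ρ => Q (ρ 0) (fun n => ρ (n + 1))) :
    DefS fun ρ => ∀ a ≤ f ρ, Q a ρ := by
  obtain ⟨θ, h0, hm, h⟩ := h.mono
  obtain ⟨t, ht⟩ := hf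
  refine ⟨allB (t.lift 0) (θ.substAll swap01), .ball _ (h0.substAll _), fun ρ => ?_⟩
  simp only [sat_allB, sat_subst, swap01_env, val_lift0, ht]
  have h' : ∀ a, Q a ρ ↔ ∃ z, θ.Sat (scons z (scons a ρ)) := fun a => h (scons a ρ)
  simp only [h']
  generalize f ρ = N
  constructor
  · intro H
    induction N with
    | zero =>
      obtain ⟨z, hz⟩ := H 0 le_rfl
      exact ⟨z, fun a ha => by rwa [Nat.le_zero.1 ha]⟩
    | succ N ih =>
      obtain ⟨z, hz⟩ := ih fun a ha => H a (by omega)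
      obtain ⟨z', hz'⟩ := H (N + 1) le_rfl
      refine ⟨max z z', fun a ha => ?_⟩
      rcases Nat.lt_or_ge N a with h1 | h1
      · obtain rfl : a = N + 1 := by omega
        exact hm _ _ _ (le_max_right _ _) hz'
      · exact hm _ _ _ (le_max_left _ _) (hz a h1)
  · rintro ⟨z, hz⟩ a ha
    exact ⟨z, hz a ha⟩

theorem DefS.eq {f g : (ℕ → ℕ) → ℕ} (hf : IsT f) (hg : IsT g) : DefS fun ρ => f ρ = g ρ := by
  obtain ⟨t, ht⟩ := hf
  obtain ⟨s, hs⟩ := hg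
  exact (DefS.delta0 (.eq t s)).of_iff fun ρ => by simp [AFml.Sat, ht, hs]

theorem DefS.le {f g : (ℕ → ℕ) → ℕ} (hf : IsT f) (hg : IsT g) : DefS fun ρ => f ρ ≤ g ρ := by
  obtain ⟨t, ht⟩ := hf
  obtain ⟨s, hs⟩ := hg
  exact (DefS.delta0 (.le t s)).of_iff fun ρ => by simp [AFml.Sat, ht, hs]

theorem DefS.lt {f g : (ℕ → ℕ) → ℕ} (hf : IsT f) (hg : IsT g) : DefS fun ρ => f ρ < g ρ :=
  (DefS.le (hf.add (IsT.const 1)) hg).of_iff fun _ => Nat.lt_iff_add_one_le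

theorem DefS.comp2 {R : ℕ → ℕ → Prop} (h : DefS fun ρ => R (ρ 0) (ρ 1)) {f g : (ℕ → ℕ) → ℕ}
    (hf : IsT f) (hg : IsT g) : DefS fun ρ => R (f ρ) (g ρ) := by
  obtain ⟨t, ht⟩ := hf
  obtain ⟨s, hs⟩ := hg
  refine (h.subst (fun n => if n = 0 then t else s)).of_iff fun ρ => ?_
  simp [ht, hs]

theorem DefS.comp3 {R : ℕ → ℕ → ℕ → Prop} (h : DefS fun ρ => R (ρ 0) (ρ 1) (ρ 2))
    {f g k : (ℕ → ℕ) → ℕ}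
    (hf : IsT f) (hg : IsT g) (hk : IsT k) : DefS fun ρ => R (f ρ) (g ρ) (k ρ) := by
  obtain ⟨t, ht⟩ := hf
  obtain ⟨s, hs⟩ := hg
  obtain ⟨r, hr⟩ := hk
  refine (h.subst (fun n => if n = 0 then t else if n = 1 then s else r)).of_iff fun ρ => ?_
  simp [ht, hs, hr]

theorem defS_pair : DefS fun ρ => Nat.pair (ρ 0) (ρ 1) = ρ 2 := by
  have v := IsT.var
  refine ((DefS.and (DefS.lt (v 0) (v 1)) (DefS.eq (((v 1).mul (v 1)).add (v 0)) (v 2))).or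
    (DefS.and (DefS.le (v 1) (v 0))
      (DefS.eq ((((v 0).mul (v 0)).add (v 0)).add (v 1)) (v 2)))).of_iff fun ρ => ?_
  unfold Nat.pair
  split_ifs with h
  · simp [h, Nat.not_le.2 h]
  · simp [h, Nat.not_lt.1 h]

theorem DefS.pair {f g k : (ℕ → ℕ) → ℕ} (hf : IsT f) (hg : IsT g) (hk : IsT k) :
    DefS fun ρ => Nat.pair (f ρ) (g ρ) = k ρ :=
  DefS.comp3 (R := fun a b c => Nat.pair a b = c) defS_pair hf hg hk

theorem defS_beta : DefS fun ρ => Nat.beta (ρ 0) (ρ 1) = ρ 2 := by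
  have v := IsT.var
  have key : DefS fun ρ => ∃ a, ∃ b, ∃ q, Nat.pair a b = ρ 0 ∧
      a = q * ((ρ 1 + 1) * b + 1) + ρ 2 ∧ ρ 2 < (ρ 1 + 1) * b + 1 := by
    apply DefS.exists
    apply DefS.exists
    apply DefS.exists
    refine DefS.and (DefS.pair (v 2) (v 1) (v 3)) (DefS.and (DefS.eq (v 2) ?_) (DefS.lt (v 5) ?_))
    · exact ((v 0).mul ((((v 4).add (IsT.const 1)).mul (v 1)).add (IsT.const 1))).add (v 5)
    · exact (((v 4).add (IsT.const 1)).mul (v 1)).add (IsT.const 1)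
  refine key.of_iff fun ρ => ?_
  unfold Nat.beta
  constructor
  · intro h
    refine ⟨(ρ 0).unpair.1, (ρ 0).unpair.2, (ρ 0).unpair.1 / ((ρ 1 + 1) * (ρ 0).unpair.2 + 1),
      Nat.pair_unpair _, ?_, ?_⟩
    · rw [← h]; exact (Nat.div_add_mod' _ _).symm
    · rw [← h]; exact Nat.mod_lt _ (Nat.succ_pos _)
  · rintro ⟨a, b, q, h1, h2, h3⟩
    rw [← h1, Nat.unpair_pair, h2]
    show (q * ((ρ 1 + 1) * b + 1) + ρ 2) % ((ρ 1 + 1) * b + 1) = ρ 2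
    rw [Nat.mul_add_mod_self_right, Nat.mod_eq_of_lt h3]

theorem DefS.beta {f g k : (ℕ → ℕ) → ℕ} (hf : IsT f) (hg : IsT g) (hk : IsT k) :
    DefS fun ρ => Nat.beta (f ρ) (g ρ) = k ρ :=
  DefS.comp3 (R := fun a b c => Nat.beta a b = c) defS_beta hf hg hk

theorem exists_beta (f : ℕ → ℕ) (N : ℕ) : ∃ b, ∀ i ≤ N, Nat.beta b i = f i := by
  refine ⟨Nat.unbeta ((List.range (N + 1)).map f), fun i hi => ?_⟩
  have := Nat.beta_unbeta_coe ((List.range (N + 1)).map f) ⟨i, by simp; omega⟩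
  simpa using this

theorem defS_primrec {f : ℕ → ℕ} (hf : Nat.Primrec f) : DefS fun ρ => f (ρ 0) = ρ 1 := by
  have v := IsT.var
  induction hf with
  | zero => exact DefS.eq (IsT.const 0) (v 1)
  | succ => exact DefS.eq ((v 0).add (IsT.const 1)) (v 1)
  | left =>
    have : DefS fun ρ => ∃ b, Nat.pair (ρ 1) b = ρ 0 :=
      DefS.exists (DefS.pair (v 2) (v 0) (v 1))
    refine this.of_iff fun ρ => ?_
    constructor
    · intro h
      exact ⟨(ρ 0).unpair.2, by rw [← h]; exact Nat.pair_unpair _⟩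
    · rintro ⟨b, h⟩
      rw [← h]; simp
  | right =>
    have : DefS fun ρ => ∃ b, Nat.pair b (ρ 1) = ρ 0 :=
      DefS.exists (DefS.pair (v 0) (v 2) (v 1))
    refine this.of_iff fun ρ => ?_
    constructor
    · intro h
      exact ⟨(ρ 0).unpair.1, by rw [← h]; exact Nat.pair_unpair _⟩
    · rintro ⟨b, h⟩
      rw [← h]; simp
  | @pair f g _ _ ihf ihg =>
    have : DefS fun ρ => ∃ a, ∃ b, f (ρ 0) = a ∧ g (ρ 0) = b ∧ Nat.pair a b = ρ 1 := by
      apply DefS.exists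
      apply DefS.exists
      exact DefS.and (DefS.comp2 (R := fun a b => f a = b) ihf (v 2) (v 1))
        (DefS.and (DefS.comp2 (R := fun a b => g a = b) ihg (v 2) (v 0))
          (DefS.pair (v 1) (v 0) (v 3)))
    exact this.of_iff fun ρ => by simp
  | @comp f g _ _ ihf ihg =>
    have : DefS fun ρ => ∃ a, g (ρ 0) = a ∧ f a = ρ 1 := by
      apply DefS.exists
      exact DefS.and (DefS.comp2 (R := fun a b => g a = b) ihg (v 1) (v 0))
        (DefS.comp2 (R := fun a b => f a = b) ihf (v 0) (v 2))
    exact this.of_iff fun ρ => by simp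
  | @prec f g _ _ ihf ihg =>
    have : DefS fun ρ => ∃ z, ∃ n, ∃ b, Nat.pair z n = ρ 0 ∧
        (∃ u, f z = u ∧ Nat.beta b 0 = u) ∧ Nat.beta b n = ρ 1 ∧
        ∀ y ≤ n, y = n ∨ ∃ u, ∃ w, ∃ p, ∃ p', Nat.beta b y = u ∧ Nat.beta b (y + 1) = w ∧
          Nat.pair y u = p ∧ Nat.pair z p = p' ∧ g p' = w := by
      apply DefS.exists
      apply DefS.exists
      apply DefS.exists
      refine DefS.and (DefS.pair (v 2) (v 1) (v 3)) (DefS.and ?_ (DefS.and ?_ ?_))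
      · apply DefS.exists
        exact DefS.and (DefS.comp2 (R := fun a b => f a = b) ihf (v 3) (v 0))
          (DefS.beta (v 1) (IsT.const 0) (v 0))
      · exact DefS.beta (v 0) (v 1) (v 4)
      · apply DefS.ball (v 1)
        refine DefS.or (DefS.eq (v 0) (v 2)) ?_
        apply DefS.exists
        apply DefS.exists
        apply DefS.exists
        apply DefS.exists
        refine DefS.and (DefS.beta (v 5) (v 4) (v 3)) (DefS.and
          (DefS.beta (v 5) ((v 4).add (IsT.const 1)) (v 2)) (DefS.and
          (DefS.pair (v 4) (v 3) (v 1)) (DefS.and (DefS.pair (v 7) (v 1) (v 0))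
          (DefS.comp2 (R := fun a b => g a = b) ihg (v 0) (v 2)))))
    refine this.of_iff fun ρ => ?_
    obtain ⟨z, n, hzn⟩ : ∃ z n, ρ 0 = Nat.pair z n := ⟨_, _, (Nat.pair_unpair _).symm⟩
    rw [hzn]
    simp only [Nat.unpaired, Nat.unpair_pair]
    let F : ℕ → ℕ := fun n => Nat.rec (f z) (fun y IH => g (Nat.pair z (Nat.pair y IH))) n
    have F0 : F 0 = f z := rfl
    have Fs : ∀ y, F (y + 1) = g (Nat.pair z (Nat.pair y (F y))) := fun _ => rfl
    show F n = ρ 1 ↔ _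
    constructor
    · intro h
      obtain ⟨b, hb⟩ := exists_beta F n
      refine ⟨z, n, b, rfl, ⟨_, rfl, by rw [hb 0 (Nat.zero_le _), F0]⟩, by rw [hb n le_rfl, h], ?_⟩
      intro y hy
      by_cases hyn : y = n
      · exact Or.inl hyn
      · refine Or.inr ⟨F y, F (y + 1), _, _, hb y hy, hb _ (by omega), rfl, rfl, (Fs y).symm⟩
    · rintro ⟨z', n', b, h1, ⟨u, rfl, h2⟩, h3, h4⟩
      obtain ⟨rfl, rfl⟩ := Nat.pair_eq_pair.1 h1
      have : ∀ y ≤ n', Nat.beta b y = F y := by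
        intro y
        induction y with
        | zero => intro _; rw [h2, F0]
        | succ y ih =>
          intro hy
          rcases h4 y (by omega) with h5 | ⟨u, w, p, p', hu, hw, rfl, rfl, hg⟩
          · omega
          · rw [Fs, ← ih (by omega), hu, hg, hw]
      rw [← this n' le_rfl, h3]

/-- Both the relation and its complement are `Σ₁`-definable. -/
def DecS (R : (ℕ → ℕ) → Prop) : Prop := DefS R ∧ DefS fun ρ => ¬ R ρ

theorem exists_primrec_char {α : Type} [Primcodable α] {R : α → Prop} (h : PrimrecPred R) :
    ∃ f : ℕ → ℕ, Nat.Primrec f ∧ ∀ a, (f (Encodable.encode a) = 1 ↔ R a) ∧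
      (f (Encodable.encode a) = 0 ↔ ¬ R a) := by
  classical
  obtain ⟨inst, h⟩ := h
  have h1 : Primrec fun n : ℕ => ((Encodable.decode n : Option α).map fun a => decide (R a)) :=
    Primrec.option_map Primrec.decode (h.comp Primrec.snd)
  have h2 : Primrec fun n : ℕ =>
      ((Encodable.decode n : Option α).map fun a => decide (R a)).getD false :=
    Primrec.option_getD.comp h1 (Primrec.const false)
  have h3 : Primrec fun n : ℕ =>
      cond (((Encodable.decode n : Option α).map fun a => decide (R a)).getD false) 1 0 :=
    Primrec.cond h2 (Primrec.const 1) (Primrec.const 0)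
  refine ⟨_, Primrec.nat_iff.1 h3, fun a => ?_⟩
  by_cases hR : R a <;> simp [hR]

theorem decS5 {R : ℕ × ℕ × ℕ × ℕ × ℕ → Prop} (h : PrimrecPred R) :
    DecS fun ρ => R (ρ 0, ρ 1, ρ 2, ρ 3, ρ 4) := by
  obtain ⟨f, hf, hR⟩ := exists_primrec_char h
  have v := IsT.var
  have hd := defS_primrec hf
  have key : ∀ k, DefS fun ρ => ∃ a, ∃ b, ∃ c, ∃ d, Nat.pair (ρ 3) (ρ 4) = a ∧
      Nat.pair (ρ 2) a = b ∧ Nat.pair (ρ 1) b = c ∧ Nat.pair (ρ 0) c = d ∧ f d = k := by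
    intro k
    apply DefS.exists
    apply DefS.exists
    apply DefS.exists
    apply DefS.exists
    exact DefS.and (DefS.pair (v 7) (v 8) (v 3)) (DefS.and (DefS.pair (v 6) (v 3) (v 2))
      (DefS.and (DefS.pair (v 5) (v 2) (v 1)) (DefS.and (DefS.pair (v 4) (v 1) (v 0))
      (DefS.comp2 (R := fun a b => f a = b) hd (v 0) (IsT.const k)))))
  have henc : ∀ a b c d e : ℕ, Encodable.encode (a, b, c, d, e) =
      Nat.pair a (Nat.pair b (Nat.pair c (Nat.pair d e))) := fun _ _ _ _ _ => rfl
  constructor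
  · refine (key 1).of_iff fun ρ => ?_
    rw [← (hR _).1, henc]
    simp
  · refine (key 0).of_iff fun ρ => ?_
    rw [← (hR _).2, henc]
    simp

def truncEnv (N : ℕ) : ℕ → ATerm := fun n => if n < N then .var n else .zero

/-- The representation lemma. -/
theorem rep {R : (ℕ → ℕ) → Prop} (h : DecS R) (N : ℕ)
    (hN : ∀ ρ, R ρ ↔ R fun n => if n < N then ρ n else 0) :
    ∃ θ, IsDelta0 θ ∧ θ.FreeLt (N + 1) ∧
      (∀ ρ, R ρ ↔ ∃ z, θ.Sat (scons z ρ)) ∧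
      (∀ ρ, ¬ R ρ → ∀ M : Mdl, M.Models PA → ∀ ζ : M.D,
        ¬ M.Sat (scons ζ fun n => M.num (ρ n)) θ) := by
  obtain ⟨⟨θp, hp0, hp⟩, θm, hm0, hm⟩ := h
  let θ₁ : AFml := .and θp (allB (.var 0) (.neg (θm.substAll skip1)))
  have d1 : IsDelta0 θ₁ := .and hp0 (.ball _ (.neg (hm0.substAll _)))
  have nat1 : ∀ ρ, R ρ ↔ ∃ z, θ₁.Sat (scons z ρ) := by
    intro ρ
    constructor
    · intro h
      obtain ⟨z, hz⟩ := (hp ρ).1 h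
      refine ⟨z, hz, ?_⟩
      rw [sat_allB]
      intro a _ ha
      rw [sat_subst, skip1_env] at ha
      exact (hm ρ).2 ⟨a, ha⟩ h
    · rintro ⟨z, hz, _⟩
      exact (hp ρ).2 ⟨z, hz⟩
  have M1 : ∀ ρ, ¬ R ρ → ∀ M : Mdl, M.Models PA → ∀ ζ : M.D,
        ¬ M.Sat (scons ζ fun n => M.num (ρ n)) θ₁ := by
    intro ρ hR M hM ζ hζ
    obtain ⟨k, hk⟩ := (hm ρ).1 hR
    rcases hM.total' k ζ with ⟨j, _, rfl⟩ | hle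
    · rw [M.scons_num, hM.abs0 d1] at hζ
      exact hR ((nat1 ρ).2 ⟨j, hζ⟩)
    · have h2 := hζ.2
      rw [M.sat_allB] at h2
      apply h2 (M.num k) hle
      rw [M.sat_subst]
      have : (fun n => M.val (scons (M.num k) (scons ζ fun n => M.num (ρ n))) (skip1 n)) =
          fun n => M.num (scons k ρ n) := by
        funext n
        cases n <;> rfl
      rw [this, hM.abs0 hm0]
      exact hk
  refine ⟨θ₁.substAll (truncEnv (N + 1)), d1.substAll _, ?_, ?_, ?_⟩
  · obtain ⟨c, hc⟩ := θ₁.exists_freeLt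
    refine hc.substAll fun n _ => ?_
    unfold truncEnv
    split_ifs with h
    · exact h
    · exact trivial
  · intro ρ
    rw [hN, nat1]
    refine exists_congr fun z => ?_
    rw [sat_subst]
    have : (fun n => (truncEnv (N + 1) n).val (scons z ρ)) =
        scons z fun n => if n < N then ρ n else 0 := by
      funext n
      cases n with
      | zero => rfl
      | succ n => by_cases h : n < N <;> simp [truncEnv, h, ATerm.val, scons]
    rw [this]
  · intro ρ hR M hM ζ hζ
    rw [hN] at hR
    apply M1 _ hR M hM ζ
    rw [M.sat_subst] at hζ
    have : (fun n => M.val (scons ζ fun n => M.num (ρ n)) (truncEnv (N + 1) n)) =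
        scons ζ fun n => M.num (if n < N then ρ n else 0) := by
      funext n
      cases n with
      | zero => rfl
      | succ n => by_cases h : n < N <;> simp [truncEnv, h, Mdl.val, scons, Mdl.num]
    rw [this] at hζ
    exact hζ

/-! ## Part C2: functions with `Σ₁` graph -/

def GF (f : (ℕ → ℕ) → ℕ) : Prop := DefS fun ρ => f (fun n => ρ (n + 1)) = ρ 0

theorem DefS.gcomp {Q : ℕ → (ℕ → ℕ) → Prop} {f : (ℕ → ℕ) → ℕ}
    (h : DefS fun ρ => Q (ρ 0) (fun n => ρ (n + 1))) (hf : GF f) : DefS fun ρ => Q (f ρ) ρ := by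
  have : DefS fun ρ => ∃ a, f ρ = a ∧ Q a ρ := DefS.exists (DefS.and hf h)
  exact this.of_iff fun ρ => by simp

theorem DefS.shift {R : (ℕ → ℕ) → Prop} (h : DefS R) : DefS fun ρ => R fun n => ρ (n + 1) :=
  h.subst fun n => .var (n + 1)

theorem DefS.shift2 {R : (ℕ → ℕ) → Prop} (h : DefS fun ρ => R (fun n => ρ (n + 1))) : DefS R :=
  (h.subst fun n => if n = 0 then .zero else .var (n - 1)).of_iff fun _ => Iff.rfl

theorem GF.shift {f : (ℕ → ℕ) → ℕ} (h : GF f) : GF fun ρ => f fun n => ρ (n + 1) := by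
  have := DefS.subst h fun n => if n = 0 then .var 0 else .var (n + 1)
  refine this.of_iff fun ρ => ?_
  simp [ATerm.val]

theorem GF.ofT {f : (ℕ → ℕ) → ℕ} (h : IsT f) : GF f := by
  obtain ⟨t, ht⟩ := h
  refine DefS.of_iff (DefS.eq (f := fun ρ => (t.substAll (shiftEnv 0)).val ρ) ⟨_, fun _ => rfl⟩
    (IsT.var 0)) fun ρ => ?_
  rw [← ATerm.lift_eq]
  have : ρ = scons (ρ 0) fun n => ρ (n + 1) := by
    funext n
    cases n <;> rfl
  have h2 : (t.lift 0).val ρ = t.val fun n => ρ (n + 1) := by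
    conv_lhs => rw [this]
    exact val_lift0 _ _ _
  rw [h2, ht]

theorem GF.var (n : ℕ) : GF fun ρ => ρ n := GF.ofT (IsT.var n)
theorem GF.const (k : ℕ) : GF fun _ => k := GF.ofT (IsT.const k)

theorem GF.of1 {h : ℕ → ℕ} (hh : Primrec h) {f : (ℕ → ℕ) → ℕ} (hf : GF f) :
    GF fun ρ => h (f ρ) := by
  have : DefS fun ρ => ∃ a, f (fun n => ρ (n + 1)) = a ∧ h a = ρ 0 := by
    apply DefS.exists
    refine DefS.and ?_ ?_
    · exact GF.shift hf
    · exact DefS.comp2 (R := fun a b => h a = b) (defS_primrec (Primrec.nat_iff.1 hh))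
        (IsT.var 0) (IsT.var 1)
  exact this.of_iff fun ρ => by simp

theorem GF.pair {f g : (ℕ → ℕ) → ℕ} (hf : GF f) (hg : GF g) :
    GF fun ρ => Nat.pair (f ρ) (g ρ) := by
  have : DefS fun ρ => ∃ a, ∃ b, g (fun n => ρ (n + 1)) = b ∧ f (fun n => ρ (n + 1)) = a ∧
      Nat.pair a b = ρ 0 := by
    apply DefS.exists
    apply DefS.exists
    refine DefS.and ?_ (DefS.and ?_ (DefS.pair (IsT.var 1) (IsT.var 0) (IsT.var 2)))
    · exact GF.shift (f := fun ρ => g fun n => ρ (n + 1)) (GF.shift hg)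
    · refine DefS.of_iff ((GF.shift hf).subst fun n => if n = 0 then .var 1 else .var (n + 1))
        fun ρ => ?_
      simp [ATerm.val]
  exact this.of_iff fun ρ => by simp

theorem GF.of2 {h : ℕ → ℕ → ℕ} (hh : Primrec₂ h) {f g : (ℕ → ℕ) → ℕ} (hf : GF f) (hg : GF g) :
    GF fun ρ => h (f ρ) (g ρ) := by
  have h1 : Primrec fun n : ℕ => h n.unpair.1 n.unpair.2 :=
    hh.comp (Primrec.fst.comp Primrec.unpair) (Primrec.snd.comp Primrec.unpair)
  have := GF.of1 h1 (GF.pair hf hg)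
  simpa using this

theorem GF.add {f g : (ℕ → ℕ) → ℕ} (hf : GF f) (hg : GF g) : GF fun ρ => f ρ + g ρ :=
  GF.of2 Primrec.nat_add hf hg
theorem GF.sub {f g : (ℕ → ℕ) → ℕ} (hf : GF f) (hg : GF g) : GF fun ρ => f ρ - g ρ :=
  GF.of2 Primrec.nat_sub hf hg
theorem GF.mul {f g : (ℕ → ℕ) → ℕ} (hf : GF f) (hg : GF g) : GF fun ρ => f ρ * g ρ :=
  GF.of2 Primrec.nat_mul hf hg
theorem GF.div {f g : (ℕ → ℕ) → ℕ} (hf : GF f) (hg : GF g) : GF fun ρ => f ρ / g ρ :=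
  GF.of2 Primrec.nat_div hf hg
theorem GF.mod {f g : (ℕ → ℕ) → ℕ} (hf : GF f) (hg : GF g) : GF fun ρ => f ρ % g ρ :=
  GF.of2 Primrec.nat_mod hf hg
theorem primrec_pow : Primrec₂ fun a b : ℕ => a ^ b := by
  have h : Primrec₂ fun (a : ℕ) (b : ℕ) =>
      Nat.rec (motive := fun _ => ℕ) 1 (fun _ r => r * a) b :=
    Primrec.nat_rec (f := fun _ : ℕ => 1) (g := fun (a : ℕ) (p : ℕ × ℕ) => p.2 * a)
      (Primrec.const 1)
      (Primrec.nat_mul.comp (Primrec.snd.comp Primrec.snd) Primrec.fst)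
  refine h.of_eq fun a b => ?_
  induction b with
  | zero => rfl
  | succ b ih => rw [pow_succ, ← ih]
theorem GF.pow {f g : (ℕ → ℕ) → ℕ} (hf : GF f) (hg : GF g) : GF fun ρ => f ρ ^ g ρ :=
  GF.of2 primrec_pow hf hg
theorem GF.unpair1 {f : (ℕ → ℕ) → ℕ} (hf : GF f) : GF fun ρ => (f ρ).unpair.1 :=
  GF.of1 (h := fun n => n.unpair.1) (Primrec.fst.comp Primrec.unpair) hf
theorem GF.unpair2 {f : (ℕ → ℕ) → ℕ} (hf : GF f) : GF fun ρ => (f ρ).unpair.2 :=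
  GF.of1 (h := fun n => n.unpair.2) (Primrec.snd.comp Primrec.unpair) hf

theorem DefS.comp1g {R : ℕ → Prop} (h : DefS fun ρ => R (ρ 0)) {f : (ℕ → ℕ) → ℕ} (hf : GF f) :
    DefS fun ρ => R (f ρ) := DefS.gcomp (Q := fun a _ => R a) h hf

theorem DefS.comp2g {R : ℕ → ℕ → Prop} (h : DefS fun ρ => R (ρ 0) (ρ 1)) {f g : (ℕ → ℕ) → ℕ}
    (hf : GF f) (hg : GF g) : DefS fun ρ => R (f ρ) (g ρ) := by
  refine DefS.gcomp (Q := fun a ρ => R a (g ρ)) ?_ hf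
  exact DefS.gcomp (Q := fun b ρ => R (ρ 0) b) (DefS.comp2 h (IsT.var 1) (IsT.var 0)) hg.shift

theorem DefS.comp3g {R : ℕ → ℕ → ℕ → Prop} (h : DefS fun ρ => R (ρ 0) (ρ 1) (ρ 2))
    {f g k : (ℕ → ℕ) → ℕ} (hf : GF f) (hg : GF g) (hk : GF k) :
    DefS fun ρ => R (f ρ) (g ρ) (k ρ) := by
  have h1 : DefS fun ρ => (fun p c => R p.unpair.1 p.unpair.2 c) (ρ 0) (ρ 1) := by
    have : DefS fun ρ => ∃ a, ∃ b, Nat.pair a b = ρ 0 ∧ R a b (ρ 1) := by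
      apply DefS.exists
      apply DefS.exists
      exact DefS.and (DefS.pair (IsT.var 1) (IsT.var 0) (IsT.var 2))
        (DefS.comp3 h (IsT.var 1) (IsT.var 0) (IsT.var 3))
    refine this.of_iff fun ρ => ?_
    constructor
    · intro h
      exact ⟨_, _, Nat.pair_unpair _, h⟩
    · rintro ⟨a, b, h, h'⟩
      rw [← h]; simpa using h'
  have := DefS.comp2g (R := fun p c => R p.unpair.1 p.unpair.2 c) h1 (hf.pair hg) hk
  simpa using this

theorem DefS.comp4g {R : ℕ → ℕ → ℕ → ℕ → Prop} (h : DefS fun ρ => R (ρ 0) (ρ 1) (ρ 2) (ρ 3))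
    {f g k l : (ℕ → ℕ) → ℕ} (hf : GF f) (hg : GF g) (hk : GF k) (hl : GF l) :
    DefS fun ρ => R (f ρ) (g ρ) (k ρ) (l ρ) := by
  have h1 : DefS fun ρ => (fun p c d => R p.unpair.1 p.unpair.2 c d) (ρ 0) (ρ 1) (ρ 2) := by
    have : DefS fun ρ => ∃ a, ∃ b, Nat.pair a b = ρ 0 ∧ R a b (ρ 1) (ρ 2) := by
      apply DefS.exists
      apply DefS.exists
      refine DefS.and (DefS.pair (IsT.var 1) (IsT.var 0) (IsT.var 2)) ?_
      refine (h.subst fun n => if n = 0 then .var 1 else if n = 1 then .var 0 else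
        .var (n + 1)).of_iff fun ρ => ?_
      simp [ATerm.val]
    refine this.of_iff fun ρ => ?_
    constructor
    · intro h
      exact ⟨_, _, Nat.pair_unpair _, h⟩
    · rintro ⟨a, b, h, h'⟩
      rw [← h]; simpa using h'
  have := DefS.comp3g (R := fun p c d => R p.unpair.1 p.unpair.2 c d) h1 (hf.pair hg) hk hl
  simpa using this

theorem DefS.comp5g {R : ℕ → ℕ → ℕ → ℕ → ℕ → Prop}
    (h : DefS fun ρ => R (ρ 0) (ρ 1) (ρ 2) (ρ 3) (ρ 4))
    {f g k l m : (ℕ → ℕ) → ℕ} (hf : GF f) (hg : GF g) (hk : GF k) (hl : GF l) (hm : GF m) :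
    DefS fun ρ => R (f ρ) (g ρ) (k ρ) (l ρ) (m ρ) := by
  have h1 : DefS fun ρ => (fun p c d e => R p.unpair.1 p.unpair.2 c d e)
      (ρ 0) (ρ 1) (ρ 2) (ρ 3) := by
    have : DefS fun ρ => ∃ a, ∃ b, Nat.pair a b = ρ 0 ∧ R a b (ρ 1) (ρ 2) (ρ 3) := by
      apply DefS.exists
      apply DefS.exists
      refine DefS.and (DefS.pair (IsT.var 1) (IsT.var 0) (IsT.var 2)) ?_
      refine (h.subst fun n => if n = 0 then .var 1 else if n = 1 then .var 0 else
        .var (n + 1)).of_iff fun ρ => ?_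
      simp [ATerm.val]
    refine this.of_iff fun ρ => ?_
    constructor
    · intro h
      exact ⟨_, _, Nat.pair_unpair _, h⟩
    · rintro ⟨a, b, h, h'⟩
      rw [← h]; simpa using h'
  have := DefS.comp4g (R := fun p c d e => R p.unpair.1 p.unpair.2 c d e) h1 (hf.pair hg) hk hl hm
  simpa using this

theorem DefS.ballg {Q : ℕ → (ℕ → ℕ) → Prop} {f : (ℕ → ℕ) → ℕ} (hf : GF f)
    (h : DefS fun ρ => Q (ρ 0) (fun n => ρ (n + 1))) :
    DefS fun ρ => ∀ a ≤ f ρ, Q a ρ := by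
  refine DefS.gcomp (Q := fun b ρ => ∀ a ≤ b, Q a ρ) ?_ hf
  refine DefS.ball (Q := fun a ρ => Q a fun n => ρ (n + 1)) (IsT.var 0) ?_
  refine (h.subst fun n => if n = 0 then .var 0 else .var (n + 1)).of_iff fun ρ => ?_
  simp [ATerm.val]

theorem DefS.bexg {Q : ℕ → (ℕ → ℕ) → Prop} {f : (ℕ → ℕ) → ℕ} (hf : GF f)
    (h : DefS fun ρ => Q (ρ 0) (fun n => ρ (n + 1))) :
    DefS fun ρ => ∃ a ≤ f ρ, Q a ρ := by
  refine DefS.gcomp (Q := fun b ρ => ∃ a ≤ b, Q a ρ) ?_ hf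
  refine DefS.exists (Q := fun a ρ => a ≤ ρ 0 ∧ Q a fun n => ρ (n + 1)) ?_
  refine DefS.and (DefS.le (IsT.var 0) (IsT.var 1)) ?_
  refine (h.subst fun n => if n = 0 then .var 0 else .var (n + 1)).of_iff fun ρ => ?_
  simp [ATerm.val]

theorem DefS.eqg {f g : (ℕ → ℕ) → ℕ} (hf : GF f) (hg : GF g) : DefS fun ρ => f ρ = g ρ :=
  DefS.comp2g (R := fun a b => a = b) (DefS.eq (IsT.var 0) (IsT.var 1)) hf hg

theorem DecS.not {R : (ℕ → ℕ) → Prop} (h : DecS R) : DecS fun ρ => ¬ R ρ :=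
  ⟨h.2, h.1.of_iff fun _ => not_not⟩
theorem DecS.and {R S : (ℕ → ℕ) → Prop} (h : DecS R) (h' : DecS S) : DecS fun ρ => R ρ ∧ S ρ :=
  ⟨h.1.and h'.1, (h.2.or h'.2).of_iff fun _ => not_and_or⟩
theorem DecS.or {R S : (ℕ → ℕ) → Prop} (h : DecS R) (h' : DecS S) : DecS fun ρ => R ρ ∨ S ρ :=
  ⟨h.1.or h'.1, (h.2.and h'.2).of_iff fun _ => not_or⟩
theorem DecS.of_iff {R S : (ℕ → ℕ) → Prop} (h : DecS R) (hRS : ∀ ρ, S ρ ↔ R ρ) : DecS S :=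
  ⟨h.1.of_iff hRS, h.2.of_iff fun ρ => not_congr (hRS ρ)⟩
theorem DecS.imp {R S : (ℕ → ℕ) → Prop} (h : DecS R) (h' : DecS S) : DecS fun ρ => R ρ → S ρ :=
  (h.not.or h').of_iff fun _ => imp_iff_not_or
theorem DecS.iff {R S : (ℕ → ℕ) → Prop} (h : DecS R) (h' : DecS S) :
    DecS fun ρ => (R ρ ↔ S ρ) :=
  ((h.imp h').and (h'.imp h)).of_iff fun _ => iff_iff_implies_and_implies
theorem DecS.eq {f g : (ℕ → ℕ) → ℕ} (hf : GF f) (hg : GF g) : DecS fun ρ => f ρ = g ρ := by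
  refine ⟨DefS.eqg hf hg, ?_⟩
  exact DefS.comp2g (R := fun a b => ¬ a = b)
    (((DefS.lt (IsT.var 0) (IsT.var 1)).or (DefS.lt (IsT.var 1) (IsT.var 0))).of_iff
      fun _ => Nat.ne_iff_lt_or_gt) hf hg
theorem DecS.le {f g : (ℕ → ℕ) → ℕ} (hf : GF f) (hg : GF g) : DecS fun ρ => f ρ ≤ g ρ := by
  refine ⟨?_, ?_⟩
  · exact DefS.comp2g (R := fun a b => a ≤ b) (DefS.le (IsT.var 0) (IsT.var 1)) hf hg
  · exact DefS.comp2g (R := fun a b => ¬ a ≤ b)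
      ((DefS.lt (IsT.var 1) (IsT.var 0)).of_iff fun _ => Nat.not_le) hf hg
theorem DecS.lt {f g : (ℕ → ℕ) → ℕ} (hf : GF f) (hg : GF g) : DecS fun ρ => f ρ < g ρ :=
  (DecS.le (hf.add (GF.const 1)) hg).of_iff fun _ => Nat.lt_iff_add_one_le
theorem DecS.ball {Q : ℕ → (ℕ → ℕ) → Prop} {f : (ℕ → ℕ) → ℕ} (hf : GF f)
    (h : DecS fun ρ => Q (ρ 0) (fun n => ρ (n + 1))) :
    DecS fun ρ => ∀ a ≤ f ρ, Q a ρ := by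
  refine ⟨DefS.ballg hf h.1, ?_⟩
  refine (DefS.bexg (Q := fun a ρ => ¬ Q a ρ) hf h.2).of_iff fun ρ => ?_
  push Not
  rfl
theorem DecS.bex {Q : ℕ → (ℕ → ℕ) → Prop} {f : (ℕ → ℕ) → ℕ} (hf : GF f)
    (h : DecS fun ρ => Q (ρ 0) (fun n => ρ (n + 1))) :
    DecS fun ρ => ∃ a ≤ f ρ, Q a ρ := by
  refine ⟨DefS.bexg hf h.1, ?_⟩
  refine (DefS.ballg (Q := fun a ρ => ¬ Q a ρ) hf h.2).of_iff fun ρ => ?_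
  push Not
  rfl
theorem DecS.comp1 {R : ℕ → Prop} (h : DecS fun ρ => R (ρ 0)) {f : (ℕ → ℕ) → ℕ} (hf : GF f) :
    DecS fun ρ => R (f ρ) := ⟨h.1.comp1g hf, DefS.comp1g (R := fun a => ¬ R a) h.2 hf⟩
theorem DecS.comp2 {R : ℕ → ℕ → Prop} (h : DecS fun ρ => R (ρ 0) (ρ 1)) {f g : (ℕ → ℕ) → ℕ}
    (hf : GF f) (hg : GF g) : DecS fun ρ => R (f ρ) (g ρ) :=
  ⟨h.1.comp2g hf hg, DefS.comp2g (R := fun a b => ¬ R a b) h.2 hf hg⟩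
theorem DecS.comp3 {R : ℕ → ℕ → ℕ → Prop} (h : DecS fun ρ => R (ρ 0) (ρ 1) (ρ 2))
    {f g k : (ℕ → ℕ) → ℕ} (hf : GF f) (hg : GF g) (hk : GF k) :
    DecS fun ρ => R (f ρ) (g ρ) (k ρ) :=
  ⟨h.1.comp3g hf hg hk, DefS.comp3g (R := fun a b c => ¬ R a b c) h.2 hf hg hk⟩
theorem DecS.comp4 {R : ℕ → ℕ → ℕ → ℕ → Prop} (h : DecS fun ρ => R (ρ 0) (ρ 1) (ρ 2) (ρ 3))
    {f g k l : (ℕ → ℕ) → ℕ} (hf : GF f) (hg : GF g) (hk : GF k) (hl : GF l) :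
    DecS fun ρ => R (f ρ) (g ρ) (k ρ) (l ρ) :=
  ⟨h.1.comp4g hf hg hk hl, DefS.comp4g (R := fun a b c d => ¬ R a b c d) h.2 hf hg hk hl⟩
theorem DecS.comp5 {R : ℕ → ℕ → ℕ → ℕ → ℕ → Prop}
    (h : DecS fun ρ => R (ρ 0) (ρ 1) (ρ 2) (ρ 3) (ρ 4))
    {f g k l m : (ℕ → ℕ) → ℕ} (hf : GF f) (hg : GF g) (hk : GF k) (hl : GF l) (hm : GF m) :
    DecS fun ρ => R (f ρ) (g ρ) (k ρ) (l ρ) (m ρ) :=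
  ⟨h.1.comp5g hf hg hk hl hm, DefS.comp5g (R := fun a b c d e => ¬ R a b c d e) h.2 hf hg hk hl hm⟩
theorem DecS.primrec {p : ℕ → Bool} (hp : Primrec p) {f : (ℕ → ℕ) → ℕ} (hf : GF f) :
    DecS fun ρ => p (f ρ) = true := by
  have h1 : Primrec fun n => cond (p n) 1 0 :=
    Primrec.cond hp (Primrec.const 1) (Primrec.const 0)
  refine (DecS.eq (GF.of1 h1 hf) (GF.const 1)).of_iff fun ρ => ?_
  cases p (f ρ) <;> simp
theorem DecS.delta0 {θ : AFml} (h : IsDelta0 θ) : DecS θ.Sat :=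
  ⟨DefS.delta0 h, DefS.delta0 h.neg⟩

/-- Bits of masks. -/
def bit (K x : ℕ) : Prop := K / 2 ^ x % 2 = 1

theorem bit_iff (K x : ℕ) : bit K x ↔ K.testBit x = true := by
  simp [bit, Nat.testBit_eq_decide_div_mod_eq]

theorem decS_bit {f g : (ℕ → ℕ) → ℕ} (hf : GF f) (hg : GF g) : DecS fun ρ => bit (f ρ) (g ρ) :=
  DecS.eq ((hf.div ((GF.const 2).pow hg)).mod (GF.const 2)) (GF.const 1)

theorem exists_mask (S : ℕ → Prop) (N : ℕ) : ∃ K < 2 ^ N, ∀ x < N, bit K x ↔ S x := by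
  classical
  induction N with
  | zero => exact ⟨0, by simp, by simp⟩
  | succ N ih =>
    obtain ⟨K, hK, h⟩ := ih
    by_cases hS : S N
    · refine ⟨2 ^ N + K, by rw [pow_succ]; omega, fun x hx => ?_⟩
      rw [bit_iff]
      rcases Nat.lt_or_ge x N with h1 | h1
      · rw [Nat.testBit_two_pow_add_gt h1, ← bit_iff]; exact h x h1
      · obtain rfl : x = N := by omega
        rw [Nat.testBit_two_pow_add_eq]
        simp [Nat.testBit_lt_two_pow hK, hS]
    · refine ⟨K, by rw [pow_succ]; omega, fun x hx => ?_⟩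
      rcases Nat.lt_or_ge x N with h1 | h1
      · exact h x h1
      · obtain rfl : x = N := by omega
        rw [bit_iff]
        simp [Nat.testBit_lt_two_pow hK, hS]

theorem DefS.ltg {f g : (ℕ → ℕ) → ℕ} (hf : GF f) (hg : GF g) : DefS fun ρ => f ρ < g ρ :=
  (DecS.lt hf hg).1
theorem DefS.leg {f g : (ℕ → ℕ) → ℕ} (hf : GF f) (hg : GF g) : DefS fun ρ => f ρ ≤ g ρ :=
  (DecS.le hf hg).1

/-- Inductively generated sets of numbers. -/
inductive Gen (R0 : ℕ → Prop) (R : ℕ → ℕ → ℕ → Prop) : ℕ → Prop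
  | base {x} : R0 x → Gen R0 R x
  | step {a b x} : Gen R0 R a → Gen R0 R b → R a b x → Gen R0 R x

theorem Gen.exists_seq {R0 : ℕ → Prop} {R : ℕ → ℕ → ℕ → Prop} {x : ℕ} (h : Gen R0 R x) :
    ∃ (f : ℕ → ℕ) (N : ℕ), f N = x ∧ ∀ i ≤ N, R0 (f i) ∨
      ∃ j ≤ i, ∃ k ≤ i, j < i ∧ k < i ∧ R (f j) (f k) (f i) := by
  induction h with
  | base h => exact ⟨fun _ => _, 0, rfl, fun i _ => .inl h⟩
  | @step a b x _ _ hR iha ihb =>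
    obtain ⟨f, N, hf, hf'⟩ := iha
    obtain ⟨g, L, hg, hg'⟩ := ihb
    have e1 : ∀ i, i ≤ N → (fun i => if i ≤ N then f i else if i ≤ N + 1 + L then g (i - (N + 1))
      else x) i = f i := fun i hi => by simp [hi]
    have e2 : ∀ i, i ≤ L → (fun i => if i ≤ N then f i else if i ≤ N + 1 + L then g (i - (N + 1))
      else x) (N + 1 + i) = g i := fun i hi => by
        have h1 : ¬ (N + 1 + i ≤ N) := by omega
        simp [hi, h1]
    have e3 : (fun i => if i ≤ N then f i else if i ≤ N + 1 + L then g (i - (N + 1))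
      else x) (N + 1 + L + 1) = x := by
        have h1 : ¬ (N + 1 + L + 1 ≤ N) := by omega
        simp [h1]
    generalize (fun i => if i ≤ N then f i else if i ≤ N + 1 + L then g (i - (N + 1))
      else x) = F at e1 e2 e3
    refine ⟨F, N + 1 + L + 1, e3, fun i hi => ?_⟩
    rcases Nat.lt_or_ge N i with h1 | h1
    · rcases Nat.lt_or_ge (N + 1 + L) i with h2 | h2
      · obtain rfl : i = N + 1 + L + 1 := by omega
        refine .inr ⟨N, by omega, N + 1 + L, by omega, by omega, by omega, ?_⟩
        rw [e1 N le_rfl, e2 L le_rfl, e3, hf, hg]; exact hR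
      · obtain ⟨i, rfl⟩ : ∃ i', i = N + 1 + i' := ⟨i - (N + 1), by omega⟩
        rcases hg' i (by omega) with h | ⟨j, hj, k, hk, hj', hk', h⟩
        · left; rw [e2 i (by omega)]; exact h
        · refine .inr ⟨N + 1 + j, by omega, N + 1 + k, by omega, by omega, by omega, ?_⟩
          rw [e2 i (by omega), e2 j (by omega), e2 k (by omega)]; exact h
    · rcases hf' i h1 with h | ⟨j, hj, k, hk, hj', hk', h⟩
      · left; rw [e1 i h1]; exact h
      · refine .inr ⟨j, hj, k, hk, hj', hk', ?_⟩
        rw [e1 i h1, e1 j (by omega), e1 k (by omega)]; exact h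

theorem GF.beta {f g : (ℕ → ℕ) → ℕ} (hf : GF f) (hg : GF g) :
    GF fun ρ => Nat.beta (f ρ) (g ρ) :=
  DefS.comp3g (R := fun a b c => Nat.beta a b = c) defS_beta hf.shift hg.shift (GF.var 0)

theorem Gen.defS {R0 : ℕ → Prop} {R : ℕ → ℕ → ℕ → Prop} (h0 : DefS fun ρ => R0 (ρ 0))
    (h : DefS fun ρ => R (ρ 0) (ρ 1) (ρ 2)) : DefS fun ρ => Gen R0 R (ρ 0) := by
  have key : DefS fun ρ => ∃ b, ∃ N, Nat.beta b N = ρ 0 ∧ ∀ i ≤ N, (R0 (Nat.beta b i) ∨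
      ∃ j ≤ i, ∃ k ≤ i, j < i ∧ k < i ∧ R (Nat.beta b j) (Nat.beta b k) (Nat.beta b i)) := by
    apply DefS.exists
    apply DefS.exists
    apply DefS.and (DefS.eqg (GF.beta (GF.var _) (GF.var _)) (GF.var _))
    apply DefS.ballg (GF.var _)
    apply DefS.or
    · exact DefS.comp1g h0 (GF.beta (GF.var _) (GF.var _))
    · apply DefS.bexg (GF.var _)
      apply DefS.bexg (GF.var _)
      apply DefS.and (DecS.lt (GF.var _) (GF.var _)).1
      apply DefS.and (DecS.lt (GF.var _) (GF.var _)).1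
      exact DefS.comp3g h (GF.beta (GF.var _) (GF.var _)) (GF.beta (GF.var _) (GF.var _))
        (GF.beta (GF.var _) (GF.var _))
  refine key.of_iff fun ρ => ⟨fun h => ?_, ?_⟩
  · obtain ⟨f, N, hN, hf⟩ := h.exists_seq
    obtain ⟨b, hb⟩ := exists_beta f N
    refine ⟨b, N, by rw [hb N le_rfl, hN], fun i hi => ?_⟩
    rcases hf i hi with h | ⟨j, hj, k, hk, hj', hk', h⟩
    · left; rwa [hb i hi]
    · right
      refine ⟨j, hj, k, hk, hj', hk', ?_⟩
      rwa [hb i hi, hb j (by omega), hb k (by omega)]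
  · rintro ⟨b, N, h, hs⟩
    rw [← h]
    have : ∀ i, i ≤ N → Gen R0 R (Nat.beta b i) := by
      intro i
      induction i using Nat.strong_induction_on with
      | _ i ih =>
        intro hi
        rcases hs i hi with h | ⟨j, hj, k, hk, hj', hk', h⟩
        · exact .base h
        · exact .step (ih j hj' (by omega)) (ih k hk' (by omega)) h
    exact this N le_rfl

/-- Substitution operations. -/
inductive Op : Type
  | lift : ℕ → Op
  | sub : ℕ → ATerm → Op

def Op.code : Op → ℕ
  | .lift c => Nat.pair 0 c
  | .sub d t => Nat.pair 1 (Nat.pair d t.code)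

def Op.env : Op → ℕ → ATerm
  | .lift c => shiftEnv c
  | .sub d t => fun n => if n < d then .var n else if n = d then t else .var (n - 1)

def Op.up : Op → Op
  | .lift c => .lift (c + 1)
  | .sub d t => .sub (d + 1) (t.substAll (shiftEnv 0))

theorem Op.env_up (o : Op) : o.up.env = liftSub o.env := by
  funext n
  cases o with
  | lift c => exact congrFun (liftSub_shift c).symm n
  | sub d t =>
    cases n with
    | zero => simp [Op.up, Op.env, liftSub]
    | succ n =>
      rw [liftSub, ATerm.lift_eq]
      simp only [Op.up, Op.env]
      by_cases h1 : n < d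
      · simp [h1, ATerm.substAll, shiftEnv]
      · by_cases h2 : n = d
        · simp [h2]
        · have : n ≠ 0 := by omega
          obtain ⟨k, rfl⟩ : ∃ k, n = k + 1 := ⟨n - 1, by omega⟩
          simp [h1, h2, ATerm.substAll, shiftEnv]

def tr (o x y : ℕ) : ℕ := Nat.pair o (Nat.pair x y)

theorem tr_inj {o x y o' x' y' : ℕ} : tr o x y = tr o' x' y' ↔ o = o' ∧ x = x' ∧ y = y' := by
  simp [tr]

theorem GF.tr {f g h : (ℕ → ℕ) → ℕ} (hf : GF f) (hg : GF g) (hh : GF h) :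
    GF fun ρ => tr (f ρ) (g ρ) (h ρ) := hf.pair (hg.pair hh)

def TO0 (w : ℕ) : Prop := ∃ o, (∃ n, ∃ x, w = tr o (Nat.pair 0 n) x ∧
    ((∃ c, o = Nat.pair 0 c ∧ ((n < c ∧ x = Nat.pair 0 n) ∨ (c ≤ n ∧ x = Nat.pair 0 (n + 1)))) ∨
     (∃ d, ∃ t, o = Nat.pair 1 (Nat.pair d t) ∧ ((n < d ∧ x = Nat.pair 0 n) ∨ (n = d ∧ x = t) ∨
      (d < n ∧ x = Nat.pair 0 (n - 1)))))) ∨ w = tr o (Nat.pair 1 0) (Nat.pair 1 0)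

def TO1 (a b w : ℕ) : Prop := ∃ o, ∃ x, ∃ x', ∃ y, ∃ y', a = tr o x x' ∧ b = tr o y y' ∧
  (w = tr o (Nat.pair 2 x) (Nat.pair 2 x') ∨
   w = tr o (Nat.pair 3 (Nat.pair x y)) (Nat.pair 3 (Nat.pair x' y')) ∨
   w = tr o (Nat.pair 4 (Nat.pair x y)) (Nat.pair 4 (Nat.pair x' y')))

def TO : ℕ → Prop := Gen TO0 TO1

theorem TO.defS : DefS fun ρ => TO (ρ 0) := by
  apply Gen.defS
  · unfold TO0
    repeat' first
      | exact GF.var _ | exact GF.const _ | with_reducible apply GF.tr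
      | with_reducible apply GF.pair | with_reducible apply GF.add | with_reducible apply GF.sub
      | with_reducible apply DefS.and | with_reducible apply DefS.or
      | with_reducible apply DefS.exists | with_reducible apply DefS.eqg
      | with_reducible apply DefS.ltg | with_reducible apply DefS.leg
  · unfold TO1
    repeat' first
      | exact GF.var _ | exact GF.const _ | with_reducible apply GF.tr
      | with_reducible apply GF.pair | with_reducible apply GF.add | with_reducible apply GF.sub
      | with_reducible apply DefS.and | with_reducible apply DefS.or
      | with_reducible apply DefS.exists | with_reducible apply DefS.eqg
      | with_reducible apply DefS.ltg | with_reducible apply DefS.leg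

theorem TO_iff (o : Op) (x x' : ℕ) :
    TO (tr o.code x x') ↔ ∃ t : ATerm, x = t.code ∧ x' = (t.substAll o.env).code := by
  constructor
  · intro h
    generalize hw : tr o.code x x' = w at h
    induction h generalizing x x' with
    | base h =>
      subst hw
      obtain ⟨o', h | h⟩ := h
      · obtain ⟨n, y, h, h'⟩ := h
        rw [tr_inj] at h
        obtain ⟨rfl, rfl, rfl⟩ := h
        refine ⟨.var n, rfl, ?_⟩
        rcases h' with ⟨c, hc, h'⟩ | ⟨d, t, hc, h'⟩
        · cases o with
          | sub => simp [Op.code] at hc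
          | lift c' =>
            simp [Op.code] at hc
            subst hc
            rcases h' with ⟨h1, h2⟩ | ⟨h1, h2⟩
            · simp [ATerm.substAll, Op.env, shiftEnv, h1, h2, ATerm.code]
            · simp [ATerm.substAll, Op.env, shiftEnv, h1, h2, ATerm.code, Nat.not_lt.2 h1]
        · cases o with
          | lift => simp [Op.code] at hc
          | sub d' t' =>
            simp [Op.code] at hc
            obtain ⟨rfl, rfl⟩ := hc
            rcases h' with ⟨h1, h2⟩ | ⟨h1, h2⟩ | ⟨h1, h2⟩
            · simp [ATerm.substAll, Op.env, h1, h2, ATerm.code]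
            · simp [ATerm.substAll, Op.env, h1, h2]
            · have h3 : ¬ n < d' := by omega
              have h4 : n ≠ d' := by omega
              simp [ATerm.substAll, Op.env, h2, h3, h4, ATerm.code]
      · rw [tr_inj] at h
        obtain ⟨rfl, rfl, rfl⟩ := h
        exact ⟨.zero, rfl, rfl⟩
    | step _ _ hR iha ihb =>
      subst hw
      obtain ⟨o', x, x', y, y', rfl, rfl, h⟩ := hR
      simp only [tr_inj] at h
      have ho : o.code = o' := by tauto
      subst ho
      obtain ⟨t, rfl, rfl⟩ := iha _ _ rfl
      obtain ⟨s, rfl, rfl⟩ := ihb _ _ rfl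
      rcases h with ⟨_, rfl, rfl⟩ | ⟨_, rfl, rfl⟩ | ⟨_, rfl, rfl⟩
      · exact ⟨.succ t, rfl, rfl⟩
      · exact ⟨.add t s, rfl, rfl⟩
      · exact ⟨.mul t s, rfl, rfl⟩
  · rintro ⟨t, rfl, rfl⟩
    induction t with
    | var n =>
      refine .base ⟨o.code, .inl ⟨n, _, rfl, ?_⟩⟩
      cases o with
      | lift c =>
        left
        refine ⟨c, rfl, ?_⟩
        by_cases h : n < c
        · left; simp [ATerm.substAll, Op.env, shiftEnv, h, ATerm.code]
        · right; simp [ATerm.substAll, Op.env, shiftEnv, h, ATerm.code]; omega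
      | sub d t =>
        right
        refine ⟨d, t.code, rfl, ?_⟩
        rcases Nat.lt_trichotomy n d with h | h | h
        · left; simp [ATerm.substAll, Op.env, h, ATerm.code]
        · right; left; simp [ATerm.substAll, Op.env, h]
        · have h3 : ¬ n < d := by omega
          have h4 : n ≠ d := by omega
          right; right; simp [ATerm.substAll, Op.env, h, h3, h4, ATerm.code]
    | zero => exact .base ⟨o.code, .inr rfl⟩
    | succ t ih => exact .step ih ih ⟨_, _, _, _, _, rfl, rfl, .inl rfl⟩
    | add t s ih ih' => exact .step ih ih' ⟨_, _, _, _, _, rfl, rfl, .inr (.inl rfl)⟩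
    | mul t s ih ih' => exact .step ih ih' ⟨_, _, _, _, _, rfl, rfl, .inr (.inr rfl)⟩

/-- `OpUp o o'` : the operation `o'` is the operation `o` under a binder. -/
def OpUp (o o' : ℕ) : Prop := (∃ c, o = Nat.pair 0 c ∧ o' = Nat.pair 0 (c + 1)) ∨
  ∃ d, ∃ t, ∃ t', o = Nat.pair 1 (Nat.pair d t) ∧ o' = Nat.pair 1 (Nat.pair (d + 1) t') ∧
    TO (tr (Nat.pair 0 0) t t')

theorem OpUp_iff (o : Op) (o' : ℕ) : OpUp o.code o' ↔ o' = o.up.code := by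
  cases o with
  | lift c =>
    simp only [OpUp, Op.code, Op.up]
    constructor
    · rintro (⟨c', h, rfl⟩ | ⟨d, t, t', h, _⟩)
      · simp at h; rw [h]
      · simp at h
    · rintro rfl; exact .inl ⟨c, rfl, rfl⟩
  | sub d t =>
    have key := TO_iff (.lift 0) t.code
    simp only [Op.code, Op.env] at key
    simp only [OpUp, Op.code, Op.up]
    constructor
    · rintro (⟨c', h, rfl⟩ | ⟨d', t1, t', h, rfl, h'⟩)
      · simp at h
      · simp at h
        obtain ⟨rfl, rfl⟩ := h
        obtain ⟨s, hs, rfl⟩ := (key _).1 h'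
        rw [ATerm.code_inj hs]
    · rintro rfl
      exact .inr ⟨d, t.code, _, rfl, rfl, (key _).2 ⟨t, rfl, rfl⟩⟩

def FO0 (w : ℕ) : Prop := ∃ o, ∃ x, ∃ x', ∃ y, ∃ y', TO (tr o x x') ∧ TO (tr o y y') ∧
  (w = tr o (Nat.pair 0 (Nat.pair x y)) (Nat.pair 0 (Nat.pair x' y')) ∨
   w = tr o (Nat.pair 1 (Nat.pair x y)) (Nat.pair 1 (Nat.pair x' y')))

def FO1 (a b w : ℕ) : Prop := ∃ o, ∃ x, ∃ x', ∃ y, ∃ y', a = tr o x x' ∧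
  ((b = tr o y y' ∧
  (w = tr o (Nat.pair 2 x) (Nat.pair 2 x') ∨
   w = tr o (Nat.pair 3 (Nat.pair x y)) (Nat.pair 3 (Nat.pair x' y')) ∨
   w = tr o (Nat.pair 4 (Nat.pair x y)) (Nat.pair 4 (Nat.pair x' y')) ∨
   w = tr o (Nat.pair 5 (Nat.pair x y)) (Nat.pair 5 (Nat.pair x' y')))) ∨
  ∃ o', OpUp o' o ∧ (w = tr o' (Nat.pair 6 x) (Nat.pair 6 x') ∨
    w = tr o' (Nat.pair 7 x) (Nat.pair 7 x')))

def FO : ℕ → Prop := Gen FO0 FO1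

theorem FO.defS : DefS fun ρ => FO (ρ 0) := by
  have hTO : ∀ {f}, GF f → DefS fun ρ => TO (f ρ) := fun hf => DefS.comp1g TO.defS hf
  apply Gen.defS
  · unfold FO0
    repeat' first
      | exact GF.var _ | exact GF.const _ | with_reducible apply GF.tr
      | with_reducible apply GF.pair | with_reducible apply GF.add | with_reducible apply GF.sub
      | with_reducible apply hTO
      | with_reducible apply DefS.and | with_reducible apply DefS.or
      | with_reducible apply DefS.exists | with_reducible apply DefS.eqg
  · unfold FO1 OpUp
    repeat' first
      | exact GF.var _ | exact GF.const _ | with_reducible apply GF.tr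
      | with_reducible apply GF.pair | with_reducible apply GF.add | with_reducible apply GF.sub
      | with_reducible apply hTO
      | with_reducible apply DefS.and | with_reducible apply DefS.or
      | with_reducible apply DefS.exists | with_reducible apply DefS.eqg

theorem OpUp_code {o o' : ℕ} (h : OpUp o o') (x : Op) (hx : o = x.code) : o' = x.up.code := by
  subst hx; exact (OpUp_iff x o').1 h

theorem FO_iff (o : Op) (x x' : ℕ) :
    FO (tr o.code x x') ↔ ∃ φ : AFml, x = φ.code ∧ x' = (φ.substAll o.env).code := by
  constructor
  · intro h
    generalize hw : tr o.code x x' = w at h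
    induction h generalizing x x' o with
    | base h =>
      subst hw
      obtain ⟨o', x, x', y, y', h1, h2, h⟩ := h
      simp only [tr_inj] at h
      have ho : o.code = o' := by tauto
      subst ho
      obtain ⟨t, rfl, rfl⟩ := (TO_iff _ _ _).1 h1
      obtain ⟨s, rfl, rfl⟩ := (TO_iff _ _ _).1 h2
      rcases h with ⟨_, rfl, rfl⟩ | ⟨_, rfl, rfl⟩
      · exact ⟨.eq t s, rfl, rfl⟩
      · exact ⟨.le t s, rfl, rfl⟩
    | step _ _ hR iha ihb =>
      subst hw
      obtain ⟨o', x, x', y, y', rfl, h⟩ := hR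
      rcases h with ⟨rfl, h⟩ | ⟨o2, hup, h⟩
      · simp only [tr_inj] at h
        have ho : o.code = o' := by tauto
        subst ho
        obtain ⟨t, rfl, rfl⟩ := iha _ _ _ rfl
        obtain ⟨s, rfl, rfl⟩ := ihb _ _ _ rfl
        rcases h with ⟨_, rfl, rfl⟩ | ⟨_, rfl, rfl⟩ | ⟨_, rfl, rfl⟩ | ⟨_, rfl, rfl⟩
        · exact ⟨.neg t, rfl, rfl⟩
        · exact ⟨.and t s, rfl, rfl⟩
        · exact ⟨.or t s, rfl, rfl⟩
        · exact ⟨.imp t s, rfl, rfl⟩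
      · simp only [tr_inj] at h
        have ho : o.code = o2 := by tauto
        have := OpUp_code hup o ho.symm
        subst this
        obtain ⟨t, rfl, rfl⟩ := iha _ _ _ rfl
        rw [Op.env_up] at h
        rcases h with ⟨_, rfl, rfl⟩ | ⟨_, rfl, rfl⟩
        · exact ⟨.all t, rfl, rfl⟩
        · exact ⟨.ex t, rfl, rfl⟩
  · rintro ⟨φ, rfl, rfl⟩
    induction φ generalizing o with
    | eq t s => exact .base ⟨_, _, _, _, _, (TO_iff _ _ _).2 ⟨t, rfl, rfl⟩,
        (TO_iff _ _ _).2 ⟨s, rfl, rfl⟩, .inl rfl⟩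
    | le t s => exact .base ⟨_, _, _, _, _, (TO_iff _ _ _).2 ⟨t, rfl, rfl⟩,
        (TO_iff _ _ _).2 ⟨s, rfl, rfl⟩, .inr rfl⟩
    | neg φ ih => exact .step (ih o) (ih o) ⟨_, _, _, _, _, rfl, .inl ⟨rfl, .inl rfl⟩⟩
    | and φ ψ ih ih' =>
      exact .step (ih o) (ih' o) ⟨_, _, _, _, _, rfl, .inl ⟨rfl, .inr (.inl rfl)⟩⟩
    | or φ ψ ih ih' =>
      exact .step (ih o) (ih' o) ⟨_, _, _, _, _, rfl, .inl ⟨rfl, .inr (.inr (.inl rfl))⟩⟩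
    | imp φ ψ ih ih' =>
      exact .step (ih o) (ih' o) ⟨_, _, _, _, _, rfl, .inl ⟨rfl, .inr (.inr (.inr rfl))⟩⟩
    | all φ ih =>
      refine .step (ih o.up) (ih o.up) ⟨_, _, _, 0, 0, rfl, .inr ⟨o.code, ?_, .inl ?_⟩⟩
      · exact (OpUp_iff _ _).2 rfl
      · rw [Op.env_up]; rfl
    | ex φ ih =>
      refine .step (ih o.up) (ih o.up) ⟨_, _, _, 0, 0, rfl, .inr ⟨o.code, ?_, .inr ?_⟩⟩
      · exact (OpUp_iff _ _).2 rfl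
      · rw [Op.env_up]; rfl

def isTm (x : ℕ) : Prop := ∃ x', TO (tr (Nat.pair 0 0) x x')
def isFml (x : ℕ) : Prop := ∃ x', FO (tr (Nat.pair 0 0) x x')

theorem isTm_iff (x : ℕ) : isTm x ↔ ∃ t : ATerm, x = t.code := by
  have key := TO_iff (.lift 0) x
  simp only [Op.code] at key
  simp only [isTm, key]
  exact ⟨fun ⟨_, t, h, _⟩ => ⟨t, h⟩, fun ⟨t, h⟩ => ⟨_, t, h, rfl⟩⟩

theorem isFml_iff (x : ℕ) : isFml x ↔ ∃ φ : AFml, x = φ.code := by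
  have key := FO_iff (.lift 0) x
  simp only [Op.code] at key
  simp only [isFml, key]
  exact ⟨fun ⟨_, t, h, _⟩ => ⟨t, h⟩, fun ⟨t, h⟩ => ⟨_, t, h, rfl⟩⟩

/-- `K` is a truth assignment on the formula codes in `I` (up to `w`), locally correct. -/
def LocC (K I w : ℕ) : Prop := ∀ y ≤ w, ∀ a ≤ w, ∀ b ≤ w,
  (¬ bit I y) ∨
  (((¬ y = Nat.pair 2 a) ∨ (bit I a ∧ (bit K y ↔ ¬ bit K a))) ∧
   ((¬ y = Nat.pair 3 (Nat.pair a b)) ∨ (bit I a ∧ bit I b ∧ (bit K y ↔ (bit K a ∧ bit K b)))) ∧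
   ((¬ y = Nat.pair 4 (Nat.pair a b)) ∨ (bit I a ∧ bit I b ∧ (bit K y ↔ (bit K a ∨ bit K b)))) ∧
   ((¬ y = Nat.pair 5 (Nat.pair a b)) ∨
      (bit I a ∧ bit I b ∧ (bit K y ↔ ((¬ bit K a) ∨ bit K b)))))

theorem LocC.decS : DecS fun ρ => LocC (ρ 0) (ρ 1) (ρ 2) := by
  unfold LocC
  repeat' first
    | exact GF.var _ | exact GF.const _ | with_reducible apply GF.pair
    | with_reducible apply decS_bit | with_reducible apply DecS.eq
    | with_reducible apply DecS.and | with_reducible apply DecS.or | with_reducible apply DecS.iff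
    | with_reducible apply DecS.not | with_reducible apply DecS.ball

theorem le_pair_left' (k a : ℕ) : a ≤ Nat.pair k a := Nat.right_le_pair k a
theorem le_tag1 (k a b : ℕ) : a ≤ Nat.pair k (Nat.pair a b) :=
  (Nat.left_le_pair a b).trans (Nat.right_le_pair _ _)
theorem le_tag2 (k a b : ℕ) : b ≤ Nat.pair k (Nat.pair a b) :=
  (Nat.right_le_pair a b).trans (Nat.right_le_pair _ _)

theorem LocC.neg {K I w a : ℕ} (h : LocC K I w) (hw : Nat.pair 2 a ≤ w)
    (hI : bit I (Nat.pair 2 a)) : bit I a ∧ (bit K (Nat.pair 2 a) ↔ ¬ bit K a) := by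
  have ha := (Nat.right_le_pair 2 a).trans hw
  have := h _ hw a ha a ha
  tauto

theorem LocC.bin {K I w a b : ℕ} (h : LocC K I w) (k : ℕ) (hw : Nat.pair k (Nat.pair a b) ≤ w)
    (hI : bit I (Nat.pair k (Nat.pair a b))) :
    (k = 3 → bit I a ∧ bit I b ∧
      (bit K (Nat.pair 3 (Nat.pair a b)) ↔ (bit K a ∧ bit K b))) ∧
    (k = 4 → bit I a ∧ bit I b ∧
      (bit K (Nat.pair 4 (Nat.pair a b)) ↔ (bit K a ∨ bit K b))) ∧
    (k = 5 → bit I a ∧ bit I b ∧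
      (bit K (Nat.pair 5 (Nat.pair a b)) ↔ (bit K a → bit K b))) := by
  rcases h _ hw a ((le_tag1 _ _ _).trans hw) b ((le_tag2 _ _ _).trans hw) with h | ⟨_, h3, h4, h5⟩
  · exact absurd hI h
  refine ⟨?_, ?_, ?_⟩
  · rintro rfl; exact h3.resolve_left (not_not.2 rfl)
  · rintro rfl; exact h4.resolve_left (not_not.2 rfl)
  · rintro rfl
    have := h5.resolve_left (not_not.2 rfl)
    rwa [← imp_iff_not_or] at this

def tautCode (x : ℕ) : Prop := ∀ K ≤ 2 ^ (x + 1), ∀ I ≤ 2 ^ (x + 1),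
  (¬ LocC K I x) ∨ (¬ bit I x) ∨ bit K x

theorem tautCode.decS : DecS fun ρ => tautCode (ρ 0) := by
  have hL : ∀ {f g h}, GF f → GF g → GF h → DecS fun ρ => LocC (f ρ) (g ρ) (h ρ) :=
    fun hf hg hh => DecS.comp3 LocC.decS hf hg hh
  unfold tautCode
  repeat' first
    | exact GF.var _ | exact GF.const _ | with_reducible apply GF.pow | with_reducible apply GF.add
    | with_reducible apply decS_bit | with_reducible apply hL
    | with_reducible apply DecS.or
    | with_reducible apply DecS.not | with_reducible apply DecS.ball

theorem tautCode_iff (φ : AFml) : tautCode φ.code ↔ ATaut φ := by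
  constructor
  · intro h v
    obtain ⟨K, hK, hK'⟩ := exists_mask (fun x => ∃ ψ : AFml, x = ψ.code ∧ ψ.evalProp v)
      (φ.code + 1)
    obtain ⟨I, hI, hI'⟩ := exists_mask (fun x => ∃ ψ : AFml, x = ψ.code) (φ.code + 1)
    have hK2 : ∀ ψ : AFml, ψ.code ≤ φ.code → (bit K ψ.code ↔ ψ.evalProp v) := by
      intro ψ hψ
      rw [hK' _ (by omega)]
      constructor
      · rintro ⟨χ, h, h'⟩; rwa [AFml.code_inj h]
      · intro h; exact ⟨ψ, rfl, h⟩
    have hI2 : ∀ ψ : AFml, ψ.code ≤ φ.code → bit I ψ.code := by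
      intro ψ hψ
      rw [hI' _ (by omega)]
      exact ⟨ψ, rfl⟩
    rcases h K hK.le I hI.le with h | h | h
    · exfalso
      apply h
      intro y hy a ha b hb
      by_cases hIy : bit I y
      swap
      · exact .inl hIy
      right
      rw [hI' _ (by omega)] at hIy
      obtain ⟨ψ, rfl⟩ := hIy
      cases ψ with
      | neg χ =>
        refine ⟨?_, by simp [AFml.code], by simp [AFml.code], by simp [AFml.code]⟩
        rw [← imp_iff_not_or]
        intro he
        simp [AFml.code] at he
        subst he
        exact ⟨hI2 _ ha, by rw [hK2 _ hy, hK2 _ ha]; rfl⟩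
      | and χ ξ =>
        refine ⟨by simp [AFml.code], ?_, by simp [AFml.code], by simp [AFml.code]⟩
        rw [← imp_iff_not_or]
        intro he
        simp [AFml.code] at he
        obtain ⟨rfl, rfl⟩ := he
        exact ⟨hI2 _ ha, hI2 _ hb, by rw [hK2 _ hy, hK2 _ ha, hK2 _ hb]; rfl⟩
      | or χ ξ =>
        refine ⟨by simp [AFml.code], by simp [AFml.code], ?_, by simp [AFml.code]⟩
        rw [← imp_iff_not_or]
        intro he
        simp [AFml.code] at he
        obtain ⟨rfl, rfl⟩ := he
        exact ⟨hI2 _ ha, hI2 _ hb, by rw [hK2 _ hy, hK2 _ ha, hK2 _ hb]; rfl⟩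
      | imp χ ξ =>
        refine ⟨by simp [AFml.code], by simp [AFml.code], by simp [AFml.code], ?_⟩
        rw [← imp_iff_not_or]
        intro he
        simp [AFml.code] at he
        obtain ⟨rfl, rfl⟩ := he
        exact ⟨hI2 _ ha, hI2 _ hb, by
          rw [hK2 _ hy, hK2 _ ha, hK2 _ hb, ← imp_iff_not_or]; rfl⟩
      | eq | le | all | ex => simp [AFml.code]
    · exact absurd (hI2 φ le_rfl) h
    · exact (hK2 φ le_rfl).1 h
  · intro h K _ I _
    by_cases hL : LocC K I φ.code
    swap
    · exact .inl hL
    by_cases hI : bit I φ.code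
    swap
    · exact .inr (.inl hI)
    refine .inr (.inr ?_)
    have key : ∀ ψ : AFml, ψ.code ≤ φ.code → bit I ψ.code →
        (ψ.evalProp (fun χ => bit K χ.code) ↔ bit K ψ.code) := by
      intro ψ
      induction ψ with
      | eq | le | all | ex => intros; rfl
      | neg χ ih =>
        intro hw hi
        obtain ⟨h1, h2⟩ := hL.neg hw hi
        simp only [AFml.evalProp, ih ((le_pair_left' _ _).trans hw) h1]
        exact h2.symm
      | and χ ξ ih ih' =>
        intro hw hi
        obtain ⟨h1, h2, h3⟩ := (hL.bin 3 hw hi).1 rfl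
        simp only [AFml.evalProp, ih ((le_tag1 _ _ _).trans hw) h1,
          ih' ((le_tag2 _ _ _).trans hw) h2]
        exact h3.symm
      | or χ ξ ih ih' =>
        intro hw hi
        obtain ⟨h1, h2, h3⟩ := (hL.bin 4 hw hi).2.1 rfl
        simp only [AFml.evalProp, ih ((le_tag1 _ _ _).trans hw) h1,
          ih' ((le_tag2 _ _ _).trans hw) h2]
        exact h3.symm
      | imp χ ξ ih ih' =>
        intro hw hi
        obtain ⟨h1, h2, h3⟩ := (hL.bin 5 hw hi).2.2 rfl
        simp only [AFml.evalProp, ih ((le_tag1 _ _ _).trans hw) h1,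
          ih' ((le_tag2 _ _ _).trans hw) h2]
        exact h3.symm
    exact (key φ le_rfl hI).1 (h _)

/-- Codes of axioms. -/
def Thm0 (p : ℕ → Bool) (x : ℕ) : Prop :=
  (p x = true ∧ isFml x) ∨ (isFml x ∧ tautCode x) ∨
  (∃ f, ∃ t, ∃ g, isTm t ∧ FO (tr (Nat.pair 1 (Nat.pair 0 t)) f g) ∧
    (x = Nat.pair 5 (Nat.pair (Nat.pair 6 f) g) ∨ x = Nat.pair 5 (Nat.pair g (Nat.pair 7 f)))) ∨
  (∃ f, ∃ g, isFml f ∧ isFml g ∧ x = Nat.pair 5 (Nat.pair (Nat.pair 6 (Nat.pair 5 (Nat.pair f g)))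
    (Nat.pair 5 (Nat.pair (Nat.pair 6 f) (Nat.pair 6 g))))) ∨
  (∃ f, ∃ g, FO (tr (Nat.pair 0 0) f g) ∧ x = Nat.pair 5 (Nat.pair f (Nat.pair 6 g))) ∨
  (∃ f, isFml f ∧ x = Nat.pair 3 (Nat.pair
    (Nat.pair 5 (Nat.pair (Nat.pair 7 f) (Nat.pair 2 (Nat.pair 6 (Nat.pair 2 f)))))
    (Nat.pair 5 (Nat.pair (Nat.pair 2 (Nat.pair 6 (Nat.pair 2 f))) (Nat.pair 7 f))))) ∨
  (∃ t, isTm t ∧ x = Nat.pair 0 (Nat.pair t t)) ∨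
  (∃ f, ∃ t, ∃ s, ∃ g, ∃ h, isTm t ∧ isTm s ∧ FO (tr (Nat.pair 1 (Nat.pair 0 t)) f g) ∧
    FO (tr (Nat.pair 1 (Nat.pair 0 s)) f h) ∧
    x = Nat.pair 5 (Nat.pair (Nat.pair 0 (Nat.pair t s)) (Nat.pair 5 (Nat.pair g h))))

def Thm1 (a b x : ℕ) : Prop := a = Nat.pair 5 (Nat.pair b x) ∨ x = Nat.pair 6 a

def Thm (p : ℕ → Bool) : ℕ → Prop := Gen (Thm0 p) Thm1

theorem Thm.defS {p : ℕ → Bool} (hp : Primrec p) : DefS fun ρ => Thm p (ρ 0) := by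
  have hFO : ∀ {f}, GF f → DefS fun ρ => FO (f ρ) := fun hf => DefS.comp1g FO.defS hf
  have hTO : ∀ {f}, GF f → DefS fun ρ => TO (f ρ) := fun hf => DefS.comp1g TO.defS hf
  have hta : ∀ {f}, GF f → DefS fun ρ => tautCode (f ρ) :=
    fun hf => (DecS.comp1 tautCode.decS hf).1
  have hpp : ∀ {f}, GF f → DefS fun ρ => p (f ρ) = true := fun hf => (DecS.primrec hp hf).1
  apply Gen.defS
  · unfold Thm0 isFml isTm
    repeat' first
      | exact GF.var _ | exact GF.const _ | with_reducible apply GF.tr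
      | with_reducible apply GF.pair | with_reducible apply hTO | with_reducible apply hFO
      | with_reducible apply hta | with_reducible apply hpp
      | with_reducible apply DefS.and | with_reducible apply DefS.or
      | with_reducible apply DefS.exists | with_reducible apply DefS.eqg
  · unfold Thm1
    repeat' first
      | exact GF.var _ | exact GF.const _ | with_reducible apply GF.pair
      | with_reducible apply DefS.or | with_reducible apply DefS.eqg

theorem sub0_env (t : ATerm) : (Op.sub 0 t).env = subst0Env t := by
  funext n
  cases n <;> simp [Op.env, subst0Env]

theorem FO_sub0 (t : ATerm) (f g : ℕ) : FO (tr (Nat.pair 1 (Nat.pair 0 t.code)) f g) ↔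
    ∃ φ : AFml, f = φ.code ∧ g = (φ.subst0 t).code := by
  have := FO_iff (.sub 0 t) f g
  rwa [sub0_env] at this

theorem FO_lift0 (f g : ℕ) : FO (tr (Nat.pair 0 0) f g) ↔
    ∃ φ : AFml, f = φ.code ∧ g = (φ.lift 0).code := by
  have := FO_iff (.lift 0) f g
  simp only [Op.env, ← AFml.lift_eq] at this
  exact this

theorem Thm_iff {Tax : Set AFml} {p : ℕ → Bool} (hp : ∀ φ : AFml, φ ∈ Tax ↔ p φ.code = true)
    (x : ℕ) : Thm p x ↔ ∃ φ : AFml, x = φ.code ∧ Proves Tax φ := by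
  constructor
  · intro h
    induction h with
    | base h =>
      rcases h with ⟨h1, h2⟩ | ⟨h1, h2⟩ | ⟨f, t, g, h1, h2, h3⟩ | ⟨f, g, h1, h2, h3⟩ |
        ⟨f, g, h1, h2⟩ | ⟨f, h1, h2⟩ | ⟨t, h1, h2⟩ | ⟨f, t, s, g, h, h1, h2, h3, h4, h5⟩
      · obtain ⟨φ, rfl⟩ := (isFml_iff _).1 h2
        exact ⟨φ, rfl, .ax ((hp φ).2 h1)⟩
      · obtain ⟨φ, rfl⟩ := (isFml_iff _).1 h1
        exact ⟨φ, rfl, .taut ((tautCode_iff φ).1 h2)⟩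
      · obtain ⟨t, rfl⟩ := (isTm_iff _).1 h1
        obtain ⟨φ, rfl, rfl⟩ := (FO_sub0 _ _ _).1 h2
        rcases h3 with rfl | rfl
        · exact ⟨_, rfl, .allE φ t⟩
        · exact ⟨_, rfl, .exI φ t⟩
      · obtain ⟨φ, rfl⟩ := (isFml_iff _).1 h1
        obtain ⟨ψ, rfl⟩ := (isFml_iff _).1 h2
        refine ⟨_, ?_, .allImp φ ψ⟩; exact h3
      · obtain ⟨φ, rfl, rfl⟩ := (FO_lift0 _ _).1 h1
        refine ⟨_, ?_, .vacAll φ⟩; exact h2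
      · obtain ⟨φ, rfl⟩ := (isFml_iff _).1 h1
        refine ⟨_, ?_, .exDef φ⟩; exact h2
      · obtain ⟨t, rfl⟩ := (isTm_iff _).1 h1
        refine ⟨_, ?_, .eqRefl t⟩; exact h2
      · obtain ⟨t, rfl⟩ := (isTm_iff _).1 h1
        obtain ⟨s, rfl⟩ := (isTm_iff _).1 h2
        obtain ⟨φ, rfl, rfl⟩ := (FO_sub0 _ _ _).1 h3
        obtain ⟨ψ, h6, rfl⟩ := (FO_sub0 _ _ _).1 h4
        obtain rfl := AFml.code_inj h6
        refine ⟨_, ?_, .eqSubst φ t s⟩; exact h5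
    | step _ _ hR iha ihb =>
      obtain ⟨φ, rfl, h1⟩ := iha
      obtain ⟨ψ, rfl, h2⟩ := ihb
      rcases hR with h | rfl
      · cases φ <;> simp [AFml.code] at h
        obtain ⟨h, rfl⟩ := h
        obtain rfl := AFml.code_inj h
        exact ⟨_, rfl, h1.mp h2⟩
      · exact ⟨_, rfl, h1.gen⟩
  · rintro ⟨φ, rfl, h⟩
    induction h with
    | @ax φ h => exact .base (.inl ⟨(hp _).1 h, (isFml_iff _).2 ⟨φ, rfl⟩⟩)
    | @taut φ h => exact .base (.inr (.inl ⟨(isFml_iff _).2 ⟨φ, rfl⟩, (tautCode_iff φ).2 h⟩))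
    | mp _ _ ih ih' => exact .step ih ih' (.inl rfl)
    | allE φ t => exact .base (.inr (.inr (.inl ⟨_, _, _, (isTm_iff _).2 ⟨t, rfl⟩,
        (FO_sub0 t _ _).2 ⟨φ, rfl, rfl⟩, .inl rfl⟩)))
    | exI φ t => exact .base (.inr (.inr (.inl ⟨_, _, _, (isTm_iff _).2 ⟨t, rfl⟩,
        (FO_sub0 t _ _).2 ⟨φ, rfl, rfl⟩, .inr rfl⟩)))
    | allImp φ ψ => exact .base (.inr (.inr (.inr (.inl ⟨_, _, (isFml_iff _).2 ⟨φ, rfl⟩,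
        (isFml_iff _).2 ⟨ψ, rfl⟩, rfl⟩))))
    | vacAll φ => exact .base (.inr (.inr (.inr (.inr (.inl ⟨_, _,
        (FO_lift0 _ _).2 ⟨φ, rfl, rfl⟩, rfl⟩)))))
    | exDef φ => exact .base (.inr (.inr (.inr (.inr (.inr (.inl ⟨_,
        (isFml_iff _).2 ⟨φ, rfl⟩, rfl⟩))))))
    | gen _ ih => exact .step ih ih (.inr rfl)
    | eqRefl t => exact .base (.inr (.inr (.inr (.inr (.inr (.inr (.inl ⟨_,
        (isTm_iff _).2 ⟨t, rfl⟩, rfl⟩)))))))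
    | eqSubst φ t s => exact .base (.inr (.inr (.inr (.inr (.inr (.inr (.inr
        ⟨_, _, _, _, _, (isTm_iff _).2 ⟨t, rfl⟩, (isTm_iff _).2 ⟨s, rfl⟩,
        (FO_sub0 t _ _).2 ⟨φ, rfl, rfl⟩, (FO_sub0 s _ _).2 ⟨φ, rfl, rfl⟩, rfl⟩)))))))

/-- A decidable proof relation for `Tax`. -/
structure PrfRel (Tax : Set AFml) (Prf : ℕ → ℕ → Prop) : Prop where
  dec : DecS fun ρ => Prf (ρ 0) (ρ 1)
  le : ∀ {s y}, Prf s y → y ≤ s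
  sound : ∀ {s y}, Prf s y → ∃ φ : AFml, y = φ.code ∧ Proves Tax φ
  complete : ∀ {φ : AFml}, Proves Tax φ → ∀ N, ∃ s, N ≤ s ∧ Prf s φ.code

theorem exists_prfRel {Tax : Set AFml} (hpr : PrAxiomatized Tax) : ∃ Prf, PrfRel Tax Prf := by
  obtain ⟨p, hp, hTax⟩ := hpr
  obtain ⟨θ, h0, h⟩ := Thm.defS hp
  let σ : ℕ → ATerm := fun n => if n = 0 then .var 0 else .var 1
  have hθ : DecS fun ρ => (fun z y => θ.Sat (fun n => if n = 0 then z else y)) (ρ 0) (ρ 1) := by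
    refine (DecS.delta0 (h0.substAll σ)).of_iff fun ρ => ?_
    rw [sat_subst]
    refine iff_of_eq (congrArg (fun e => AFml.Sat e θ) ?_)
    funext n
    simp only [σ]
    split_ifs <;> rfl
  have e : ∀ z y : ℕ, (fun n => if n = 0 then z else y) = scons z fun _ => y := by
    intro z y; funext n; cases n <;> rfl
  refine ⟨fun s y => s.unpair.1 = y ∧ θ.Sat (fun n => if n = 0 then s.unpair.2.unpair.1 else y),
    ?_, ?_, ?_, ?_⟩
  · apply DecS.and
    · exact DecS.eq (GF.unpair1 (GF.var 0)) (GF.var 1)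
    · exact DecS.comp2 (R := fun z y => θ.Sat (fun n => if n = 0 then z else y)) hθ
        (f := fun ρ => (ρ 0).unpair.2.unpair.1) (GF.unpair1 (GF.unpair2 (GF.var 0))) (GF.var 1)
  · rintro s y ⟨rfl, _⟩; exact Nat.unpair_left_le s
  · rintro s y ⟨_, h'⟩
    rw [e] at h'
    exact (Thm_iff hTax y).1 ((h fun _ => y).2 ⟨_, h'⟩)
  · intro φ hφ N
    obtain ⟨z, hz⟩ := (h fun _ => φ.code).1 ((Thm_iff hTax _).2 ⟨φ, rfl, hφ⟩)
    refine ⟨Nat.pair φ.code (Nat.pair z N), (le_tag2 _ _ _), ?_, ?_⟩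
    · simp
    · rw [e]; simpa using hz

/-- The code of the numeral of `u`. -/
def numcode : ℕ → ℕ
  | 0 => Nat.pair 1 0
  | u + 1 => Nat.pair 2 (numcode u)

theorem numcode_eq (u : ℕ) : numcode u = (numeral u).code := by
  induction u with
  | zero => rfl
  | succ u ih => simp [numcode, numeral, ATerm.code, ih]

theorem numcode_gt (u : ℕ) : u < numcode u := by
  induction u with
  | zero => decide
  | succ u ih =>
    have := Nat.right_le_pair 2 (numcode u)
    have h2 := Nat.add_le_pair 2 (numcode u)
    simp only [numcode]
    omega

theorem numcode_inj {u v : ℕ} (h : numcode u = numcode v) : u = v := by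
  induction u generalizing v with
  | zero => cases v with
    | zero => rfl
    | succ v => simp [numcode] at h
  | succ u ih => cases v with
    | zero => simp [numcode] at h
    | succ v => simp [numcode] at h; rw [ih h]

theorem numcode_primrec : Primrec numcode := by
  have h : Primrec fun u : ℕ => Nat.rec (motive := fun _ => ℕ) (Nat.pair 1 0)
      (fun _ r => Nat.pair 2 r) u :=
    Primrec.nat_rec₁ (Nat.pair 1 0)
      (Primrec₂.natPair.comp (Primrec.const 2) Primrec.snd)
  refine h.of_eq fun u => ?_
  induction u with
  | zero => rfl
  | succ u ih => simp only [numcode, ← ih]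

theorem GF.numcode {f : (ℕ → ℕ) → ℕ} (hf : GF f) : GF fun ρ => numcode (f ρ) :=
  GF.of1 numcode_primrec hf

/-- The code of `P(ū)` where `P` is built from the formula with code `c`. -/
def Psub (c u : ℕ) : ℕ :=
  Nat.pair 7 (Nat.pair 3 (Nat.pair (Nat.pair 0 (Nat.pair (Nat.pair 0 0) (numcode u)))
    (Nat.pair 7 (Nat.pair 3 (Nat.pair (Nat.pair 0 (Nat.pair (Nat.pair 0 0) (numcode c))) c)))))

theorem GF.Psub {f g : (ℕ → ℕ) → ℕ} (hf : GF f) (hg : GF g) :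
    GF fun ρ => Psub (f ρ) (g ρ) := by
  unfold PLN.Psub
  repeat' first
    | exact GF.const _ | with_reducible apply GF.pair | with_reducible apply GF.numcode
    | assumption

theorem Psub_inj {c u v : ℕ} (h : Psub c u = Psub c v) : u = v := by
  simp [Psub] at h
  exact numcode_inj h

theorem Psub_gt (c u : ℕ) : u < Psub c u := by
  have h1 := numcode_gt u
  have h2 := le_tag2 0 (Nat.pair 0 0) (numcode u)
  have h3 := le_tag1 3 (Nat.pair 0 (Nat.pair (Nat.pair 0 0) (numcode u)))
    (Nat.pair 7 (Nat.pair 3 (Nat.pair (Nat.pair 0 (Nat.pair (Nat.pair 0 0) (numcode c))) c)))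
  have h4 := Nat.right_le_pair 7 (Nat.pair 3 (Nat.pair (Nat.pair 0 (Nat.pair (Nat.pair 0 0)
    (numcode u))) (Nat.pair 7 (Nat.pair 3 (Nat.pair (Nat.pair 0 (Nat.pair (Nat.pair 0 0)
    (numcode c))) c)))))
  unfold Psub
  omega

theorem Psub_tag (c u : ℕ) : (Psub c u).unpair.1 = 7 := by simp [Psub]

def junk (u : ℕ) : Prop := u.unpair.1 = 8

theorem not_junk_Psub (c u : ℕ) : ¬ junk (Psub c u) := by simp [junk, Psub_tag]

theorem not_junk_code (φ : AFml) : ¬ junk φ.code := by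
  cases φ <;> simp [junk, AFml.code]

def It (c j y : ℕ) : ℕ := (Psub c)^[j] y

theorem It_zero (c y : ℕ) : It c 0 y = y := rfl
theorem It_succ (c j y : ℕ) : It c (j + 1) y = Psub c (It c j y) :=
  Function.iterate_succ_apply' _ _ _

theorem le_It (c j y : ℕ) : y + j ≤ It c j y := by
  induction j with
  | zero => simp [It_zero]
  | succ j ih => rw [It_succ]; have := Psub_gt c (It c j y); omega

def Fst (p : ℕ) : ℕ := Nat.pair p.unpair.1 (Psub p.unpair.1 p.unpair.2)

theorem Psub_primrec : Primrec₂ Psub := by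
  unfold Psub
  have P := @Primrec₂.natPair
  have cst : ∀ k : ℕ, Primrec fun _ : ℕ × ℕ => k := fun k => Primrec.const k
  exact (P.comp (cst 7) (P.comp (cst 3) (P.comp (P.comp (cst 0) (P.comp (cst _)
    (numcode_primrec.comp Primrec.snd))) (P.comp (cst 7) (P.comp (cst 3) (P.comp (P.comp (cst 0)
    (P.comp (cst _) (numcode_primrec.comp Primrec.fst))) Primrec.fst))))))

theorem Fst_primrec : Primrec Fst := by
  have h1 : Primrec fun p : ℕ => p.unpair.1 := Primrec.fst.comp Primrec.unpair
  have h2 : Primrec fun p : ℕ => p.unpair.2 := Primrec.snd.comp Primrec.unpair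
  exact Primrec₂.natPair.comp h1 (Psub_primrec.comp h1 h2)

theorem It_eq (c j y : ℕ) : It c j y = (Fst^[j] (Nat.pair c y)).unpair.2 := by
  have : Fst^[j] (Nat.pair c y) = Nat.pair c (It c j y) := by
    induction j with
    | zero => rfl
    | succ j ih => rw [Function.iterate_succ_apply', ih, It_succ]; simp [Fst]
  rw [this]; simp

theorem GF.It {f g h : (ℕ → ℕ) → ℕ} (hf : GF f) (hg : GF g) (hh : GF h) :
    GF fun ρ => It (f ρ) (g ρ) (h ρ) := by
  have hp : Primrec₂ fun (p j : ℕ) => Fst^[j] p :=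
    Primrec.nat_iterate Primrec.snd Primrec.fst (Fst_primrec.comp Primrec.snd)
  have := GF.unpair2 (GF.of2 hp (hf.pair hh) hg)
  simpa only [It_eq] using this

def rootC (c y : ℕ) : Prop := ∀ u ≤ y, (¬ y = Psub c u) ∨ junk u

/-- `x` is the `j`-th iterate of the root `y`. -/
def Dec (c x y j : ℕ) : Prop := rootC c y ∧ x = It c j y ∧ ((¬ junk y) ∨ j = 0)

theorem rootC_iff (c y : ℕ) : rootC c y ↔ ∀ u, y = Psub c u → junk u := by
  constructor
  · intro h u hu
    refine (h u ?_).resolve_left (not_not.2 hu)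
    have := Psub_gt c u; omega
  · intro h u _
    exact imp_iff_not_or.1 (h u)

theorem Dec.le {c x y j : ℕ} (h : Dec c x y j) : y ≤ x ∧ j ≤ x := by
  have := le_It c j y
  obtain ⟨_, rfl, _⟩ := h
  omega

theorem Dec.exists (c x : ℕ) : ∃ y j, Dec c x y j := by
  induction x using Nat.strong_induction_on with
  | _ x ih =>
    by_cases h : rootC c x
    · exact ⟨x, 0, h, rfl, .inr rfl⟩
    · rw [rootC_iff] at h
      push Not at h
      obtain ⟨u, rfl, hu⟩ := h
      obtain ⟨y, j, h1, h2, h3⟩ := ih u (Psub_gt c u)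
      refine ⟨y, j + 1, h1, by rw [It_succ, ← h2], .inl ?_⟩
      rcases h3 with h3 | h3
      · exact h3
      · subst h3; rw [h2] at hu; exact hu

theorem Dec.succ {c x y j : ℕ} (h : Dec c x y j) (hx : ¬ junk x) : Dec c (Psub c x) y (j + 1) := by
  obtain ⟨h1, h2, h3⟩ := h
  refine ⟨h1, by rw [It_succ, ← h2], .inl ?_⟩
  rcases h3 with h3 | h3
  · exact h3
  · subst h3; rw [h2] at hx; exact hx

theorem Dec.pred {c x y j : ℕ} (h : Dec c x y (j + 1)) :
    ∃ u, x = Psub c u ∧ ¬ junk u ∧ Dec c u y j := by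
  obtain ⟨h1, h2, h3⟩ := h
  have h4 : ¬ junk y := h3.resolve_right (by omega)
  refine ⟨It c j y, by rw [h2, It_succ], ?_, h1, rfl, .inl h4⟩
  cases j with
  | zero => exact h4
  | succ j => rw [It_succ]; exact not_junk_Psub _ _

theorem Dec.unique {c x y j y' j' : ℕ} (h : Dec c x y j) (h' : Dec c x y' j') :
    y = y' ∧ j = j' := by
  induction j generalizing x j' with
  | zero =>
    obtain ⟨h1, rfl, _⟩ := h
    cases j' with
    | zero => obtain ⟨_, h2, _⟩ := h'; exact ⟨h2, rfl⟩
    | succ j' =>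
      obtain ⟨u, h2, h3, _⟩ := h'.pred
      exact absurd ((rootC_iff _ _).1 h1 u h2) h3
  | succ j ih =>
    cases j' with
    | zero =>
      obtain ⟨u, h2, h3, _⟩ := h.pred
      obtain ⟨h1, rfl, _⟩ := h'
      exact absurd ((rootC_iff _ _).1 h1 u h2) h3
    | succ j' =>
      obtain ⟨u, h2, _, h4⟩ := h.pred
      obtain ⟨v, h5, _, h6⟩ := h'.pred
      have : u = v := Psub_inj (h2.symm.trans h5)
      subst this
      have := ih h4 h6
      omega

theorem Dec.decS {f g h k : (ℕ → ℕ) → ℕ} (hf : GF f) (hg : GF g) (hh : GF h) (hk : GF k) :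
    DecS fun ρ => Dec (f ρ) (g ρ) (h ρ) (k ρ) := by
  have : DecS fun ρ => Dec (ρ 0) (ρ 1) (ρ 2) (ρ 3) := by
    unfold Dec rootC junk
    repeat' first
      | exact GF.var _ | exact GF.const _ | with_reducible apply GF.unpair1
      | with_reducible apply GF.Psub | with_reducible apply GF.It
      | with_reducible apply DecS.eq | with_reducible apply DecS.and
      | with_reducible apply DecS.or | with_reducible apply DecS.not
      | with_reducible apply DecS.ball
  exact DecS.comp4 this hf hg hh hk

/-- The class of an exponent. -/
def cl (m n i : ℕ) : ℕ :=
  if i < min m n - 1 then i else min m n - 1 + (i - (min m n - 1)) % ((m - n) + (n - m))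

theorem cl_le (m n i : ℕ) : cl m n i ≤ i := by
  unfold cl
  split_ifs with h
  · exact le_rfl
  · have := Nat.mod_le (i - (min m n - 1)) ((m - n) + (n - m))
    omega

theorem cl_shift {m n : ℕ} (hm : 1 ≤ m) (hn : 1 ≤ n) (j : ℕ) :
    cl m n (n - 1 + j) = cl m n (m - 1 + j) := by
  unfold cl
  rw [if_neg (by omega), if_neg (by omega)]
  congr 1
  rcases Nat.le_total m n with h | h
  · have h1 : min m n = m := min_eq_left h
    rw [h1]
    have e : n - 1 + j - (m - 1) = j + ((m - n) + (n - m)) := by omega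
    have e' : m - 1 + j - (m - 1) = j := by omega
    rw [e, e', Nat.add_mod_right]
  · have h1 : min m n = n := min_eq_right h
    rw [h1]
    have e : m - 1 + j - (n - 1) = j + ((m - n) + (n - m)) := by omega
    have e' : n - 1 + j - (n - 1) = j := by omega
    rw [e, e', Nat.add_mod_right]

/-- The order of accessibility of exponents. -/
def LeS (m n i j : ℕ) : Prop := if m < n then j ≤ i else i ≤ j

theorem LeS.refl (m n i : ℕ) : LeS m n i i := by unfold LeS; split_ifs <;> exact le_rfl

theorem LeS.shift {m n : ℕ} (j : ℕ) : LeS m n (n - 1 + j) (m - 1 + j) := by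
  unfold LeS; split_ifs <;> omega

/-- Two exponents in the same class, in the right order, are equal or are connected by
finitely many steps. -/
theorem cl_steps {m n i j : ℕ} (hmn : m ≠ n) (hm : 1 ≤ m) (hn : 1 ≤ n)
    (hc : cl m n i = cl m n j) (hl : LeS m n i j) {Q : ℕ → ℕ → Prop} (h0 : ∀ i, Q i i)
    (ht : ∀ i j k, Q i j → Q j k → Q i k) (hs : ∀ a, Q (n - 1 + a) (m - 1 + a)) : Q i j := by
  unfold cl at hc
  have hd : 0 < (m - n) + (n - m) := by omega
  set d := (m - n) + (n - m) with hd'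
  set a0 := min m n - 1 with ha0
  by_cases h1 : i < a0
  · rw [if_pos h1] at hc
    split_ifs at hc with h2
    · subst hc; exact h0 i
    · omega
  · rw [if_neg h1] at hc
    split_ifs at hc with h2
    · omega
    · obtain ⟨i, rfl⟩ : ∃ i', i = a0 + i' := ⟨i - a0, by omega⟩
      obtain ⟨j, rfl⟩ : ∃ j', j = a0 + j' := ⟨j - a0, by omega⟩
      have hc' : i % d = j % d := by simpa using hc
      unfold LeS at hl
      split_ifs at hl with hlt
      · have hji : j ≤ i := by omega
        obtain ⟨k, hk⟩ := (Nat.modEq_iff_dvd' hji).1 hc'.symm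
        obtain rfl : i = j + d * k := by omega
        have hq : ∀ a, Q (a0 + a + d) (a0 + a) := by
          intro a
          have := hs a
          rwa [show n - 1 + a = a0 + a + d by omega, show m - 1 + a = a0 + a by omega] at this
        clear hk hc hc' hji hl h1
        induction k with
        | zero => exact h0 _
        | succ k ih =>
          refine ht _ _ _ ?_ ih
          have := hq (j + d * k)
          rwa [show a0 + (j + d * k) + d = a0 + (j + d * (k + 1)) by ring] at this
      · have hji : i ≤ j := by omega
        obtain ⟨k, hk⟩ := (Nat.modEq_iff_dvd' hji).1 hc'
        obtain rfl : j = i + d * k := by omega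
        have hq : ∀ a, Q (a0 + a) (a0 + a + d) := by
          intro a
          have := hs a
          rwa [show m - 1 + a = a0 + a + d by omega, show n - 1 + a = a0 + a by omega] at this
        clear hk hc hc' hji hl h1 h2
        induction k with
        | zero => exact h0 _
        | succ k ih =>
          refine ht _ _ _ ih ?_
          have := hq (i + d * k)
          rwa [show a0 + (i + d * k) + d = a0 + (i + d * (k + 1)) by ring] at this

theorem decS_cl {m n : ℕ} {f g : (ℕ → ℕ) → ℕ} (hf : GF f) (hg : GF g) :
    DecS fun ρ => cl m n (f ρ) = g ρ := by
  have : DecS fun ρ => ((f ρ < min m n - 1 ∧ f ρ = g ρ) ∨ ((¬ f ρ < min m n - 1) ∧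
      min m n - 1 + (f ρ - (min m n - 1)) % ((m - n) + (n - m)) = g ρ)) := by
    repeat' first
      | assumption
      | exact GF.const _ | with_reducible apply GF.add | with_reducible apply GF.mod
      | with_reducible apply GF.sub | with_reducible apply DecS.lt
      | with_reducible apply DecS.eq | with_reducible apply DecS.and
      | with_reducible apply DecS.or | with_reducible apply DecS.not
  refine this.of_iff fun ρ => ?_
  unfold cl
  split_ifs with h <;> simp [h]

theorem decS_LeS {m n : ℕ} {f g : (ℕ → ℕ) → ℕ} (hf : GF f) (hg : GF g) :
    DecS fun ρ => LeS m n (f ρ) (g ρ) := by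
  unfold LeS
  split_ifs
  · exact DecS.le hg hf
  · exact DecS.le hf hg

/-- Closure of `k` under the accessibility steps. -/
def VA (m n c w k : ℕ) : Prop := ∀ x ≤ w, ∀ x' ≤ w, ∀ y ≤ w, ∀ i ≤ w, ∀ j ≤ w,
  (¬ Dec c x y i) ∨ (¬ Dec c x' y j) ∨ (¬ cl m n i = cl m n j) ∨ (¬ LeS m n i j) ∨
    (¬ bit k x) ∨ bit k x'

/-- `k` contains no boxed sentence refuted before stage `w`. -/
def VB (Prf : ℕ → ℕ → Prop) (c w k : ℕ) : Prop := ∀ s ≤ w, ∀ z ≤ w, ∀ y ≤ w, ∀ j ≤ w,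
  (¬ s < w) ∨ (¬ Dec c z y j) ∨ (¬ 1 ≤ j) ∨ (¬ Prf s (Nat.pair 2 z)) ∨ ¬ bit k z

/-- `k` contains all iterates of sentences proved before stage `w`. -/
def VC (Prf : ℕ → ℕ → Prop) (c w k : ℕ) : Prop := ∀ s ≤ w, ∀ x ≤ w, ∀ y ≤ w, ∀ j ≤ w,
  (¬ s < w) ∨ (¬ Dec c x y j) ∨ (¬ Prf s y) ∨ bit k x

/-- The truth assignment `K` is correct for atoms. -/
def VD (c w k K I : ℕ) : Prop := ∀ x ≤ w, (¬ bit I x) ∨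
  (x = botFml.code ∧ ¬ bit K x) ∨
  (∃ a ≤ w, x = Nat.pair 2 a) ∨
  (∃ a ≤ w, ∃ b ≤ w, x = Nat.pair 3 (Nat.pair a b) ∨ x = Nat.pair 4 (Nat.pair a b) ∨
    x = Nat.pair 5 (Nat.pair a b)) ∨
  (∃ u ≤ w, x = Psub c u ∧ (bit K x ↔ bit k u))

/-- Some sentence proved at stage `w` is refuted by `K`. -/
def VE (Prf : ℕ → ℕ → Prop) (w K I : ℕ) : Prop :=
  ∃ x ≤ w, Prf w x ∧ bit I x ∧ ¬ bit K x

def VW (m n : ℕ) (Prf : ℕ → ℕ → Prop) (c w k : ℕ) : Prop :=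
  ∃ K ≤ 2 ^ (w + 1), ∃ I ≤ 2 ^ (w + 1),
    VA m n c w k ∧ VB Prf c w k ∧ VC Prf c w k ∧ VD c w k K I ∧ LocC K I w ∧ VE Prf w K I

/-- The bell rings at stage `w`. -/
def Bell (m n : ℕ) (Prf : ℕ → ℕ → Prop) (c w : ℕ) : Prop := ∃ k ≤ 2 ^ (w + 1), VW m n Prf c w k

/-- `k` is the least good set at stage `w`. -/
def LV (m n : ℕ) (Prf : ℕ → ℕ → Prop) (c w k : ℕ) : Prop :=
  VW m n Prf c w k ∧ ∀ k' ≤ k, (¬ k' < k) ∨ ¬ VW m n Prf c w k'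

def RelD (m n : ℕ) (c x i y q : ℕ) : Prop := Dec c x y i ∧ cl m n i = q
def RelN (m n : ℕ) (Prf : ℕ → ℕ → Prop) (c s _a _b _d : ℕ) : Prop := ¬ Bell m n Prf c s
def RelP (m n : ℕ) (Prf : ℕ → ℕ → Prop) (c s y _a _b : ℕ) : Prop :=
  (¬ Bell m n Prf c s) ∧ Prf s y
def RelX (m n : ℕ) (Prf : ℕ → ℕ → Prop) (c s y q j : ℕ) : Prop :=
  ∃ k ≤ 2 ^ (s + 1), LV m n Prf c s k ∧
    ∀ x ≤ s, (¬ Dec c x y j) ∨ (¬ cl m n j = q) ∨ bit k x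
def RelV (m n : ℕ) (Prf : ℕ → ℕ → Prop) (c s y q j : ℕ) : Prop :=
  ¬ ∃ z ≤ s, Dec c z y j ∧ cl m n j = q ∧ 1 ≤ j ∧ Prf s (Nat.pair 2 z)

section
variable {m n : ℕ} {Prf : ℕ → ℕ → Prop}

theorem decS_clcl {f g : (ℕ → ℕ) → ℕ} (hf : GF f) (hg : GF g) :
    DecS fun ρ => cl m n (f ρ) = cl m n (g ρ) := by
  have h1 : GF fun ρ => cl m n (g ρ) := (decS_cl (GF.shift hg) (GF.var 0)).1
  exact decS_cl hf h1

theorem VA.decS {f g h : (ℕ → ℕ) → ℕ} (hf : GF f) (hg : GF g) (hh : GF h) :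
    DecS fun ρ => VA m n (f ρ) (g ρ) (h ρ) := by
  refine DecS.comp3 (R := fun a b c => VA m n a b c) ?_ hf hg hh
  unfold VA
  repeat' first
    | exact GF.var _ | with_reducible apply DecS.or | with_reducible apply DecS.not
    | with_reducible apply Dec.decS | with_reducible apply decS_clcl
    | with_reducible apply decS_LeS | with_reducible apply decS_bit
    | with_reducible apply DecS.ball

theorem VB.decS (hP : DecS fun ρ => Prf (ρ 0) (ρ 1))
    {f g h : (ℕ → ℕ) → ℕ} (hf : GF f) (hg : GF g) (hh : GF h) :
    DecS fun ρ => VB Prf (f ρ) (g ρ) (h ρ) := by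
  refine DecS.comp3 (R := fun a b c => VB Prf a b c) ?_ hf hg hh
  have hP' : ∀ {f g}, GF f → GF g → DecS fun ρ => Prf (f ρ) (g ρ) :=
    fun hf hg => DecS.comp2 hP hf hg
  unfold VB
  repeat' first
    | exact GF.var _ | exact GF.const _ | with_reducible apply GF.pair
    | with_reducible apply DecS.or | with_reducible apply DecS.not
    | with_reducible apply Dec.decS | with_reducible apply DecS.lt | with_reducible apply DecS.le
    | with_reducible apply hP' | with_reducible apply decS_bit
    | with_reducible apply DecS.ball

theorem VC.decS (hP : DecS fun ρ => Prf (ρ 0) (ρ 1))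
    {f g h : (ℕ → ℕ) → ℕ} (hf : GF f) (hg : GF g) (hh : GF h) :
    DecS fun ρ => VC Prf (f ρ) (g ρ) (h ρ) := by
  refine DecS.comp3 (R := fun a b c => VC Prf a b c) ?_ hf hg hh
  have hP' : ∀ {f g}, GF f → GF g → DecS fun ρ => Prf (f ρ) (g ρ) :=
    fun hf hg => DecS.comp2 hP hf hg
  unfold VC
  repeat' first
    | exact GF.var _ | exact GF.const _ | with_reducible apply GF.pair
    | with_reducible apply DecS.or | with_reducible apply DecS.not
    | with_reducible apply Dec.decS | with_reducible apply DecS.lt | with_reducible apply DecS.le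
    | with_reducible apply hP' | with_reducible apply decS_bit
    | with_reducible apply DecS.ball

theorem VD.decS {f g h p r : (ℕ → ℕ) → ℕ} (hf : GF f) (hg : GF g) (hh : GF h) (hp : GF p)
    (hr : GF r) : DecS fun ρ => VD (f ρ) (g ρ) (h ρ) (p ρ) (r ρ) := by
  refine DecS.comp5 (R := fun a b c d e => VD a b c d e) ?_ hf hg hh hp hr
  unfold VD
  repeat' first
    | exact GF.var _ | exact GF.const _ | with_reducible apply GF.pair
    | with_reducible apply GF.Psub
    | with_reducible apply DecS.or | with_reducible apply DecS.not | with_reducible apply DecS.and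
    | with_reducible apply DecS.iff | with_reducible apply DecS.eq
    | with_reducible apply decS_bit
    | with_reducible apply DecS.ball | with_reducible apply DecS.bex

theorem VE.decS (hP : DecS fun ρ => Prf (ρ 0) (ρ 1))
    {f g h : (ℕ → ℕ) → ℕ} (hf : GF f) (hg : GF g) (hh : GF h) :
    DecS fun ρ => VE Prf (f ρ) (g ρ) (h ρ) := by
  refine DecS.comp3 (R := fun a b c => VE Prf a b c) ?_ hf hg hh
  have hP' : ∀ {f g}, GF f → GF g → DecS fun ρ => Prf (f ρ) (g ρ) :=
    fun hf hg => DecS.comp2 hP hf hg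
  unfold VE
  repeat' first
    | exact GF.var _ | with_reducible apply DecS.and | with_reducible apply DecS.not
    | with_reducible apply hP' | with_reducible apply decS_bit
    | with_reducible apply DecS.bex

theorem VW.decS (hP : DecS fun ρ => Prf (ρ 0) (ρ 1))
    {f g h : (ℕ → ℕ) → ℕ} (hf : GF f) (hg : GF g) (hh : GF h) :
    DecS fun ρ => VW m n Prf (f ρ) (g ρ) (h ρ) := by
  refine DecS.comp3 (R := fun a b c => VW m n Prf a b c) ?_ hf hg hh
  have hL : ∀ {f g h}, GF f → GF g → GF h → DecS fun ρ => LocC (f ρ) (g ρ) (h ρ) :=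
    fun hf hg hh => DecS.comp3 LocC.decS hf hg hh
  have hB : ∀ {f g h}, GF f → GF g → GF h → DecS fun ρ => VB Prf (f ρ) (g ρ) (h ρ) :=
    fun hf hg hh => VB.decS hP hf hg hh
  have hC : ∀ {f g h}, GF f → GF g → GF h → DecS fun ρ => VC Prf (f ρ) (g ρ) (h ρ) :=
    fun hf hg hh => VC.decS hP hf hg hh
  have hE : ∀ {f g h}, GF f → GF g → GF h → DecS fun ρ => VE Prf (f ρ) (g ρ) (h ρ) :=
    fun hf hg hh => VE.decS hP hf hg hh
  unfold VW
  repeat' first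
    | exact GF.var _ | exact GF.const _ | with_reducible apply GF.add
    | with_reducible apply GF.pow
    | with_reducible apply DecS.and | with_reducible apply VA.decS
    | with_reducible apply hL | with_reducible apply hB | with_reducible apply hC
    | with_reducible apply hE | with_reducible apply VD.decS
    | with_reducible apply DecS.bex

theorem Bell.decS (hP : DecS fun ρ => Prf (ρ 0) (ρ 1))
    {f g : (ℕ → ℕ) → ℕ} (hf : GF f) (hg : GF g) :
    DecS fun ρ => Bell m n Prf (f ρ) (g ρ) := by
  refine DecS.comp2 (R := fun a b => Bell m n Prf a b) ?_ hf hg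
  have hB : ∀ {f g h}, GF f → GF g → GF h → DecS fun ρ => VW m n Prf (f ρ) (g ρ) (h ρ) :=
    fun hf hg hh => VW.decS hP hf hg hh
  unfold Bell
  repeat' first
    | exact GF.var _ | exact GF.const _ | with_reducible apply GF.add
    | with_reducible apply GF.pow
    | with_reducible apply hB | with_reducible apply DecS.bex

theorem LV.decS (hP : DecS fun ρ => Prf (ρ 0) (ρ 1))
    {f g h : (ℕ → ℕ) → ℕ} (hf : GF f) (hg : GF g) (hh : GF h) :
    DecS fun ρ => LV m n Prf (f ρ) (g ρ) (h ρ) := by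
  refine DecS.comp3 (R := fun a b c => LV m n Prf a b c) ?_ hf hg hh
  have hB : ∀ {f g h}, GF f → GF g → GF h → DecS fun ρ => VW m n Prf (f ρ) (g ρ) (h ρ) :=
    fun hf hg hh => VW.decS hP hf hg hh
  unfold LV
  repeat' first
    | exact GF.var _ | with_reducible apply DecS.and | with_reducible apply DecS.or
    | with_reducible apply DecS.not | with_reducible apply DecS.lt
    | with_reducible apply hB | with_reducible apply DecS.ball

theorem RelD.decS : DecS fun ρ => RelD m n (ρ 0) (ρ 1) (ρ 2) (ρ 3) (ρ 4) := by
  unfold RelD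
  exact DecS.and (Dec.decS (GF.var _) (GF.var _) (GF.var _) (GF.var _)) (decS_cl (GF.var _) (GF.var _))

theorem RelN.decS (hP : DecS fun ρ => Prf (ρ 0) (ρ 1)) :
    DecS fun ρ => RelN m n Prf (ρ 0) (ρ 1) (ρ 2) (ρ 3) (ρ 4) := by
  unfold RelN
  exact DecS.not (Bell.decS hP (GF.var _) (GF.var _))

theorem RelP.decS (hP : DecS fun ρ => Prf (ρ 0) (ρ 1)) :
    DecS fun ρ => RelP m n Prf (ρ 0) (ρ 1) (ρ 2) (ρ 3) (ρ 4) := by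
  unfold RelP
  exact DecS.and (DecS.not (Bell.decS hP (GF.var _) (GF.var _)))
    (DecS.comp2 hP (GF.var _) (GF.var _))

theorem RelX.decS (hP : DecS fun ρ => Prf (ρ 0) (ρ 1)) :
    DecS fun ρ => RelX m n Prf (ρ 0) (ρ 1) (ρ 2) (ρ 3) (ρ 4) := by
  have hB : ∀ {f g h}, GF f → GF g → GF h → DecS fun ρ => LV m n Prf (f ρ) (g ρ) (h ρ) :=
    fun hf hg hh => LV.decS hP hf hg hh
  unfold RelX
  repeat' first
    | exact GF.var _ | exact GF.const _ | with_reducible apply GF.add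
    | with_reducible apply GF.pow
    | with_reducible apply DecS.and | with_reducible apply DecS.or
    | with_reducible apply DecS.not | with_reducible apply decS_cl
    | with_reducible apply Dec.decS | with_reducible apply decS_bit
    | with_reducible apply hB | with_reducible apply DecS.ball | with_reducible apply DecS.bex

theorem RelV.decS (hP : DecS fun ρ => Prf (ρ 0) (ρ 1)) :
    DecS fun ρ => RelV m n Prf (ρ 0) (ρ 1) (ρ 2) (ρ 3) (ρ 4) := by
  have hP' : ∀ {f g}, GF f → GF g → DecS fun ρ => Prf (f ρ) (g ρ) :=
    fun hf hg => DecS.comp2 hP hf hg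
  unfold RelV
  repeat' first
    | exact GF.var _ | exact GF.const _ | with_reducible apply GF.pair
    | with_reducible apply DecS.and
    | with_reducible apply DecS.not | with_reducible apply decS_cl
    | with_reducible apply DecS.le
    | with_reducible apply Dec.decS
    | with_reducible apply hP' | with_reducible apply DecS.bex

end

/-- The environment with six given values. -/
def e6 {α : Type} (d z a b c e f : α) : ℕ → α :=
  scons z (scons a (scons b (scons c (scons e (scons f fun _ => d)))))

def ap (θ : AFml) (z a b c e f : ATerm) : AFml := θ.substAll (e6 .zero z a b c e f)

/-- `θ` represents the five-place relation `R`. -/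
structure Rep (R : ℕ → ℕ → ℕ → ℕ → ℕ → Prop) (θ : AFml) : Prop where
  d0 : IsDelta0 θ
  fr : θ.FreeLt 6
  pos : ∀ {a b c e f}, R a b c e f → ∃ z, θ.Sat (e6 0 z a b c e f)
  neg : ∀ {a b c e f}, ∀ M : Mdl, M.Models PA → ∀ ζ : M.D,
    M.Sat (e6 M.zero ζ (M.num a) (M.num b) (M.num c) (M.num e) (M.num f)) θ → R a b c e f

theorem exists_rep {R : ℕ → ℕ → ℕ → ℕ → ℕ → Prop}
    (h : DecS fun ρ => R (ρ 0) (ρ 1) (ρ 2) (ρ 3) (ρ 4)) : ∃ θ, Rep R θ := by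
  obtain ⟨θ, h1, h2, h3, h4⟩ := rep h 5 (fun ρ => by simp)
  refine ⟨θ, h1, h2, ?_, ?_⟩
  · intro a b c e f hR
    exact (h3 (scons a (scons b (scons c (scons e (scons f fun _ => 0)))))).1 hR
  · intro a b c e f M hM ζ hs
    by_contra hR
    refine h4 (scons a (scons b (scons c (scons e (scons f fun _ => 0))))) hR M hM ζ ?_
    convert hs using 1
    funext n
    rcases n with _ | _ | _ | _ | _ | _ | n <;> rfl

theorem Mdl.sat_ap (M : Mdl) (θ : AFml) (z a b c e f : ATerm) (ρ : ℕ → M.D) :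
    M.Sat ρ (ap θ z a b c e f) ↔ M.Sat (e6 M.zero (M.val ρ z) (M.val ρ a) (M.val ρ b) (M.val ρ c)
      (M.val ρ e) (M.val ρ f)) θ := by
  unfold ap
  rw [M.sat_subst]
  have : (fun n => M.val ρ (e6 .zero z a b c e f n)) = e6 M.zero (M.val ρ z) (M.val ρ a)
      (M.val ρ b) (M.val ρ c) (M.val ρ e) (M.val ρ f) := by
    funext n
    rcases n with _ | _ | _ | _ | _ | _ | n <;> rfl
  rw [this]

theorem NMdl_models : NMdl.Models PA := by
  intro γ hγ ρ
  cases hγ with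
  | succNeZero => intro a; exact Nat.succ_ne_zero a
  | succInj => intro a b h; exact Nat.succ.inj h
  | addZero => intro a; exact Nat.add_zero a
  | addSucc => intro a b; exact Nat.add_succ a b
  | mulZero => intro a; exact Nat.mul_zero a
  | mulSucc => intro a b; exact Nat.mul_succ a b
  | leDef =>
    intro a b
    have key : ∀ a b : ℕ, (a ≤ b → ∃ z, z + a = b) ∧ ((∃ z, z + a = b) → a ≤ b) :=
      fun a b => ⟨fun h => ⟨b - a, Nat.sub_add_cancel h⟩, fun ⟨z, hz⟩ => by omega⟩
    exact key a b
  | ind φ =>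
    rintro ⟨h0, hs⟩ a
    rw [Mdl.sat_subst0] at h0
    induction (a : ℕ) with
    | zero => exact h0
    | succ k ih =>
      have := hs k ih
      rw [succSubst, Mdl.sat_subst] at this
      convert this using 1
      funext i
      cases i <;> rfl

theorem NMdl_num (k : ℕ) : NMdl.num k = k := by
  induction k with
  | zero => rfl
  | succ k ih => show Nat.succ (NMdl.num k) = _; rw [ih]

theorem numeral_lift (k c : ℕ) : (numeral k).lift c = numeral k := by
  induction k <;> simp_all [numeral, ATerm.lift]

theorem numeral_subst (k : ℕ) (σ) : (numeral k).substAll σ = numeral k := by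
  induction k <;> simp_all [numeral, ATerm.substAll]

theorem numeral_free (k c : ℕ) : (numeral k).FreeLt c := by
  induction k <;> simp_all [numeral, ATerm.FreeLt]

theorem Mdl.val_numeral (M : Mdl) (k : ℕ) (ρ) : M.val ρ (numeral k) = M.num k := by
  induction k with
  | zero => rfl
  | succ k ih => show M.succ _ = _; rw [ih]; rfl

/-- Formulas representing the five basic relations. -/
structure Cd (m n : ℕ) (Prf : ℕ → ℕ → Prop) where
  fD : AFml
  fN : AFml
  fP : AFml
  fX : AFml
  fV : AFml
  rD : Rep (RelD m n) fD
  rN : Rep (RelN m n Prf) fN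
  rP : Rep (RelP m n Prf) fP
  rX : Rep (RelX m n Prf) fX
  rV : Rep (RelV m n Prf) fV

theorem exists_Cd {m n : ℕ} {Prf : ℕ → ℕ → Prop} (hP : DecS fun ρ => Prf (ρ 0) (ρ 1)) :
    Nonempty (Cd m n Prf) := by
  obtain ⟨a, ha⟩ := exists_rep (RelD.decS (m := m) (n := n))
  obtain ⟨b, hb⟩ := exists_rep (RelN.decS (m := m) (n := n) hP)
  obtain ⟨c, hc⟩ := exists_rep (RelP.decS (m := m) (n := n) hP)
  obtain ⟨d, hd⟩ := exists_rep (RelX.decS (m := m) (n := n) hP)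
  obtain ⟨e, he⟩ := exists_rep (RelV.decS (m := m) (n := n) hP)
  exact ⟨⟨a, b, c, d, e, ha, hb, hc, hd, he⟩⟩

def LeSF (m n : ℕ) (t s : ATerm) : AFml := if m < n then .le s t else .le t s

def Mdl.LeM (M : Mdl) (m n : ℕ) (a b : M.D) : Prop := if m < n then M.le b a else M.le a b

theorem Mdl.sat_LeSF (M : Mdl) (m n : ℕ) (t s : ATerm) (ρ) :
    M.Sat ρ (LeSF m n t s) ↔ M.LeM m n (M.val ρ t) (M.val ρ s) := by
  unfold LeSF Mdl.LeM
  split_ifs <;> rfl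

section
variable {m n : ℕ} {Prf : ℕ → ℕ → Prop}

/-- The matrix of the provability predicate. -/
def Cd.matF (Θ : Cd m n Prf) : AFml :=
  .and (ap Θ.fD (.var 4) (.var 6) (.var 7) (.var 2) (.var 1) (.var 0))
  (.and (.le (.var 7) (.var 5))
  (.and (allB (.var 5) (.imp (.le (.succ (.var 0)) (.var 6))
      (exB (.var 4) (ap Θ.fN (.var 0) (.var 8) (.var 1) (.var 1) (.var 1) (.var 1)))))
  (.or (exB (.var 3) (ap Θ.fP (.var 0) (.var 7) (.var 6) (.var 2) (.var 2) (.var 2)))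
    (allB (.var 5) (.imp (LeSF m n (.var 3) (.var 0))
      (.and (exB (.var 4) (ap Θ.fX (.var 0) (.var 8) (.var 7) (.var 3) (.var 2) (.var 1)))
        (allB (.var 6) (.imp (.le (.succ (.var 0)) (.var 7))
          (exB (.var 5) (ap Θ.fV (.var 0) (.var 9) (.var 1) (.var 4) (.var 3) (.var 2)))))))))))

def Cd.coreF (Θ : Cd m n Prf) : AFml :=
  .ex (.ex (.ex (exB (.var 4) (exB (.var 5) (exB (.var 6) Θ.matF)))))

/-- The last part of the core condition in a model. -/
def Cd.Main (Θ : Cd m n Prf) (M : Mdl) (c s u i y q : M.D) : Prop :=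
  (∀ s', M.le s' s → M.le (M.succ s') s →
      ∃ z, M.le z u ∧ M.Sat (e6 M.zero z c s' s' s' s') Θ.fN) ∧
  ((∃ z, M.le z u ∧ M.Sat (e6 M.zero z c s y y y) Θ.fP) ∨
    (∀ j, M.le j s → M.LeM m n i j →
      (∃ z, M.le z u ∧ M.Sat (e6 M.zero z c s y q j) Θ.fX) ∧
      (∀ s', M.le s' s → M.le (M.succ s') s →
        ∃ z, M.le z u ∧ M.Sat (e6 M.zero z c s' y q j) Θ.fV)))

theorem Cd.sat_coreF (Θ : Cd m n Prf) (M : Mdl) (c x : M.D) (ρ) :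
    M.Sat (scons c (scons x ρ)) Θ.coreF ↔ ∃ s u0 u i, M.le i x ∧ ∃ y, M.le y x ∧ ∃ q, M.le q x ∧
      M.Sat (e6 M.zero u0 c x i y q) Θ.fD ∧ M.le x s ∧ Θ.Main M c s u i y q := by
  simp only [Cd.coreF, Cd.matF, Cd.Main, Mdl.Sat, Mdl.sat_exB, Mdl.sat_allB, Mdl.sat_ap,
    Mdl.sat_LeSF, Mdl.val, scons]

theorem Cd.coreF_free (Θ : Cd m n Prf) : Θ.coreF.FreeLt 2 := by
  have hap : ∀ {R : ℕ → ℕ → ℕ → ℕ → ℕ → Prop} {θ : AFml} (_ : Rep R θ) (k a b c d e f : ℕ), a < k →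
      b < k → c < k → d < k → e < k → f < k →
      (ap θ (.var a) (.var b) (.var c) (.var d) (.var e) (.var f)).FreeLt k := by
    intro R θ h k a b c d e f ha hb hc hd he hf
    refine AFml.FreeLt.substAll h.fr fun j hj => ?_
    rcases j with _ | _ | _ | _ | _ | _ | j
    · exact ha
    · exact hb
    · exact hc
    · exact hd
    · exact he
    · exact hf
    · omega
  have hL : ∀ k a b, a < k → b < k → (LeSF m n (.var a) (.var b)).FreeLt k := by
    intro k a b ha hb
    unfold LeSF
    split_ifs
    · exact ⟨hb, ha⟩
    · exact ⟨ha, hb⟩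
  simp only [Cd.coreF, Cd.matF, exB, allB, AFml.FreeLt, ATerm.FreeLt, ATerm.lift]
  simp [hap Θ.rD, hap Θ.rN, hap Θ.rP, hap Θ.rX, hap Θ.rV, hL]

theorem Cd.coreF_sigma (Θ : Cd m n Prf) : IsSigma1 Θ.coreF := by
  have hL : ∀ a b, IsDelta0 (LeSF m n a b) := by
    intro a b
    unfold LeSF
    split_ifs
    · exact .le _ _
    · exact .le _ _
  refine .ex (.ex (.ex (.delta0 (.bex _ (.bex _ (.bex _ ?_))))))
  exact .and (Θ.rD.d0.substAll _) (.and (.le _ _) (.and (.ball _ (.imp (.le _ _)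
    (.bex _ (Θ.rN.d0.substAll _)))) (.or (.bex _ (Θ.rP.d0.substAll _)) (.ball _ (.imp (hL _ _)
    (.and (.bex _ (Θ.rX.d0.substAll _)) (.ball _ (.imp (.le _ _)
      (.bex _ (Θ.rV.d0.substAll _))))))))))

/-- The code of the core formula. -/
def Cd.e (Θ : Cd m n Prf) : ℕ := Θ.coreF.code

/-- The provability predicate. -/
def Cd.P (Θ : Cd m n Prf) : AFml :=
  .ex (.and (.eq (.var 0) (.var 1)) (.ex (.and (.eq (.var 0) (numeral Θ.e)) Θ.coreF)))

theorem Cd.P_sigma (Θ : Cd m n Prf) : IsSigma1 Θ.P :=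
  .ex (.and (.delta0 (.eq _ _)) (.ex (.and (.delta0 (.eq _ _)) Θ.coreF_sigma)))

theorem Cd.P_free (Θ : Cd m n Prf) : Θ.P.FreeLt 1 := by
  simp only [Cd.P, AFml.FreeLt, ATerm.FreeLt, numeral_free]
  exact ⟨⟨by omega, by omega⟩, ⟨by omega, trivial⟩, Θ.coreF_free.mono (by omega)⟩

theorem Cd.P_code (Θ : Cd m n Prf) (u : ℕ) : (Θ.P.subst0 (numeral u)).code = Psub Θ.e u := by
  have h : Θ.coreF.substAll (liftSub (liftSub (subst0Env (numeral u)))) = Θ.coreF := by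
    rw [AFml.substAll_congr _ 2 Θ.coreF_free (τ := ATerm.var), AFml.substAll_var]
    intro j hj
    rcases j with _ | _ | j
    · rfl
    · rfl
    · omega
  have h1 : liftSub (subst0Env (numeral u)) 1 = numeral u := numeral_lift u 0
  simp only [AFml.subst0, Cd.P, AFml.substAll, h, AFml.code, ATerm.substAll, numeral_subst,
    ← numcode_eq, h1, Psub]
  rfl

attribute [irreducible] Cd.e

theorem Cd.appNum_code (Θ : Cd m n Prf) (φ : AFml) : (Θ.P.appNum φ).code = Psub Θ.e φ.code :=
  Θ.P_code φ.code

theorem Cd.P_inst_sigma (Θ : Cd m n Prf) (u : ℕ) : IsSigma1 (Θ.P.subst0 (numeral u)) := by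
  have h : Θ.coreF.substAll (liftSub (liftSub (subst0Env (numeral u)))) = Θ.coreF := by
    rw [AFml.substAll_congr _ 2 Θ.coreF_free (τ := ATerm.var), AFml.substAll_var]
    intro j hj
    rcases j with _ | _ | j
    · rfl
    · rfl
    · omega
  simp only [AFml.subst0, Cd.P, AFml.substAll, h]
  exact .ex (.and (.delta0 (.eq _ _)) (.ex (.and (.delta0 (.eq _ _)) Θ.coreF_sigma)))

theorem Cd.P_inst_free (Θ : Cd m n Prf) (u : ℕ) : (Θ.P.subst0 (numeral u)).FreeLt 0 := by
  refine AFml.FreeLt.substAll Θ.P_free fun j hj => ?_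
  obtain rfl : j = 0 := by omega
  exact numeral_free _ _

/-- `P(x)` holds in the model `M`. -/
def Cd.MP (Θ : Cd m n Prf) (M : Mdl) (x : ℕ) : Prop :=
  ∃ s u0 u i, M.le i (M.num x) ∧ ∃ y, M.le y (M.num x) ∧ ∃ q, M.le q (M.num x) ∧
      M.Sat (e6 M.zero u0 (M.num Θ.e) (M.num x) i y q) Θ.fD ∧ M.le (M.num x) s ∧
      Θ.Main M (M.num Θ.e) s u i y q

theorem Cd.sat_P (Θ : Cd m n Prf) (M : Mdl) (x : ℕ) (ρ) :
    M.Sat ρ (Θ.P.subst0 (numeral x)) ↔ Θ.MP M x := by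
  rw [Mdl.sat_subst0, Cd.P]
  simp only [Mdl.Sat, Mdl.val, M.val_numeral]
  constructor
  · rintro ⟨a, h1, b, h2, h3⟩
    have h1 : a = M.num x := h1
    have h2 : b = M.num Θ.e := h2
    subst h1 h2
    exact (Θ.sat_coreF M _ _ _).1 h3
  · intro h
    exact ⟨M.num x, rfl, M.num Θ.e, rfl, (Θ.sat_coreF M _ _ _).2 h⟩

end

theorem Rep.mpos {R : ℕ → ℕ → ℕ → ℕ → ℕ → Prop} {θ : AFml} (h : Rep R θ) {M : Mdl}
    (hM : M.Models PA) {a b c d f : ℕ} (hR : R a b c d f) :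
    ∃ z : ℕ, M.Sat (e6 M.zero (M.num z) (M.num a) (M.num b) (M.num c) (M.num d) (M.num f)) θ := by
  obtain ⟨z, hz⟩ := h.pos hR
  refine ⟨z, ?_⟩
  rw [← hM.abs0 h.d0] at hz
  convert hz using 1
  funext n
  rcases n with _ | _ | _ | _ | _ | _ | n <;> rfl

theorem Mdl.Models.leM {M : Mdl} (hM : M.Models PA) (m n i j : ℕ) :
    M.LeM m n (M.num i) (M.num j) ↔ LeS m n i j := by
  unfold Mdl.LeM LeS
  split_ifs <;> exact hM.num_le

theorem exists_bound2 (f : ℕ → ℕ → ℕ) (s : ℕ) : ∃ u, ∀ a ≤ s, ∀ b ≤ s, f a b ≤ u := by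
  refine ⟨∑ a ∈ Finset.range (s + 1), ∑ b ∈ Finset.range (s + 1), f a b, fun a ha b hb => ?_⟩
  have h1 : f a b ≤ ∑ b ∈ Finset.range (s + 1), f a b :=
    Finset.single_le_sum (f := fun b => f a b) (fun _ _ => Nat.zero_le _)
      (Finset.mem_range.2 (by omega))
  have h2 : ∑ b ∈ Finset.range (s + 1), f a b ≤
      ∑ a ∈ Finset.range (s + 1), ∑ b ∈ Finset.range (s + 1), f a b :=
    Finset.single_le_sum (f := fun a => ∑ b ∈ Finset.range (s + 1), f a b)
      (fun _ _ => Nat.zero_le _) (Finset.mem_range.2 (by omega))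
  omega

section
variable {m n : ℕ} {Prf : ℕ → ℕ → Prop}

def Cd.Tail (Θ : Cd m n Prf) (s i y q : ℕ) : Prop :=
  (∀ s' < s, ¬ Bell m n Prf Θ.e s') ∧
    (RelP m n Prf Θ.e s y y y ∨ ∀ j ≤ s, LeS m n i j → RelX m n Prf Θ.e s y q j ∧
      ∀ s' < s, RelV m n Prf Θ.e s' y q j)

theorem Cd.tail_of_main (Θ : Cd m n Prf) {M : Mdl} (hM : M.Models PA) {s i y q : ℕ} {u : M.D}
    (h : Θ.Main M (M.num Θ.e) (M.num s) u (M.num i) (M.num y) (M.num q)) : Θ.Tail s i y q := by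
  obtain ⟨h1, h2⟩ := h
  refine ⟨fun s' hs' => ?_, ?_⟩
  · obtain ⟨z, _, hz⟩ := h1 (M.num s') (hM.num_le.2 hs'.le) ((hM.num_le (j := s' + 1)).2 hs')
    exact Θ.rN.neg M hM z hz
  · rcases h2 with ⟨z, _, hz⟩ | h2
    · exact .inl (Θ.rP.neg M hM z hz)
    · refine .inr fun j hj hl => ?_
      obtain ⟨⟨z, _, hz⟩, h3⟩ := h2 (M.num j) (hM.num_le.2 hj) ((hM.leM m n i j).2 hl)
      refine ⟨Θ.rX.neg M hM z hz, fun s' hs' => ?_⟩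
      obtain ⟨z, _, hz⟩ := h3 (M.num s') (hM.num_le.2 hs'.le) ((hM.num_le (j := s' + 1)).2 hs')
      exact Θ.rV.neg M hM z hz

theorem Cd.main_of_tail (Θ : Cd m n Prf) {M : Mdl} (hM : M.Models PA) {s i y q : ℕ}
    (h : Θ.Tail s i y q) :
    ∃ u, Θ.Main M (M.num Θ.e) (M.num s) u (M.num i) (M.num y) (M.num q) := by
  obtain ⟨h1, h2⟩ := h
  have hN : ∀ s', ∃ z : ℕ, s' < s → M.Sat (e6 M.zero (M.num z) (M.num Θ.e) (M.num s') (M.num s')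
      (M.num s') (M.num s')) Θ.fN := by
    intro s'
    by_cases hs : s' < s
    · obtain ⟨z, hz⟩ := Θ.rN.mpos hM (c := s') (d := s') (f := s') (h1 s' hs)
      exact ⟨z, fun _ => hz⟩
    · exact ⟨0, fun h => absurd h hs⟩
  choose zN hzN using hN
  have hlt : ∀ s' : M.D, M.le (M.succ s') (M.num s) → ∃ k < s, s' = M.num k := by
    intro s' hs
    obtain ⟨k, hk, h⟩ := hM.le_num hs
    cases k with
    | zero => exact absurd h (hM.succ_ne s')
    | succ k => exact ⟨k, hk, hM.succ_inj h⟩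
  rcases h2 with h2 | h2
  · obtain ⟨z, hz⟩ := Θ.rP.mpos hM h2
    obtain ⟨u, hu⟩ := exists_bound2 (fun a _ => zN a + z) s
    refine ⟨M.num u, fun s' _ hs => ?_, .inl ⟨M.num z, ?_, hz⟩⟩
    · obtain ⟨k, hk, rfl⟩ := hlt s' hs
      exact ⟨M.num (zN k), hM.num_le.2 (by have := hu k hk.le 0 (Nat.zero_le _); omega), hzN k hk⟩
    · exact hM.num_le.2 (by have := hu 0 (Nat.zero_le _) 0 (Nat.zero_le _); omega)
  · have hX : ∀ j, ∃ z : ℕ, j ≤ s → LeS m n i j → M.Sat (e6 M.zero (M.num z) (M.num Θ.e)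
        (M.num s) (M.num y) (M.num q) (M.num j)) Θ.fX := by
      intro j
      by_cases hs : j ≤ s ∧ LeS m n i j
      · obtain ⟨z, hz⟩ := Θ.rX.mpos hM (h2 j hs.1 hs.2).1
        exact ⟨z, fun _ _ => hz⟩
      · exact ⟨0, fun h h' => absurd ⟨h, h'⟩ hs⟩
    have hV : ∀ s' j, ∃ z : ℕ, j ≤ s → LeS m n i j → s' < s → M.Sat (e6 M.zero (M.num z)
        (M.num Θ.e) (M.num s') (M.num y) (M.num q) (M.num j)) Θ.fV := by
      intro s' j
      by_cases hs : j ≤ s ∧ LeS m n i j ∧ s' < s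
      · obtain ⟨z, hz⟩ := Θ.rV.mpos hM ((h2 j hs.1 hs.2.1).2 s' hs.2.2)
        exact ⟨z, fun _ _ _ => hz⟩
      · exact ⟨0, fun h h' h'' => absurd ⟨h, h', h''⟩ hs⟩
    choose zX hzX using hX
    choose zV hzV using hV
    obtain ⟨u, hu⟩ := exists_bound2 (fun a j => zN a + zX j + zV a j) s
    refine ⟨M.num u, fun s' _ hs => ?_, .inr fun j hj hl => ?_⟩
    · obtain ⟨k, hk, rfl⟩ := hlt s' hs
      exact ⟨M.num (zN k), hM.num_le.2 (by have := hu k hk.le 0 (Nat.zero_le _); omega), hzN k hk⟩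
    · obtain ⟨j, hj', rfl⟩ := hM.le_num hj
      rw [hM.leM] at hl
      refine ⟨⟨M.num (zX j), hM.num_le.2 ?_, hzX j hj' hl⟩, fun s' _ hs => ?_⟩
      · have := hu 0 (Nat.zero_le _) j hj'; omega
      · obtain ⟨k, hk, rfl⟩ := hlt s' hs
        exact ⟨M.num (zV k j), hM.num_le.2 (by have := hu k hk.le j hj'; omega),
          hzV k j hj' hl hk⟩

theorem Cd.MP_elim (Θ : Cd m n Prf) {M : Mdl} (hM : M.Models PA) {x : ℕ} (h : Θ.MP M x) :
    ∃ s u i y, Dec Θ.e x y i ∧ M.le (M.num x) s ∧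
      Θ.Main M (M.num Θ.e) s u (M.num i) (M.num y) (M.num (cl m n i)) := by
  obtain ⟨s, u0, u, i, hi, y, hy, q, hq, h1, h2, h3⟩ := h
  obtain ⟨i, _, rfl⟩ := hM.le_num hi
  obtain ⟨y, _, rfl⟩ := hM.le_num hy
  obtain ⟨q, _, rfl⟩ := hM.le_num hq
  obtain ⟨h4, rfl⟩ := Θ.rD.neg M hM u0 h1
  exact ⟨s, u, i, y, h4, h2, h3⟩

theorem Cd.MP_intro (Θ : Cd m n Prf) {M : Mdl} (hM : M.Models PA) {x i y : ℕ} {s u : M.D}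
    (hd : Dec Θ.e x y i) (hs : M.le (M.num x) s)
    (h : Θ.Main M (M.num Θ.e) s u (M.num i) (M.num y) (M.num (cl m n i))) : Θ.MP M x := by
  obtain ⟨u0, hu0⟩ := Θ.rD.mpos hM (a := Θ.e) (b := x) (c := i) (d := y) (f := cl m n i) ⟨hd, rfl⟩
  exact ⟨s, M.num u0, u, M.num i, hM.num_le.2 hd.le.2, M.num y, hM.num_le.2 hd.le.1,
    M.num (cl m n i), hM.num_le.2 ((cl_le _ _ _).trans hd.le.2), hu0, hs, h⟩

/-- Truth of the predicate. -/
def Cd.NP (Θ : Cd m n Prf) (x : ℕ) : Prop :=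
  ∃ s i y, Dec Θ.e x y i ∧ x ≤ s ∧ Θ.Tail s i y (cl m n i)

theorem Cd.MP_of_NP (Θ : Cd m n Prf) {M : Mdl} (hM : M.Models PA) {x : ℕ} (h : Θ.NP x) :
    Θ.MP M x := by
  obtain ⟨s, i, y, h1, h2, h3⟩ := h
  obtain ⟨u, hu⟩ := Θ.main_of_tail hM h3
  exact Θ.MP_intro hM h1 (hM.num_le.2 h2) hu

theorem Cd.MP_cases (Θ : Cd m n Prf) {M : Mdl} (hM : M.Models PA) {x : ℕ} (h : Θ.MP M x) :
    Θ.NP x ∨ ((∀ w, ¬ Bell m n Prf Θ.e w) ∧ ∃ s u i y, Dec Θ.e x y i ∧ (∀ k, M.le (M.num k) s) ∧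
      Θ.Main M (M.num Θ.e) s u (M.num i) (M.num y) (M.num (cl m n i))) := by
  obtain ⟨s, u, i, y, h1, h2, h3⟩ := Θ.MP_elim hM h
  by_cases hs : ∃ s0, s = M.num s0
  · obtain ⟨s0, rfl⟩ := hs
    exact .inl ⟨s0, i, y, h1, hM.num_le.1 h2, Θ.tail_of_main hM h3⟩
  · have hk : ∀ k, M.le (M.num k) s := fun k =>
      (hM.total' k s).resolve_left fun ⟨j, _, hj⟩ => hs ⟨j, hj⟩
    refine .inr ⟨fun w hw => ?_, s, u, i, y, h1, hk, h3⟩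
    obtain ⟨z, _, hz⟩ := h3.1 (M.num w) (hk w) (hk (w + 1))
    exact Θ.rN.neg M hM z hz hw

theorem Cd.true_iff (Θ : Cd m n Prf) (x : ℕ) : TrueN (Θ.P.subst0 (numeral x)) ↔ Θ.NP x := by
  refine ((NMdl_sat _ _).symm.trans (Θ.sat_P NMdl x fun _ => (0 : ℕ))).trans ?_
  refine ⟨fun h => ?_, Θ.MP_of_NP NMdl_models⟩
  obtain ⟨s, u, i, y, h1, h2, h3⟩ := Θ.MP_elim NMdl_models h
  obtain ⟨s0, rfl⟩ : ∃ s0, s = NMdl.num s0 := ⟨s, (NMdl_num s).symm⟩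
  exact ⟨s0, i, y, h1, NMdl_models.num_le.1 h2, Θ.tail_of_main NMdl_models h3⟩

/-! ### The bell never rings -/

theorem Bell.of_relX {c s y q j : ℕ} (h : RelX m n Prf c s y q j) : Bell m n Prf c s := by
  obtain ⟨k, hk, h1, _⟩ := h
  exact ⟨k, hk, h1.1⟩

theorem LV.unique {c s k k' : ℕ} (h : LV m n Prf c s k) (h' : LV m n Prf c s k') : k = k' := by
  rcases lt_trichotomy k k' with hl | hl | hl
  · exact absurd h.1 ((h'.2 k hl.le).resolve_left (not_not.2 hl))
  · exact hl
  · exact absurd h'.1 ((h.2 k' hl.le).resolve_left (not_not.2 hl))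

theorem Bell.exists_LV {c s : ℕ} (h : Bell m n Prf c s) :
    ∃ k ≤ 2 ^ (s + 1), LV m n Prf c s k := by
  classical
  obtain ⟨k, hk, h⟩ := h
  have hex : ∃ k, VW m n Prf c s k := ⟨k, h⟩
  refine ⟨Nat.find hex, (Nat.find_le h).trans hk, Nat.find_spec hex, fun k' _ => ?_⟩
  by_cases hl : k' < Nat.find hex
  · exact .inr (Nat.find_min hex hl)
  · exact .inl hl

theorem Cd.not_bell (Θ : Cd m n Prf) {Tax : Set AFml} (hext : PA ⊆ Tax)
    (hcons : ¬ Proves Tax botFml) (hP : PrfRel Tax Prf) (w : ℕ) : ¬ Bell m n Prf Θ.e w := by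
  induction w using Nat.strong_induction_on with
  | _ w ihw =>
  intro hb
  obtain ⟨k, hk2, hk⟩ := hb.exists_LV
  obtain ⟨K, _, I, _, hA, hB, hC, hD, hL, x₀, hx₀, hE1, hE2, hE3⟩ := hk.1
  obtain ⟨M, hM⟩ := exists_model hcons
  have hMP : M.Models PA := fun γ hγ => hM γ (hext hγ)
  -- the meaning of the predicate below `w`
  have key : ∀ x ≤ w, Θ.NP x ↔ bit k x := by
    intro x hx
    constructor
    · rintro ⟨s, i, y, h1, h2, h3, h4⟩
      have hyx := h1.le
      have hs : s ≤ w := by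
        by_contra hs
        exact h3 w (by omega) hb
      rcases hs.lt_or_eq with hs | rfl
      · rcases h4 with h4 | h4
        · rcases hC s hs.le x hx y (by omega) i (by omega) with h | h | h | h
          · exact absurd hs h
          · exact absurd h1 h
          · exact absurd h4.2 h
          · exact h
        · exact absurd (Bell.of_relX (h4 i (by omega) (LeS.refl _ _ _)).1) (ihw s hs)
      · rcases h4 with h4 | h4
        · exact absurd hb h4.1
        · obtain ⟨k', _, h5, h6⟩ := (h4 i (by omega) (LeS.refl _ _ _)).1
          obtain rfl := hk.unique h5
          rcases h6 x hx with h | h | h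
          · exact absurd h1 h
          · exact absurd rfl h
          · exact h
    · intro hxk
      obtain ⟨y, i, h1⟩ := Dec.exists Θ.e x
      have hyx := h1.le
      have step : ∀ x' ≤ w, ∀ j, LeS m n i j → Dec Θ.e x' y j → cl m n j = cl m n i →
          bit k x' := by
        intro x' hx' j hl hd hc
        have hd' := hd.le
        rcases hA x hx x' hx' y (by omega) i (by omega) j (by omega) with h | h | h | h | h | h
        · exact absurd h1 h
        · exact absurd hd h
        · exact absurd hc.symm h
        · exact absurd hl h
        · exact absurd hxk h
        · exact h
      refine ⟨w, i, y, h1, hx, ihw, .inr fun j hj hl => ⟨⟨k, hk2, hk, fun x' hx' => ?_⟩, ?_⟩⟩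
      · by_cases hd : Dec Θ.e x' y j
        · by_cases hc : cl m n j = cl m n i
          · exact .inr (.inr (step x' hx' j hl hd hc))
          · exact .inr (.inl hc)
        · exact .inl hd
      · rintro s' hs' ⟨z, hz, hd, hc, hj1, hpf⟩
        rcases hB s' hs'.le z (by omega) y (by omega) j hj with h | h | h | h | h
        · exact h hs'
        · exact h hd
        · exact h hj1
        · exact h hpf
        · exact h (step z (by omega) j hl hd hc)
  -- `K` is the truth set of `M`
  have truth : ∀ x ≤ w, bit I x → ∃ ψ : AFml, x = ψ.code ∧ ∀ ρ, (M.Sat ρ ψ ↔ bit K x) := by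
    intro x
    induction x using Nat.strong_induction_on with
    | _ x ih =>
    intro hx hxI
    rcases hD x hx with h | ⟨h, h'⟩ | ⟨a, ha, rfl⟩ | ⟨a, ha, b, hb, h⟩ | ⟨u, hu, rfl, h⟩
    · exact absurd hxI h
    · refine ⟨botFml, h, fun ρ => ⟨fun hs => ?_, fun h => absurd h h'⟩⟩
      exact absurd hs.symm (hMP.succ_ne _)
    · obtain ⟨h1, h2⟩ := hL.neg hx hxI
      have hlt : a < Nat.pair 2 a := by have := Nat.add_le_pair 2 a; omega
      obtain ⟨ψ, rfl, h3⟩ := ih a hlt ha h1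
      exact ⟨.neg ψ, rfl, fun ρ => by simp only [Mdl.Sat]; rw [h2, h3]⟩
    · have hlt : ∀ t, 3 ≤ t → a < Nat.pair t (Nat.pair a b) ∧ b < Nat.pair t (Nat.pair a b) := by
        intro t ht
        have := Nat.add_le_pair t (Nat.pair a b)
        have := Nat.add_le_pair a b
        omega
      rcases h with rfl | rfl | rfl
      · obtain ⟨h1, h1', h2⟩ := (hL.bin 3 hx hxI).1 rfl
        obtain ⟨ψ, rfl, h3⟩ := ih a (hlt 3 (by omega)).1 ha h1
        obtain ⟨χ, rfl, h4⟩ := ih b (hlt 3 (by omega)).2 hb h1'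
        exact ⟨.and ψ χ, rfl, fun ρ => by simp only [Mdl.Sat]; rw [h2, h3, h4]⟩
      · obtain ⟨h1, h1', h2⟩ := (hL.bin 4 hx hxI).2.1 rfl
        obtain ⟨ψ, rfl, h3⟩ := ih a (hlt 4 (by omega)).1 ha h1
        obtain ⟨χ, rfl, h4⟩ := ih b (hlt 4 (by omega)).2 hb h1'
        exact ⟨.or ψ χ, rfl, fun ρ => by simp only [Mdl.Sat]; rw [h2, h3, h4]⟩
      · obtain ⟨h1, h1', h2⟩ := (hL.bin 5 hx hxI).2.2 rfl
        obtain ⟨ψ, rfl, h3⟩ := ih a (hlt 5 (by omega)).1 ha h1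
        obtain ⟨χ, rfl, h4⟩ := ih b (hlt 5 (by omega)).2 hb h1'
        refine ⟨.imp ψ χ, rfl, fun ρ => ?_⟩
        simp only [Mdl.Sat]
        rw [h2, h3, h4]
        try exact imp_iff_not_or
    · refine ⟨Θ.P.subst0 (numeral u), (Θ.P_code u).symm, fun ρ => ?_⟩
      rw [Θ.sat_P, h, ← key u hu]
      refine ⟨fun hm => ?_, Θ.MP_of_NP hMP⟩
      exact (Θ.MP_cases hMP hm).resolve_right fun hr => hr.1 w hb
  obtain ⟨ψ, hψ, hT⟩ := truth x₀ hx₀ hE2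
  obtain ⟨φ, hφ, hpf⟩ := hP.sound hE1
  obtain rfl : ψ = φ := AFml.code_inj (hψ.symm.trans hφ)
  exact hE3 ((hT fun _ => M.zero).1 (M.sound hM hpf _))

end

section
variable {m n : ℕ} {Prf : ℕ → ℕ → Prop}

theorem Cd.NP_elim (Θ : Cd m n Prf) {Tax : Set AFml} (hext : PA ⊆ Tax)
    (hcons : ¬ Proves Tax botFml) (hP : PrfRel Tax Prf) {x y i : ℕ} (h : Θ.NP x)
    (hd : Dec Θ.e x y i) : ∃ ψ : AFml, y = ψ.code ∧ Proves Tax ψ := by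
  obtain ⟨s, i', y', h1, h2, h3, h4⟩ := h
  obtain ⟨rfl, rfl⟩ := h1.unique hd
  rcases h4 with h4 | h4
  · exact hP.sound h4.2
  · have := h1.le
    exact absurd (Bell.of_relX (h4 i' (by omega) (LeS.refl _ _ _)).1)
      (Θ.not_bell hext hcons hP s)

theorem Cd.NP_intro (Θ : Cd m n Prf) {Tax : Set AFml} (hext : PA ⊆ Tax)
    (hcons : ¬ Proves Tax botFml) (hP : PrfRel Tax Prf) {x i : ℕ} {ψ : AFml}
    (hd : Dec Θ.e x ψ.code i) (h : Proves Tax ψ) : Θ.NP x := by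
  obtain ⟨s, hs, hp⟩ := hP.complete h x
  exact ⟨s, i, ψ.code, hd, hs, fun s' _ => Θ.not_bell hext hcons hP s',
    .inl ⟨Θ.not_bell hext hcons hP s, hp⟩⟩

theorem Cd.prov_root (Θ : Cd m n Prf) {Tax : Set AFml} (hext : PA ⊆ Tax)
    (hcons : ¬ Proves Tax botFml) (hsound : Sigma1Sound Tax) (hP : PrfRel Tax Prf)
    {φ : AFml} {y i : ℕ} (hd : Dec Θ.e φ.code y i) (h : Proves Tax φ) :
    ∃ ψ : AFml, y = ψ.code ∧ Proves Tax ψ := by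
  cases i with
  | zero => exact ⟨φ, hd.2.1.symm, h⟩
  | succ i =>
    obtain ⟨u, h1, h2, h3⟩ := hd.pred
    rw [← Θ.P_code] at h1
    obtain rfl := AFml.code_inj h1
    exact Θ.NP_elim hext hcons hP
      ((Θ.true_iff u).1 (hsound _ (Θ.P_inst_sigma u) (Θ.P_inst_free u) h)) h3

theorem Cd.NP_of_prov (Θ : Cd m n Prf) {Tax : Set AFml} (hext : PA ⊆ Tax)
    (hcons : ¬ Proves Tax botFml) (hsound : Sigma1Sound Tax) (hP : PrfRel Tax Prf)
    {φ : AFml} (h : Proves Tax φ) : Θ.NP φ.code := by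
  obtain ⟨y, i, hd⟩ := Dec.exists Θ.e φ.code
  obtain ⟨ψ, rfl, hψ⟩ := Θ.prov_root hext hcons hsound hP hd h
  exact Θ.NP_intro hext hcons hP hd hψ

theorem Cd.PA_of_NP (Θ : Cd m n Prf) {Γ : Set AFml} (hext : PA ⊆ Γ) {x : ℕ} (h : Θ.NP x) :
    Proves Γ (Θ.P.subst0 (numeral x)) :=
  completeness fun M hM ρ =>
    (Θ.sat_P M x ρ).2 (Θ.MP_of_NP (fun γ hγ => hM γ (hext hγ)) h)

theorem Cd.iter_code (Θ : Cd m n Prf) (φ : AFml) (j : ℕ) :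
    (iterPred Θ.P j φ).code = It Θ.e j φ.code := by
  induction j with
  | zero => rfl
  | succ j ih => rw [iterPred, Θ.appNum_code, ih, It_succ]

theorem Cd.prov_iter (Θ : Cd m n Prf) {Tax : Set AFml} (hext : PA ⊆ Tax)
    (hcons : ¬ Proves Tax botFml) (hsound : Sigma1Sound Tax) (hP : PrfRel Tax Prf)
    {φ : AFml} (h : Proves Tax φ) (j : ℕ) : Proves Tax (iterPred Θ.P j φ) := by
  induction j with
  | zero => exact h
  | succ j ih => exact Θ.PA_of_NP hext (Θ.NP_of_prov hext hcons hsound hP ih)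

theorem Cd.prov_of_NP (Θ : Cd m n Prf) {Tax : Set AFml} (hext : PA ⊆ Tax)
    (hcons : ¬ Proves Tax botFml) (hsound : Sigma1Sound Tax) (hP : PrfRel Tax Prf)
    {φ : AFml} (h : Θ.NP φ.code) : Proves Tax φ := by
  obtain ⟨y, i, hd⟩ := Dec.exists Θ.e φ.code
  obtain ⟨ψ, rfl, hψ⟩ := Θ.NP_elim hext hcons hP h hd
  have h1 := hd.2.1
  rw [← Θ.iter_code] at h1
  rw [AFml.code_inj h1]
  exact Θ.prov_iter hext hcons hsound hP hψ i

theorem Cd.isProvPred (Θ : Cd m n Prf) {Tax : Set AFml} (hext : PA ⊆ Tax)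
    (hcons : ¬ Proves Tax botFml) (hsound : Sigma1Sound Tax) (hP : PrfRel Tax Prf) :
    IsProvPred Tax Θ.P := by
  refine ⟨Θ.P_free, fun φ => ⟨fun h => ?_, fun h => ?_⟩⟩
  · exact Θ.PA_of_NP (fun _ h => h) (Θ.NP_of_prov hext hcons hsound hP h)
  · have h1 : Proves Tax (Θ.P.appNum φ) :=
      completeness fun M hM ρ => M.sound (fun γ hγ => hM γ (hext hγ)) h ρ
    exact Θ.prov_of_NP hext hcons hsound hP
      ((Θ.true_iff _).1 (hsound _ (Θ.P_inst_sigma _) (Θ.P_inst_free _) h1))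

theorem LeM_trans {M : Mdl} (hM : M.Models PA) {i i' : ℕ} {j : M.D} (h : LeS m n i i')
    (h' : M.LeM m n (M.num i') j) : M.LeM m n (M.num i) j := by
  unfold Mdl.LeM at *
  unfold LeS at h
  split_ifs at *
  · obtain ⟨k, hk, rfl⟩ := hM.le_num h'
    exact hM.num_le.2 (by omega)
  · exact hM.num_le_of_le h h'

theorem Dec.iter {c x y i : ℕ} (h : Dec c x y i) (hx : ¬ junk x) (j : ℕ) :
    Dec c (It c j x) y (j + i) := by
  induction j with
  | zero => rw [Nat.zero_add]; exact h
  | succ j ih =>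
    rw [It_succ, show j + 1 + i = j + i + 1 by ring]
    refine ih.succ ?_
    cases j with
    | zero => exact hx
    | succ j => rw [It_succ]; exact not_junk_Psub _ _

theorem Cd.prov_acc (Θ : Cd m n Prf) {Tax : Set AFml} (hext : PA ⊆ Tax)
    (hcons : ¬ Proves Tax botFml) (hP : PrfRel Tax Prf) (hm : 1 ≤ m) (hn : 1 ≤ n) (φ : AFml) :
    Proves Tax (.imp (iterPred Θ.P n φ) (iterPred Θ.P m φ)) := by
  obtain ⟨y, a, hd⟩ := Dec.exists Θ.e φ.code
  have hdn := hd.iter (not_junk_code φ) (n - 1)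
  have hdm := hd.iter (not_junk_code φ) (m - 1)
  have hcl := cl_shift hm hn a
  have en : iterPred Θ.P n φ = Θ.P.subst0 (numeral (It Θ.e (n - 1) φ.code)) := by
    obtain ⟨n, rfl⟩ : ∃ k, n = k + 1 := ⟨n - 1, by omega⟩
    rw [iterPred, AFml.appNum, gnum, Θ.iter_code]; rfl
  have em : iterPred Θ.P m φ = Θ.P.subst0 (numeral (It Θ.e (m - 1) φ.code)) := by
    obtain ⟨m, rfl⟩ : ∃ k, m = k + 1 := ⟨m - 1, by omega⟩
    rw [iterPred, AFml.appNum, gnum, Θ.iter_code]; rfl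
  rw [en, em]
  refine completeness fun M hM ρ => ?_
  have hMP : M.Models PA := fun γ hγ => hM γ (hext hγ)
  show M.Sat _ _ → M.Sat _ _
  rw [Θ.sat_P, Θ.sat_P]
  intro h
  rcases Θ.MP_cases hMP h with h | ⟨_, s, u, i, y', h1, h2, h3, h4⟩
  · obtain ⟨ψ, rfl, hψ⟩ := Θ.NP_elim hext hcons hP h hdn
    exact Θ.MP_of_NP hMP (Θ.NP_intro hext hcons hP hdm hψ)
  · obtain ⟨rfl, rfl⟩ := h1.unique hdn
    refine Θ.MP_intro hMP (s := s) (u := u) hdm (h2 _) ?_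
    rw [hcl] at h4
    exact ⟨h3, h4.imp_right fun h4 j hj hl => h4 j hj (LeM_trans hMP (LeS.shift a) hl)⟩

theorem Cd.prov_ros (Θ : Cd m n Prf) {Tax : Set AFml} (hext : PA ⊆ Tax)
    (hcons : ¬ Proves Tax botFml) (hsound : Sigma1Sound Tax) (hP : PrfRel Tax Prf) (φ : AFml)
    (h : Proves Tax (.neg (Θ.P.appNum φ))) :
    Proves Tax (.neg (Θ.P.appNum (Θ.P.appNum φ))) := by
  obtain ⟨y, a, hd⟩ := Dec.exists Θ.e φ.code
  have hd' := hd.succ (not_junk_code φ)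
  refine completeness fun M hM ρ => ?_
  have hMP : M.Models PA := fun γ hγ => hM γ (hext hγ)
  have hneg : ¬ Θ.MP M φ.code := fun h' => M.sound hM h ρ ((Θ.sat_P M _ ρ).2 h')
  show ¬ M.Sat ρ (Θ.P.subst0 (numeral (Θ.P.appNum φ).code))
  rw [Θ.sat_P, Θ.appNum_code]
  intro hm'
  rcases Θ.MP_cases hMP hm' with h' | ⟨_, s, u, i, y', h1, h2, h3, h4⟩
  · obtain ⟨ψ, rfl, hψ⟩ := Θ.NP_elim hext hcons hP h' hd'
    exact hneg (Θ.MP_of_NP hMP (Θ.NP_intro hext hcons hP hd hψ))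
  · obtain ⟨rfl, rfl⟩ := h1.unique hd'
    rcases h4 with h4 | h4
    · exact hneg (Θ.MP_intro hMP (s := s) (u := u) hd (h2 _) ⟨h3, .inl h4⟩)
    · obtain ⟨s0, _, hs0⟩ := hP.complete h 0
      have hle := hP.le hs0
      have hle' := le_pair_left' 2 (Θ.P.appNum φ).code
      obtain ⟨_, h5⟩ := h4 (M.num (a + 1)) (h2 _) ((hMP.leM _ _ _ _).2 (LeS.refl _ _ _))
      obtain ⟨z, _, hz⟩ := h5 (M.num s0) (h2 s0) (h2 (s0 + 1))
      refine Θ.rV.neg M hMP z hz ⟨Psub Θ.e φ.code, ?_, hd', rfl, by omega, ?_⟩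
      · rw [← Θ.appNum_code]; exact hle'.trans hle
      · rw [← Θ.appNum_code]; exact hs0

theorem IsInterp.boxIter {P : AFml} {f : MFml → AFml} (hf : IsInterp P f) (k : ℕ) (A : MFml) :
    f (boxIter k A) = iterPred P k (f A) := by
  induction k with
  | zero => rfl
  | succ k ih => rw [PLN.boxIter, hf.2.2.2.2.2.2, ih]; rfl

theorem IsInterp.taut {P : AFml} {f : MFml → AFml} (hf : IsInterp P f) {A : MFml} (h : MTaut A)
    {Γ : Set AFml} (hΓ : PA ⊆ Γ) : Proves Γ (f A) := by
  obtain ⟨_, hbot, hneg, hand, hor, himp, _⟩ := hf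
  refine completeness fun M hM ρ => ?_
  have hMP : M.Models PA := fun γ hγ => hM γ (hΓ hγ)
  have : ∀ B : MFml, B.evalTC (fun B => M.Sat ρ (f B)) ↔ M.Sat ρ (f B) := by
    intro B
    induction B with
    | var i => rfl
    | box B _ => rfl
    | bot =>
      rw [hbot]
      exact ⟨False.elim, fun h => hMP.succ_ne _ h.symm⟩
    | neg B ih => rw [hneg]; simp only [MFml.evalTC, Mdl.Sat, ih]
    | and B C ih ih' => rw [hand]; simp only [MFml.evalTC, Mdl.Sat, ih, ih']
    | or B C ih ih' => rw [hor]; simp only [MFml.evalTC, Mdl.Sat, ih, ih']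
    | imp B C ih ih' => rw [himp]; simp only [MFml.evalTC, Mdl.Sat, ih, ih']
  exact (this A).1 (h _)

theorem Cd.soundness (Θ : Cd m n Prf) {Tax : Set AFml} (hext : PA ⊆ Tax)
    (hcons : ¬ Proves Tax botFml) (hsound : Sigma1Sound Tax) (hP : PrfRel Tax Prf)
    (hm : 1 ≤ m) (hn : 1 ≤ n) {f : MFml → AFml} (hf : IsInterp Θ.P f) {A : MFml}
    (h : NAProves m n A) : Proves Tax (f A) := by
  have hf' := hf
  obtain ⟨_, hbot, hneg, hand, hor, himp, hbox⟩ := hf'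
  induction h with
  | taut h => exact hf.taut h hext
  | acc A =>
    rw [himp, hf.boxIter, hf.boxIter]
    exact Θ.prov_acc hext hcons hP hm hn _
  | mp _ _ ih ih' => rw [himp] at ih; exact ih.mp ih'
  | nec _ ih => rw [hbox]; exact Θ.prov_iter hext hcons hsound hP ih 1
  | ros _ ih =>
    rw [hneg, hbox] at ih
    rw [hneg, hbox, hbox]
    exact Θ.prov_ros hext hcons hsound hP _ ih

end

/-! ### A Lindenbaum lemma for the modal logic -/

theorem lindenbaum {m n : ℕ} {A : MFml} (hA : ¬ NAProves m n A) :
    ∃ v : MFml → Prop, (∀ B, NAProves m n B → B.evalTC v) ∧ ¬ A.evalTC v := by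
  let Good : Set (Set MFml) := {S | (∀ B, NAProves m n B → B ∈ S) ∧
    (∀ B C, MFml.imp B C ∈ S → B ∈ S → C ∈ S) ∧ A ∉ S}
  obtain ⟨S, hS0, hS⟩ := zorn_subset_nonempty Good (fun c hc hch hne => by
    refine ⟨⋃₀ c, ⟨?_, ?_, ?_⟩, fun s hs => Set.subset_sUnion_of_mem hs⟩
    · intro B hB
      obtain ⟨s, hs⟩ := hne
      exact ⟨s, hs, (hc hs).1 B hB⟩
    · rintro B C ⟨s, hs, h1⟩ ⟨t, ht, h2⟩
      rcases hch.total hs ht with h | h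
      · exact ⟨t, ht, (hc ht).2.1 B C (h h1) h2⟩
      · exact ⟨s, hs, (hc hs).2.1 B C h1 (h h2)⟩
    · rintro ⟨s, hs, h⟩
      exact (hc hs).2.2 h) {B | NAProves m n B}
      ⟨fun _ h => h, fun _ _ h h' => h.mp h', hA⟩
  obtain ⟨⟨hth, hmp, hAS⟩, hmax⟩ := hS
  have t : ∀ B, MTaut B → B ∈ S := fun B hB => hth B (.taut hB)
  have hout : ∀ B, B ∉ S → MFml.imp B A ∈ S := by
    intro B hB
    by_contra hBA
    have hle : S ⊆ {C | MFml.imp B C ∈ S} := fun C hC =>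
      hmp C _ (t (.imp C (.imp B C)) (by intro v; simp only [MFml.evalTC]; tauto)) hC
    refine hB (hmax (y := {C | MFml.imp B C ∈ S}) ⟨fun C hC => hle (hth C hC), ?_, hBA⟩ hle
      (t (.imp B B) (by intro v; simp only [MFml.evalTC]; tauto)))
    intro C D h1 h2
    exact hmp _ _ (hmp _ _ (t (.imp (.imp B (.imp C D)) (.imp (.imp B C) (.imp B D)))
      (by intro v; simp only [MFml.evalTC]; tauto)) h1) h2
  have hneg : ∀ B, MFml.neg B ∈ S ↔ B ∉ S := by
    intro B
    constructor
    · intro h1 h2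
      exact hAS (hmp _ _ (hmp _ _ (t (.imp (.neg B) (.imp B A))
        (by intro v; simp only [MFml.evalTC]; tauto)) h1) h2)
    · intro h1
      by_contra h2
      exact hAS (hmp _ _ (hmp _ _ (t (.imp (.imp B A) (.imp (.imp (.neg B) A) A))
        (by intro v; simp only [MFml.evalTC]; tauto)) (hout _ h1)) (hout _ h2))
  have m1 : ∀ B C, MTaut (.imp B C) → B ∈ S → C ∈ S := fun B C h => hmp _ _ (t _ h)
  have m2 : ∀ B C D, MTaut (.imp B (.imp C D)) → B ∈ S → C ∈ S → D ∈ S :=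
    fun B C D h h1 h2 => hmp _ _ (hmp _ _ (t _ h) h1) h2
  have key : ∀ B : MFml, B.evalTC (fun C => C ∈ S) ↔ B ∈ S := by
    intro B
    induction B with
    | var i => rfl
    | box B _ => rfl
    | bot =>
      exact ⟨False.elim, fun h => hAS (m1 .bot A
        (by intro v; simp only [MFml.evalTC]; tauto) h)⟩
    | neg B ih => simp only [MFml.evalTC, ih, hneg]
    | and B C ih ih' =>
      simp only [MFml.evalTC, ih, ih']
      exact ⟨fun h => m2 B C _ (by intro v; simp only [MFml.evalTC]; tauto) h.1 h.2,
        fun h => ⟨m1 _ _ (by intro v; simp only [MFml.evalTC]; tauto) h,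
          m1 _ _ (by intro v; simp only [MFml.evalTC]; tauto) h⟩⟩
    | or B C ih ih' =>
      simp only [MFml.evalTC, ih, ih']
      constructor
      · rintro (h | h)
        · exact m1 B _ (by intro v; simp only [MFml.evalTC]; tauto) h
        · exact m1 C _ (by intro v; simp only [MFml.evalTC]; tauto) h
      · intro h
        by_contra! h'
        exact h'.2 (m2 (.or B C) (.neg B) C (by intro v; simp only [MFml.evalTC]; tauto) h
          ((hneg B).2 h'.1))
    | imp B C ih ih' =>
      simp only [MFml.evalTC, ih, ih']
      constructor
      · intro h
        by_cases hB : B ∈ S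
        · exact m1 C _ (by intro v; simp only [MFml.evalTC]; tauto) (h hB)
        · exact m1 (.neg B) _ (by intro v; simp only [MFml.evalTC]; tauto) ((hneg B).2 hB)
      · exact hmp B C
  exact ⟨fun C => C ∈ S, fun B hB => (key B).2 (hth B hB), fun h => hAS ((key A).1 h)⟩

/-! ### The exact interpretation -/

/-- The interpretation sending `p_i` to `P(⟨8,i⟩)`. -/
def itp (P : AFml) : MFml → AFml
  | .var i => P.subst0 (numeral (Nat.pair 8 i))
  | .bot => botFml
  | .neg A => .neg (itp P A)
  | .and A B => .and (itp P A) (itp P B)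
  | .or A B => .or (itp P A) (itp P B)
  | .imp A B => .imp (itp P A) (itp P B)
  | .box A => P.appNum (itp P A)

/-- Codes of the values of the interpretation. -/
def fc (c : ℕ) : MFml → ℕ
  | .var i => Psub c (Nat.pair 8 i)
  | .bot => botFml.code
  | .neg A => Nat.pair 2 (fc c A)
  | .and A B => Nat.pair 3 (Nat.pair (fc c A) (fc c B))
  | .or A B => Nat.pair 4 (Nat.pair (fc c A) (fc c B))
  | .imp A B => Nat.pair 5 (Nat.pair (fc c A) (fc c B))
  | .box A => Psub c (fc c A)

def mtag : MFml → ℕ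
  | .var _ => 7
  | .bot => 0
  | .neg _ => 2
  | .and _ _ => 3
  | .or _ _ => 4
  | .imp _ _ => 5
  | .box _ => 7

theorem fc_tag (c : ℕ) (A : MFml) : (fc c A).unpair.1 = mtag A := by
  cases A <;> simp [fc, mtag, Psub_tag, botFml, AFml.code]

theorem fc_not_junk (c : ℕ) (A : MFml) : ¬ junk (fc c A) := by
  unfold junk
  rw [fc_tag]
  cases A <;> simp [mtag]

theorem fc_inj {c : ℕ} {A B : MFml} (h : fc c A = fc c B) : A = B := by
  have ht : mtag A = mtag B := by rw [← fc_tag c, ← fc_tag c, h]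
  induction A generalizing B with
  | var i =>
    cases B <;> simp [mtag] at ht
    · have := Psub_inj h; simp at this; rw [this]
    · rename_i B
      have := Psub_inj h
      exact absurd (show junk (fc c B) by rw [← this]; simp [junk]) (fc_not_junk c B)
  | bot => cases B <;> simp [mtag] at ht; rfl
  | box A ih =>
    cases B <;> simp [mtag] at ht
    · have := Psub_inj h
      exact absurd (show junk (fc c A) by rw [this]; simp [junk]) (fc_not_junk c A)
    · have := Psub_inj h
      rw [ih this (by rw [← fc_tag c, ← fc_tag c, this])]
  | neg A ih =>
    cases B <;> simp [mtag] at ht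
    simp [fc] at h
    rw [ih h (by rw [← fc_tag c, ← fc_tag c, h])]
  | and A A' ih ih' =>
    cases B <;> simp [mtag] at ht
    simp [fc] at h
    rw [ih h.1 (by rw [← fc_tag c, ← fc_tag c, h.1]), ih' h.2 (by rw [← fc_tag c, ← fc_tag c, h.2])]
  | or A A' ih ih' =>
    cases B <;> simp [mtag] at ht
    simp [fc] at h
    rw [ih h.1 (by rw [← fc_tag c, ← fc_tag c, h.1]), ih' h.2 (by rw [← fc_tag c, ← fc_tag c, h.2])]
  | imp A A' ih ih' =>
    cases B <;> simp [mtag] at ht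
    simp [fc] at h
    rw [ih h.1 (by rw [← fc_tag c, ← fc_tag c, h.1]), ih' h.2 (by rw [← fc_tag c, ← fc_tag c, h.2])]

theorem fc_Psub {c u : ℕ} {B : MFml} (h : fc c B = Psub c u) (hu : ¬ junk u) :
    ∃ B', B = .box B' ∧ u = fc c B' := by
  have ht : mtag B = 7 := by rw [← fc_tag c, h, Psub_tag]
  cases B <;> simp [mtag] at ht
  · have := Psub_inj h
    exact absurd (show junk u by rw [← this]; simp [junk]) hu
  · exact ⟨_, rfl, (Psub_inj h).symm⟩

theorem fc_boxIter (c k : ℕ) (A : MFml) : fc c (boxIter k A) = It c k (fc c A) := by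
  induction k with
  | zero => rfl
  | succ k ih => rw [boxIter, It_succ, ← ih]; rfl

theorem fc_dec {c x y i : ℕ} {B : MFml} (h : Dec c x y i) (hx : x = fc c B) :
    ∃ C, y = fc c C ∧ B = boxIter i C := by
  induction i generalizing x B with
  | zero => exact ⟨B, by rw [← hx]; exact h.2.1.symm, rfl⟩
  | succ i ih =>
    obtain ⟨u, h1, h2, h3⟩ := h.pred
    obtain ⟨B', rfl, h5⟩ := fc_Psub (hx.symm.trans h1) h2
    obtain ⟨C, h6, rfl⟩ := ih h3 h5
    exact ⟨C, h6, rfl⟩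

theorem boxIter_add (a b : ℕ) (A : MFml) : boxIter (a + b) A = boxIter a (boxIter b A) := by
  induction a with
  | zero => rw [Nat.zero_add]; rfl
  | succ a ih => rw [show a + 1 + b = a + b + 1 by ring, boxIter, ih]; rfl

theorem nec_iter {m n : ℕ} {A : MFml} (h : NAProves m n A) (k : ℕ) :
    NAProves m n (boxIter k A) := by
  induction k with
  | zero => exact h
  | succ k ih => exact ih.nec

theorem box_steps {m n i j : ℕ} (hmn : m ≠ n) (hm : 1 ≤ m) (hn : 1 ≤ n)
    (hc : cl m n i = cl m n j) (hl : LeS m n i j) (C : MFml) :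
    NAProves m n (.imp (boxIter (i + 1) C) (boxIter (j + 1) C)) := by
  refine cl_steps hmn hm hn hc hl
    (Q := fun i j => NAProves m n (.imp (boxIter (i + 1) C) (boxIter (j + 1) C))) ?_ ?_ ?_
  · intro i
    exact .taut (by intro v; simp only [MFml.evalTC]; tauto)
  · intro i j k h1 h2
    refine .mp (.mp (.taut ?_) h1) h2
    intro v; simp only [MFml.evalTC]; tauto
  · intro a
    have := NAProves.acc (m := m) (n := n) (boxIter a C)
    rw [← boxIter_add, ← boxIter_add] at this
    rw [show n - 1 + a + 1 = n + a by omega, show m - 1 + a + 1 = m + a by omega]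
    exact this

section
variable {m n : ℕ} {Prf : ℕ → ℕ → Prop}

theorem Cd.itp_code (Θ : Cd m n Prf) (A : MFml) : (itp Θ.P A).code = fc Θ.e A := by
  induction A with
  | var i => exact Θ.P_code _
  | bot => rfl
  | box A ih => rw [itp, Θ.appNum_code, ih]; rfl
  | neg A ih => simp only [itp, fc, AFml.code, ih]
  | and A B ih ih' => simp only [itp, fc, AFml.code, ih, ih']
  | or A B ih ih' => simp only [itp, fc, AFml.code, ih, ih']
  | imp A B ih ih' => simp only [itp, fc, AFml.code, ih, ih']

theorem Cd.itp_isInterp (Θ : Cd m n Prf) : IsInterp Θ.P (itp Θ.P) :=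
  ⟨fun _ => Θ.P_inst_free _, rfl, fun _ => rfl, fun _ _ => rfl, fun _ _ => rfl,
    fun _ _ => rfl, fun _ => rfl⟩

set_option maxHeartbeats 1000000 in
theorem Cd.exact (Θ : Cd m n Prf) {Tax : Set AFml} (hext : PA ⊆ Tax)
    (hcons : ¬ Proves Tax botFml) (hsound : Sigma1Sound Tax) (hP : PrfRel Tax Prf)
    (hmn : m ≠ n) (hm : 1 ≤ m) (hn : 1 ≤ n) (w : ℕ) :
    ∀ A, Prf w (fc Θ.e A) → NAProves m n A := by
  induction w using Nat.strong_induction_on with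
  | _ w ihw =>
  intro A hA
  by_contra hnA
  obtain ⟨v, hv, hvA⟩ := lindenbaum hnA
  set c := Θ.e with hc
  let Im : ℕ → Prop := fun x => ∃ B, x = fc c B
  let S : ℕ → Prop := fun x => (∃ B, x = fc c B ∧ v (.box B)) ∨
    (∃ i, x = Nat.pair 8 i ∧ v (.var i)) ∨ ((¬ Im x) ∧ ∃ φ : AFml, x = φ.code ∧ Proves Tax φ)
  obtain ⟨k, hk, hk'⟩ := exists_mask S (w + 1)
  obtain ⟨K, hK, hK'⟩ := exists_mask (fun x => ∃ B, x = fc c B ∧ B.evalTC v) (w + 1)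
  obtain ⟨I, hI, hI'⟩ := exists_mask Im (w + 1)
  have bk : ∀ x ≤ w, (bit k x ↔ S x) := fun x hx => hk' x (by omega)
  have bI : ∀ x ≤ w, (bit I x ↔ Im x) := fun x hx => hI' x (by omega)
  have bK : ∀ B, fc c B ≤ w → (bit K (fc c B) ↔ B.evalTC v) := by
    intro B hB
    rw [hK' _ (by omega)]
    exact ⟨fun ⟨B', h1, h2⟩ => by rw [fc_inj h1]; exact h2, fun h => ⟨B, rfl, h⟩⟩
  have bI' : ∀ B, fc c B ≤ w → bit I (fc c B) := fun B hB => (bI _ hB).2 ⟨B, rfl⟩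
  have Sfc : ∀ B, S (fc c B) ↔ v (.box B) := by
    intro B
    constructor
    · rintro (⟨B', h1, h2⟩ | ⟨i, h1, _⟩ | ⟨h1, _⟩)
      · rw [fc_inj h1]; exact h2
      · exact absurd (show junk (fc c B) by rw [h1]; simp [junk]) (fc_not_junk c B)
      · exact absurd ⟨B, rfl⟩ h1
    · exact fun h => .inl ⟨B, rfl, h⟩
  have Sj : ∀ i, S (Nat.pair 8 i) ↔ v (.var i) := by
    intro i
    have hj : junk (Nat.pair 8 i) := by simp [junk]
    constructor
    · rintro (⟨B', h1, h2⟩ | ⟨i', h1, h2⟩ | ⟨_, φ, h1, _⟩)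
      · rw [h1] at hj; exact absurd hj (fc_not_junk c B')
      · simp at h1; rw [h1]; exact h2
      · rw [h1] at hj; exact absurd hj (not_junk_code φ)
    · exact fun h => .inr (.inl ⟨i, rfl, h⟩)
  refine Θ.not_bell hext hcons hP w ⟨k, hk.le, K, hK.le, I, hI.le, ?_, ?_, ?_, ?_, ?_, ?_⟩
  · -- accessibility
    intro x hx x' hx' y hy i hi j hj
    by_cases h1 : Dec Θ.e x y i
    swap
    · exact .inl h1
    by_cases h2 : Dec Θ.e x' y j
    swap
    · exact .inr (.inl h2)
    by_cases h3 : cl m n i = cl m n j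
    swap
    · exact .inr (.inr (.inl h3))
    by_cases h4 : LeS m n i j
    swap
    · exact .inr (.inr (.inr (.inl h4)))
    refine .inr (.inr (.inr (.inr (imp_iff_not_or.1 ?_))))
    rw [bk x hx, bk x' hx']
    rintro (⟨B, h5, h6⟩ | ⟨p, h5, h6⟩ | ⟨h5, φ, h6, h7⟩)
    · obtain ⟨C, rfl, rfl⟩ := fc_dec h1 h5
      have h7 : x' = fc c (boxIter j C) := by rw [fc_boxIter]; exact h2.2.1
      rw [h7, Sfc]
      exact hv _ (box_steps hmn hm hn h3 h4 C) h6
    · have hxj : junk x := by rw [h5]; simp [junk]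
      have hi0 : i = 0 := by
        cases i with
        | zero => rfl
        | succ i =>
          obtain ⟨u, h8, _⟩ := h1.pred
          exact absurd hxj (by rw [h8]; exact not_junk_Psub _ _)
      subst hi0
      have hxy : x = y := h1.2.1
      subst hxy
      have hj0 : j = 0 := h2.2.2.resolve_left (not_not.2 hxj)
      subst hj0
      have hxx : x' = x := h2.2.1
      rw [hxx, h5]
      exact (Sj p).2 h6
    · subst h6
      obtain ⟨ψ, rfl, hψ⟩ := Θ.prov_root hext hcons hsound hP h1 h7
      refine .inr (.inr ⟨?_, iterPred Θ.P j ψ, ?_, Θ.prov_iter hext hcons hsound hP hψ j⟩)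
      · rintro ⟨B, hB⟩
        obtain ⟨C, h8, _⟩ := fc_dec h2 hB
        refine h5 ⟨boxIter i C, ?_⟩
        rw [fc_boxIter, ← h8]
        exact h1.2.1
      · rw [Θ.iter_code]; exact h2.2.1
  · -- refuted sentences
    intro s hs z hz y hy j hj
    by_cases h1 : s < w
    swap
    · exact .inl h1
    by_cases h2 : Dec Θ.e z y j
    swap
    · exact .inr (.inl h2)
    by_cases h3 : 1 ≤ j
    swap
    · exact .inr (.inr (.inl h3))
    refine .inr (.inr (.inr (imp_iff_not_or.1 ?_)))
    rw [bk z hz]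
    obtain ⟨j, rfl⟩ : ∃ j', j = j' + 1 := ⟨j - 1, by omega⟩
    obtain ⟨u, rfl, hu, _⟩ := h2.pred
    rintro hp (⟨B, h5, h6⟩ | ⟨p, h5, h6⟩ | ⟨h5, φ, h6, h7⟩)
    · obtain ⟨B', rfl, rfl⟩ := fc_Psub h5.symm hu
      have := hv _ (ihw s h1 (.neg (.box B')) hp).ros
      exact this h6
    · exact not_junk_Psub Θ.e u (by rw [h5]; simp [junk])
    · obtain ⟨χ, h8, h9⟩ := hP.sound hp
      have h10 : χ = .neg φ := AFml.code_inj (by rw [← h8, h6, AFml.code])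
      subst h10
      refine hcons (.mp (.mp (.taut ?_) h7) h9)
      intro v; simp only [AFml.evalProp]; tauto
  · -- proved sentences
    intro s hs x hx y hy j hj
    by_cases h1 : s < w
    swap
    · exact .inl h1
    by_cases h2 : Dec Θ.e x y j
    swap
    · exact .inr (.inl h2)
    refine .inr (.inr (imp_iff_not_or.1 ?_))
    rw [bk x hx]
    intro hp
    by_cases hIm : Im x
    · obtain ⟨B, rfl⟩ := hIm
      obtain ⟨C, rfl, rfl⟩ := fc_dec h2 rfl
      rw [Sfc]
      exact hv _ (nec_iter (ihw s h1 C hp) j).nec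
    · obtain ⟨ψ, rfl, hψ⟩ := hP.sound hp
      refine .inr (.inr ⟨hIm, iterPred Θ.P j ψ, ?_, Θ.prov_iter hext hcons hsound hP hψ j⟩)
      rw [Θ.iter_code]; exact h2.2.1
  · -- atoms
    intro x hx
    refine imp_iff_not_or.1 ?_
    rw [bI x hx]
    rintro ⟨B, rfl⟩
    cases B with
    | bot => exact .inl ⟨rfl, by rw [bK .bot hx]; exact id⟩
    | neg B => exact .inr (.inl ⟨fc c B, (le_pair_left' 2 _).trans hx, rfl⟩)
    | and B C =>
      exact .inr (.inr (.inl ⟨fc c B, (le_tag1 3 _ _).trans hx, fc c C, (le_tag2 3 _ _).trans hx,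
        .inl rfl⟩))
    | or B C =>
      exact .inr (.inr (.inl ⟨fc c B, (le_tag1 4 _ _).trans hx, fc c C, (le_tag2 4 _ _).trans hx,
        .inr (.inl rfl)⟩))
    | imp B C =>
      exact .inr (.inr (.inl ⟨fc c B, (le_tag1 5 _ _).trans hx, fc c C, (le_tag2 5 _ _).trans hx,
        .inr (.inr rfl)⟩))
    | var i =>
      have hu : Nat.pair 8 i ≤ w := (Psub_gt c _).le.trans hx
      refine .inr (.inr (.inr ⟨Nat.pair 8 i, hu, rfl, ?_⟩))
      rw [bK (.var i) hx, bk _ hu, Sj]; rfl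
    | box B =>
      have hu : fc c B ≤ w := (Psub_gt c _).le.trans hx
      refine .inr (.inr (.inr ⟨fc c B, hu, rfl, ?_⟩))
      rw [bK (.box B) hx, bk _ hu, Sfc]; rfl
  · -- connectives
    intro y hy a ha b hb
    refine imp_iff_not_or.1 ?_
    rw [bI y hy]
    rintro ⟨B, rfl⟩
    have ht := fc_tag c B
    refine ⟨imp_iff_not_or.1 fun h => ?_, imp_iff_not_or.1 fun h => ?_,
      imp_iff_not_or.1 fun h => ?_, imp_iff_not_or.1 fun h => ?_⟩
    · rw [h] at ht
      cases B <;> simp [mtag] at ht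
      rename_i B
      obtain rfl : fc c B = a := by simpa [fc] using h
      exact ⟨bI' _ ha, by rw [bK _ hy, bK _ ha]; rfl⟩
    · rw [h] at ht
      cases B <;> simp [mtag] at ht
      rename_i B C
      obtain ⟨rfl, rfl⟩ : fc c B = a ∧ fc c C = b := by simpa [fc] using h
      exact ⟨bI' _ ha, bI' _ hb, by rw [bK _ hy, bK _ ha, bK _ hb]; rfl⟩
    · rw [h] at ht
      cases B <;> simp [mtag] at ht
      rename_i B C
      obtain ⟨rfl, rfl⟩ : fc c B = a ∧ fc c C = b := by simpa [fc] using h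
      exact ⟨bI' _ ha, bI' _ hb, by rw [bK _ hy, bK _ ha, bK _ hb]; rfl⟩
    · rw [h] at ht
      cases B <;> simp [mtag] at ht
      rename_i B C
      obtain ⟨rfl, rfl⟩ : fc c B = a ∧ fc c C = b := by simpa [fc] using h
      exact ⟨bI' _ ha, bI' _ hb, by rw [bK _ hy, bK _ ha, bK _ hb]; exact imp_iff_not_or⟩
  · -- the refuted sentence
    have hle : fc c A ≤ w := hP.le hA
    exact ⟨fc c A, hle, hA, bI' A hle, by rw [bK A hle]; exact hvA⟩

end

theorem main_result (Tax : Set AFml) (hext : PA ⊆ Tax)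
    (hcons : ¬ Proves Tax botFml) (hpr : PrAxiomatized Tax)
    (hsound : Sigma1Sound Tax)
    (m n : ℕ) (hmn : m ≠ n) (hm : 1 ≤ m) (hn : 1 ≤ n) :
    ∃ P : AFml, IsSigma1 P ∧ IsProvPred Tax P ∧
      (∀ (A : MFml) (f : MFml → AFml), IsInterp P f → NAProves m n A → Proves Tax (f A)) ∧
      (∃ f : MFml → AFml, IsInterp P f ∧ ∀ A : MFml, NAProves m n A ↔ Proves Tax (f A)) := by
  obtain ⟨Prf, hP⟩ := exists_prfRel hpr
  obtain ⟨Θ⟩ := exists_Cd (m := m) (n := n) hP.dec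
  refine ⟨Θ.P, Θ.P_sigma, Θ.isProvPred hext hcons hsound hP,
    fun A f hf h => Θ.soundness hext hcons hsound hP hm hn hf h,
    itp Θ.P, Θ.itp_isInterp, fun A => ⟨fun h =>
      Θ.soundness hext hcons hsound hP hm hn Θ.itp_isInterp h, fun h => ?_⟩⟩
  obtain ⟨s, _, hs⟩ := hP.complete h 0
  rw [Θ.itp_code] at hs
  exact Θ.exact hext hcons hsound hP hmn hm hn s A hs

/-- Theorem 4.2: Suppose `m ≠ n`, `T` is `Σ₁`-sound, and `m, n ≥ 1`. Then
there is a `Σ₁` provability predicate `PR_T(x)` of `T` such that (1) `N⁺A_{m,n}` is sound for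
every arithmetical interpretation based on `PR_T(x)`, and (2) some arithmetical interpretation
based on `PR_T(x)` is exact for `N⁺A_{m,n}`. -/
theorem statement_6 (Tax : Set AFml) (hext : PA ⊆ Tax)
    (hcons : ¬ Proves Tax botFml) (hpr : PrAxiomatized Tax)
    (hsound : Sigma1Sound Tax)
    (m n : ℕ) (hmn : m ≠ n) (hm : 1 ≤ m) (hn : 1 ≤ n) :
    ∃ P : AFml, IsSigma1 P ∧ IsProvPred Tax P ∧
      (∀ (A : MFml) (f : MFml → AFml), IsInterp P f → NAProves m n A → Proves Tax (f A)) ∧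
      (∃ f : MFml → AFml, IsInterp P f ∧ ∀ A : MFml, NAProves m n A ↔ Proves Tax (f A)) := by
  exact main_result Tax hext hcons hpr hsound m n hmn hm hn

end PLN
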